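/- arXiv:1708.08338 — 5 statements merged into one kernel-verified Lean document; each statement's English description precedes it below -/
import Mathlib

section
/- Let w₁, w₂ ∈ ℤ² be linearly independent over ℝ and let σ = {a·w₁ + b·w₂ : a, b ∈ ℝ, a ≥ 0, b ≥ 0} be the strongly convex rational polyhedral cone they generate in ℝ². Then there exist integers p, q with 0 ≤ q < p and gcd(p,q) = 1, and a matrix M ∈ GL₂(ℤ), such that the image of σ under M is the cone generated by p·e₁ − q·e₂ and e₂; moreover, if σ is not the image under any element of GL₂(ℤ) of the cone generated by e₁ and e₂, then p, q can be chosen with 0 < q < p. -/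
noncomputable section

/-- The (rational polyhedral) cone generated by two vectors `v, w` in `ℝ²`:
`{a·v + b·w : a, b ≥ 0}`. -/
def coneGen (v w : Fin 2 → ℝ) : Set (Fin 2 → ℝ) :=
  {x | ∃ a b : ℝ, 0 ≤ a ∧ 0 ≤ b ∧ x = a • v + b • w}

/-- The real vector associated to an integer vector. -/
def intVec (v : Fin 2 → ℤ) : Fin 2 → ℝ := fun i => (v i : ℝ)

/-- The action of `GL₂(ℤ)` on `ℝ²` by matrix multiplication. -/
def glAct (M : Matrix.GeneralLinearGroup (Fin 2) ℤ) (x : Fin 2 → ℝ) : Fin 2 → ℝ :=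
  ((M : Matrix (Fin 2) (Fin 2) ℤ).map (Int.cast : ℤ → ℝ)).mulVec x

theorem glAct_add (M : Matrix.GeneralLinearGroup (Fin 2) ℤ) (x y : Fin 2 → ℝ) :
    glAct M (x + y) = glAct M x + glAct M y :=
  Matrix.mulVec_add _ _ _

theorem glAct_smul (M : Matrix.GeneralLinearGroup (Fin 2) ℤ) (a : ℝ) (x : Fin 2 → ℝ) :
    glAct M (a • x) = a • glAct M x :=
  Matrix.mulVec_smul _ _ _

theorem glAct_intVec (M : Matrix.GeneralLinearGroup (Fin 2) ℤ) (v : Fin 2 → ℤ) :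
    glAct M (intVec v) = intVec ((M : Matrix (Fin 2) (Fin 2) ℤ).mulVec v) := by
  ext i
  simp [glAct, intVec, Matrix.mulVec, dotProduct]

theorem glAct_inv_glAct (M : Matrix.GeneralLinearGroup (Fin 2) ℤ) (x : Fin 2 → ℝ) :
    glAct M⁻¹ (glAct M x) = x := by
  have h := congrArg (fun A : Matrix (Fin 2) (Fin 2) ℤ => A.map (Int.castRingHom ℝ)) M.inv_mul
  simp only [Matrix.map_mul, map_zero, map_one, Matrix.map_one] at h
  change Matrix.mulVec _ (Matrix.mulVec _ x) = x
  rw [Matrix.mulVec_mulVec]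
  exact (congrArg (fun A => Matrix.mulVec A x) h).trans (Matrix.one_mulVec x)

theorem glAct_inv_image_image (M : Matrix.GeneralLinearGroup (Fin 2) ℤ) (s : Set (Fin 2 → ℝ)) :
    glAct M⁻¹ '' (glAct M '' s) = s := by
  simp [Set.image_image, glAct_inv_glAct]

theorem glAct_image_coneGen (M : Matrix.GeneralLinearGroup (Fin 2) ℤ) (v w : Fin 2 → ℝ) :
    glAct M '' coneGen v w = coneGen (glAct M v) (glAct M w) := by
  ext x
  constructor
  · rintro ⟨_, ⟨a, b, ha, hb, rfl⟩, rfl⟩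
    exact ⟨a, b, ha, hb, by simp only [glAct_add, glAct_smul]⟩
  · rintro ⟨a, b, ha, hb, rfl⟩
    exact ⟨a • v + b • w, ⟨a, b, ha, hb, rfl⟩, by simp only [glAct_add, glAct_smul]⟩

theorem coneGen_smul_smul {r s : ℝ} (hr : 0 < r) (hs : 0 < s) (v w : Fin 2 → ℝ) :
    coneGen (r • v) (s • w) = coneGen v w := by
  ext x
  constructor
  · rintro ⟨a, b, ha, hb, rfl⟩
    exact ⟨a * r, b * s, by positivity, by positivity, by simp only [mul_smul]⟩
  · rintro ⟨a, b, ha, hb, rfl⟩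
    refine ⟨a / r, b / s, by positivity, by positivity, ?_⟩
    rw [smul_smul, smul_smul, div_mul_cancel₀ _ hr.ne', div_mul_cancel₀ _ hs.ne']

theorem exists_pos_smul_isCoprime {w : Fin 2 → ℤ} (hw : w ≠ 0) :
    ∃ (g : ℤ) (u : Fin 2 → ℤ), 0 < g ∧ IsCoprime (u 0) (u 1) ∧ w = g • u := by
  have hg : 0 < Int.gcd (w 0) (w 1) := by
    rw [Int.gcd_pos_iff]
    by_contra! h
    exact hw (by ext i; fin_cases i <;> simp [h.1, h.2])
  obtain ⟨a, b, hab, ha, hb⟩ := Int.exists_gcd_one hg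
  refine ⟨Int.gcd (w 0) (w 1), ![a, b], by exact_mod_cast hg, ?_, ?_⟩
  · exact Int.isCoprime_iff_gcd_eq_one.2 hab
  · ext i
    fin_cases i
    · simpa [mul_comm] using ha
    · simpa [mul_comm] using hb

theorem intVec_smul (g : ℤ) (u : Fin 2 → ℤ) : intVec (g • u) = (g : ℝ) • intVec u := by
  ext i
  simp [intVec]

theorem det_ne_zero_of_linearIndependent_intVec {u v : Fin 2 → ℤ}
    (h : LinearIndependent ℝ ![intVec u, intVec v]) : u 0 * v 1 - u 1 * v 0 ≠ 0 := by
  intro hD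
  have hD' : (u 0 : ℝ) * v 1 - u 1 * v 0 = 0 := by exact_mod_cast hD
  have hp := LinearIndependent.pair_iff.1 h
  have h1 := hp (v 1) (-u 1) (by
    ext i; fin_cases i <;> simp [intVec] <;> linarith)
  have h0 := hp (v 0) (-u 0) (by
    ext i; fin_cases i <;> simp [intVec] <;> linarith)
  apply h.ne_zero 0
  ext i
  fin_cases i
  · simpa [intVec] using h0.2
  · simpa [intVec] using h1.2

/-- An ordered pair of independent primitive vectors can be brought to the pair
`p·e₁ − q·e₂`, `e₂` with `0 ≤ q < p` coprime. -/
theorem exists_mulVec_eq_normal_form {u v : Fin 2 → ℤ} (hu : IsCoprime (u 0) (u 1))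
    (hv : IsCoprime (v 0) (v 1)) (hD : u 0 * v 1 - u 1 * v 0 ≠ 0) :
    ∃ (p q : ℤ) (M : Matrix.GeneralLinearGroup (Fin 2) ℤ), 0 ≤ q ∧ q < p ∧ IsCoprime p q ∧
      (M : Matrix (Fin 2) (Fin 2) ℤ).mulVec u = ![p, -q] ∧
      (M : Matrix (Fin 2) (Fin 2) ℤ).mulVec v = ![0, 1] := by
  obtain ⟨s, hs, hp⟩ : ∃ s : ℤ, s * s = 1 ∧ 0 < s * (u 0 * v 1 - u 1 * v 0) := by
    rcases hD.lt_or_gt with h | h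
    · exact ⟨-1, by norm_num, by linarith⟩
    · exact ⟨1, by norm_num, by linarith⟩
  obtain ⟨x, y, hxy⟩ := hv
  obtain ⟨a, b, hab⟩ := hu
  obtain ⟨p, hpdef⟩ : ∃ p, p = s * (u 0 * v 1 - u 1 * v 0) := ⟨_, rfl⟩
  rw [← hpdef] at hp
  obtain ⟨t, ht⟩ : ∃ t, t = x * u 0 + y * u 1 := ⟨_, rfl⟩
  obtain ⟨k, hk⟩ : ∃ k, k = (-t) / p := ⟨_, rfl⟩
  obtain ⟨q, hq⟩ : ∃ q, q = (-t) % p := ⟨_, rfl⟩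
  have hdiv : p * k + q = -t := by rw [hk, hq]; exact Int.mul_ediv_add_emod (-t) p
  obtain ⟨X, hX⟩ : ∃ X, X = x + k * (s * v 1) := ⟨_, rfl⟩
  obtain ⟨Y, hY⟩ : ∃ Y, Y = y - k * (s * v 0) := ⟨_, rfl⟩
  have hXYv : X * v 0 + Y * v 1 = 1 := by rw [hX, hY]; linear_combination hxy
  have hXYu : X * u 0 + Y * u 1 = -q := by
    rw [hX, hY]; linear_combination -ht + hdiv - k * hpdef
  have hdet : IsUnit (!![s * v 1, -(s * v 0); X, Y]).det := by
    rw [Matrix.det_fin_two_of]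
    exact .of_mul_eq_one s (by linear_combination hs + s * s * hXYv)
  refine ⟨p, q, Matrix.GeneralLinearGroup.mk'' _ hdet, hq ▸ Int.emod_nonneg _ hp.ne',
    hq ▸ Int.emod_lt_of_pos _ hp, ?_, ?_, ?_⟩
  · refine ⟨s * (a * Y - b * X), -(a * v 0 + b * v 1), ?_⟩
    have h0 : u 0 = s * Y * p - v 0 * q := by
      rw [hpdef]
      linear_combination (-u 0) * hXYv + v 0 * hXYu - Y * (u 0 * v 1 - u 1 * v 0) * hs
    have h1 : u 1 = -(s * X * p) - v 1 * q := by
      rw [hpdef]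
      linear_combination (-u 1) * hXYv + v 1 * hXYu + X * (u 0 * v 1 - u 1 * v 0) * hs
    linear_combination hab - a * h0 - b * h1
  · change Matrix.mulVec !![s * v 1, -(s * v 0); X, Y] u = _
    ext i
    fin_cases i
    · simp [Matrix.mulVec, dotProduct]
      linear_combination -hpdef
    · simpa [Matrix.mulVec, dotProduct] using hXYu
  · change Matrix.mulVec !![s * v 1, -(s * v 0); X, Y] v = _
    ext i
    fin_cases i
    · simp [Matrix.mulVec, dotProduct]
      ring
    · simpa [Matrix.mulVec, dotProduct] using hXYv

/-- Any strongly convex rational polyhedral cone in `ℝ²` generated by two linearly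
independent integer vectors can be brought, by an element of `GL₂(ℤ)`, to the normal
form generated by `p·e₁ − q·e₂` and `e₂` with `0 ≤ q < p` coprime; and if the cone is
not `GL₂(ℤ)`-equivalent to the cone generated by `e₁` and `e₂`, then `0 < q < p`. -/
theorem normal_form_of_two_dim_cone (w₁ w₂ : Fin 2 → ℤ)
    (hli : LinearIndependent ℝ ![intVec w₁, intVec w₂]) :
    ∃ (p q : ℤ) (M : Matrix.GeneralLinearGroup (Fin 2) ℤ),
      0 ≤ q ∧ q < p ∧ Int.gcd p q = 1 ∧
      glAct M '' coneGen (intVec w₁) (intVec w₂)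
        = coneGen ![(p : ℝ), (-q : ℝ)] ![(0 : ℝ), (1 : ℝ)] ∧
      ((¬ ∃ M' : Matrix.GeneralLinearGroup (Fin 2) ℤ,
          glAct M' '' coneGen ![(1 : ℝ), (0 : ℝ)] ![(0 : ℝ), (1 : ℝ)]
            = coneGen (intVec w₁) (intVec w₂)) → 0 < q) := by
  have hD := det_ne_zero_of_linearIndependent_intVec hli
  have hw₁ : w₁ ≠ 0 := by rintro rfl; simp at hD
  have hw₂ : w₂ ≠ 0 := by rintro rfl; simp at hD
  obtain ⟨g, u, hg, hu, rfl⟩ := exists_pos_smul_isCoprime hw₁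
  obtain ⟨h, v, hh, hv, rfl⟩ := exists_pos_smul_isCoprime hw₂
  have huv : u 0 * v 1 - u 1 * v 0 ≠ 0 := by
    intro h0
    apply hD
    simp only [Pi.smul_apply, smul_eq_mul]
    linear_combination g * h * h0
  obtain ⟨p, q, M, hq, hqp, hpq, hMu, hMv⟩ := exists_mulVec_eq_normal_form hu hv huv
  have himage : glAct M '' coneGen (intVec (g • u)) (intVec (h • v))
      = coneGen ![(p : ℝ), (-q : ℝ)] ![(0 : ℝ), (1 : ℝ)] := by
    rw [intVec_smul, intVec_smul, coneGen_smul_smul (by exact_mod_cast hg) (by exact_mod_cast hh),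
      glAct_image_coneGen, glAct_intVec, glAct_intVec, hMu, hMv]
    congr 1 <;> ext i <;> fin_cases i <;> simp [intVec]
  refine ⟨p, q, M, hq, hqp, Int.isCoprime_iff_gcd_eq_one.1 hpq, himage, fun hne => ?_⟩
  refine hq.lt_of_ne' ?_
  rintro rfl
  have hp : p = 1 := by
    rcases Int.isUnit_iff.1 (isCoprime_zero_right.1 hpq) with h1 | h1 <;> omega
  subst hp
  refine hne ⟨M⁻¹, ?_⟩
  rw [← glAct_inv_image_image M (coneGen (intVec (g • u)) (intVec (h • v))), himage]
  simp

end
end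

section
/- With the notation below, μ_n = (q, p). -/
noncomputable section

/-- Hirzebruch–Jung continued fraction value of a list of integers:
`HJ [a₂, …, a_k] = a₂ − 1/(a₃ − 1/(⋯ − 1/a_k))`. -/
def HJ : List ℤ → ℚ
  | [] => 0
  | [a] => (a : ℚ)
  | a :: b :: rest => (a : ℚ) - 1 / HJ (b :: rest)

/-- A sequence satisfying the three-term recurrence with coefficients `a 0, …, a k` has its last
term determined by its first two terms and by the continued fraction value of the coefficients,
up to a positive factor that does not depend on the sequence. -/
theorem exists_pos_eq_mul_HJ (k : ℕ) (a : ℕ → ℤ) (ha : ∀ i ≤ k, 2 ≤ a i) :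
    1 < HJ ((List.range (k + 1)).map a) ∧ ∃ D : ℚ, 0 < D ∧
      ∀ u : ℕ → ℤ, (∀ i ≤ k, u (i + 2) = a i * u (i + 1) - u i) →
        (u (k + 2) : ℚ) = D * (HJ ((List.range (k + 1)).map a) * u 1 - u 0) := by
  induction k generalizing a with
  | zero =>
    have h0 : (2 : ℚ) ≤ a 0 := by exact_mod_cast ha 0 le_rfl
    simp only [zero_add, List.range_one, List.map_cons, List.map_nil, HJ]
    refine ⟨by linarith, 1, one_pos, fun u hu => ?_⟩
    have := hu 0 le_rfl
    simp only [zero_add] at this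
    rw [this]
    push_cast
    ring
  | succ k ih =>
    obtain ⟨h1, D, hD, hu⟩ := ih (fun i => a (i + 1)) fun i hi => ha _ (by omega)
    have h0 : (2 : ℚ) ≤ a 0 := by exact_mod_cast ha 0 (by omega)
    have hstep : HJ ((List.range (k + 1 + 1)).map a)
        = a 0 - 1 / HJ ((List.range (k + 1)).map fun i => a (i + 1)) := by
      rw [List.range_succ_eq_map, List.map_cons, List.map_map]
      change HJ (a 0 :: (List.range (k + 1)).map fun i => a (i + 1)) = _
      rw [List.range_succ_eq_map, List.map_cons, HJ]
    rw [hstep]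
    set h := HJ ((List.range (k + 1)).map fun i => a (i + 1))
    have hpos : 0 < h := by linarith
    have hlt : 1 / h < 1 := (div_lt_one hpos).2 h1
    refine ⟨by linarith, D * h, mul_pos hD hpos, fun u hrec => ?_⟩
    have key := hu (fun i => u (i + 1)) fun i hi => hrec (i + 1) (by omega)
    have h2 := hrec 0 (by omega)
    simp only [zero_add, one_add_one_eq_two] at key h2
    rw [h2] at key
    rw [show k + 1 + 2 = k + 2 + 1 by ring, key]
    push_cast
    field_simp
    ring

/-- The determinant of consecutive terms of two solutions of the same three-term recurrence is
constant. -/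
theorem det_consecutive_eq (k : ℕ) (a u v : ℕ → ℤ)
    (hu : ∀ i < k, u (i + 2) = a i * u (i + 1) - u i)
    (hv : ∀ i < k, v (i + 2) = a i * v (i + 1) - v i) :
    u k * v (k + 1) - u (k + 1) * v k = u 0 * v 1 - u 1 * v 0 := by
  induction k with
  | zero => simp
  | succ k ih =>
    rw [← ih (fun i hi => hu i (by omega)) fun i hi => hv i (by omega),
      hu k (by omega), hv k (by omega)]
    ring

/-- Let `0 < q < p` be coprime integers and `a₂, …, a_{n−1}` (each `≥ 2`) the
Hirzebruch–Jung continued fraction expansion of `p/(p−q)`.  Define `μ₁ = (1,0)`,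
`μ₂ = (1,1)`, `μ_{i+1} = a_i·μ_i − μ_{i−1}` for `2 ≤ i ≤ n−1`.  Then `μ_n = (q,p)`. -/
theorem mu_last_eq (p q : ℤ) (hq : 0 < q) (hqp : q < p) (hcop : Int.gcd p q = 1)
    (n : ℕ) (hn : 3 ≤ n) (a : ℕ → ℤ)
    (ha : ∀ i, 2 ≤ i → i ≤ n - 1 → 2 ≤ a i)
    (hHJ : HJ ((List.range (n - 2)).map fun k => a (k + 2))
      = (p : ℚ) / ((p : ℚ) - (q : ℚ)))
    (μ : ℕ → ℤ × ℤ) (hμ1 : μ 1 = (1, 0)) (hμ2 : μ 2 = (1, 1))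
    (hrec : ∀ i, 2 ≤ i → i ≤ n - 1 → μ (i + 1) = a i • μ i - μ (i - 1)) :
    μ n = (q, p) := by
  obtain ⟨k, rfl⟩ : ∃ k, n = k + 3 := ⟨n - 3, by omega⟩
  have hrec' : ∀ i ≤ k, μ (i + 2 + 1) = a (i + 2) • μ (i + 1 + 1) - μ (i + 1) :=
    fun i hi => hrec (i + 2) (by omega) (by omega)
  have hx : ∀ i ≤ k, (μ (i + 2 + 1)).1 = a (i + 2) * (μ (i + 1 + 1)).1 - (μ (i + 1)).1 :=
    fun i hi => by simp [hrec' i hi]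
  have hy : ∀ i ≤ k, (μ (i + 2 + 1)).2 = a (i + 2) * (μ (i + 1 + 1)).2 - (μ (i + 1)).2 :=
    fun i hi => by simp [hrec' i hi]
  have hdet := det_consecutive_eq (k + 1) (fun i => a (i + 2)) (fun i => (μ (i + 1)).1)
    (fun i => (μ (i + 1)).2) (fun i hi => hx i (by omega)) fun i hi => hy i (by omega)
  obtain ⟨-, D, hD, hu⟩ := exists_pos_eq_mul_HJ k (fun i => a (i + 2))
    fun i hi => ha _ (by omega) (by omega)
  have hX := hu (fun i => (μ (i + 1)).1) hx
  have hY := hu (fun i => (μ (i + 1)).2) hy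
  rw [show k + 3 - 2 = k + 1 by omega] at hHJ
  simp only [hHJ, zero_add, one_add_one_eq_two, hμ1, hμ2] at hX hY hdet
  change ((μ (k + 3)).1 : ℚ) = _ at hX
  change ((μ (k + 3)).2 : ℚ) = _ at hY
  change (μ (k + 2)).1 * (μ (k + 3)).2 - (μ (k + 3)).1 * (μ (k + 2)).2 = _ at hdet
  have hq' : (0 : ℚ) < q := by exact_mod_cast hq
  have hpq : (0 : ℚ) < p - q := by
    rw [sub_pos]
    exact_mod_cast hqp
  have hp' : (0 : ℚ) < p := by linarith
  generalize μ (k + 3) = w at *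
  obtain ⟨x, y⟩ := w
  simp only at hX hY hdet
  have hy0 : 0 < y := by
    have : (0 : ℚ) < y := by
      rw [hY]
      push_cast
      rw [mul_one, sub_zero]
      positivity
    exact_mod_cast this
  have hprop : y * q = x * p := by
    have : (y : ℚ) * q = x * p := by
      rw [hX, hY]
      push_cast
      field_simp
      ring
    exact_mod_cast this
  have hpy : p ∣ y := (Int.isCoprime_iff_gcd_eq_one.2 hcop).dvd_of_dvd_mul_right ⟨x, by linarith⟩
  have hxy : IsCoprime y x := ⟨(μ (k + 2)).1, -(μ (k + 2)).2, by linarith⟩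
  have hyp : y ∣ p := hxy.dvd_of_dvd_mul_left ⟨q, hprop.symm⟩
  obtain rfl : y = p := Int.dvd_antisymm hy0.le (by omega) hyp hpy
  rw [mul_comm] at hprop
  rw [mul_right_cancel₀ hy0.ne' hprop]

end
end

section
/- With the notation below, every μ_i lies in S = σ̌ ∩ ℤ²; the additive monoid S is generated by {μ₁, …, μ_n}; and this generating set is minimal, i.e. for every i, μ_i does not lie in the additive submonoid of ℤ² generated by {μ_j : j ≠ i}. -/
noncomputable section

/-- The semigroup `S = σ̌ ∩ ℤ²` of the dual cone
`σ̌ = {(u₁,u₂) : p·u₁ − q·u₂ ≥ 0, u₂ ≥ 0}`, as a subset of `ℤ²`. -/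
def dualSemigroup (p q : ℤ) : Set (ℤ × ℤ) :=
  {u : ℤ × ℤ | 0 ≤ p * u.1 - q * u.2 ∧ 0 ≤ u.2}

theorem one_lt_HJ : ∀ l : List ℤ, l ≠ [] → (∀ x ∈ l, 2 ≤ x) → 1 < HJ l
  | [], h, _ => absurd rfl h
  | [a], _, h => by
    have ha : (2 : ℚ) ≤ a := by exact_mod_cast h a (by simp)
    simp only [HJ]
    linarith
  | a :: b :: l, _, h => by
    have ha : (2 : ℚ) ≤ a := by exact_mod_cast h a (by simp)
    have ih := one_lt_HJ (b :: l) (by simp) fun x hx => h x (List.mem_cons_of_mem a hx)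
    have hinv : 1 / HJ (b :: l) < 1 := by
      rw [div_lt_one (by linarith)]
      exact ih
    simp only [HJ]
    linarith

/-- If `f 0 / f 1` has Hirzebruch–Jung expansion `[a 0, …, a m]`, then the sequence determined by
`f (k + 2) = a k * f (k + 1) - f k` decreases strictly until it reaches `0` at index `m + 2`. -/
theorem HJ_remainders (m : ℕ) : ∀ a f : ℕ → ℤ, (∀ k ≤ m, 2 ≤ a k) →
    (∀ k ≤ m, f (k + 2) = a k * f (k + 1) - f k) →
    HJ ((List.range (m + 1)).map a) * f 1 = f 0 → 0 < f 1 →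
    f (m + 2) = 0 ∧ ∀ k ≤ m + 1, f (k + 1) < f k := by
  induction m with
  | zero =>
    intro a f ha hf h hpos
    have h0 : a 0 * f 1 = f 0 := by
      simp only [zero_add, List.range_one, List.map_cons, List.map_nil, HJ] at h
      exact_mod_cast h
    have h2 : f 2 = a 0 * f 1 - f 0 := hf 0 le_rfl
    have ha0 := ha 0 le_rfl
    refine ⟨by linarith, fun k hk => ?_⟩
    interval_cases k
    · change f 1 < f 0
      nlinarith
    · change f 2 < f 1
      linarith
  | succ m ih =>
    intro a f ha hf h hpos
    set l := (List.range (m + 1)).map fun k => a (k + 1) with hl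
    have hl_ne : l ≠ [] := by simp [hl]
    have hl_HJ : 1 < HJ l := by
      refine one_lt_HJ l hl_ne fun x hx => ?_
      obtain ⟨k, hk, rfl⟩ := List.mem_map.1 hx
      exact ha _ (by have := List.mem_range.1 hk; omega)
    have hcons : HJ ((List.range (m + 1 + 1)).map a) = a 0 - 1 / HJ l := by
      rw [List.range_succ_eq_map, List.map_cons, List.map_map]
      change HJ (a 0 :: l) = _
      obtain ⟨b, t, hbt⟩ := List.exists_cons_of_ne_nil hl_ne
      rw [hbt, HJ]
    have h2 : f 2 = a 0 * f 1 - f 0 := hf 0 (by omega)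
    have h2' : (f 2 : ℚ) = a 0 * f 1 - f 0 := by exact_mod_cast h2
    have hstep : HJ l * f 2 = f 1 := by
      rw [hcons] at h
      rw [h2', ← h]
      have : HJ l ≠ 0 := by linarith
      field_simp
      ring
    have hf1 : (0 : ℚ) < f 1 := by exact_mod_cast hpos
    have hf2 : (0 : ℚ) < f 2 := by
      by_contra! hle
      nlinarith
    have hf2' : 0 < f 2 := by exact_mod_cast hf2
    obtain ⟨hzero, hlt⟩ := ih (fun k => a (k + 1)) (fun k => f (k + 1))
      (fun k hk => ha _ (by omega)) (fun k hk => hf _ (by omega)) hstep hf2'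
    refine ⟨hzero, fun k hk => ?_⟩
    cases k with
    | zero =>
      have h21 : f 2 < f 1 := hlt 0 (by omega)
      have ha0 := ha 0 (by omega)
      change f 1 < f 0
      nlinarith
    | succ k => exact hlt k (by omega)

theorem lt_succ_of_recurrence {m : ℕ} {a y : ℕ → ℤ} (ha : ∀ k ≤ m, 2 ≤ a k)
    (hy : ∀ k ≤ m, y (k + 2) = a k * y (k + 1) - y k) (h0 : 0 ≤ y 0) (h1 : y 0 < y 1) :
    ∀ k ≤ m + 1, 0 ≤ y k ∧ y k < y (k + 1) := by
  intro k
  induction k with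
  | zero => exact fun _ => ⟨h0, h1⟩
  | succ k ih =>
    intro hk
    obtain ⟨hnn, hlt⟩ := ih (by omega)
    have := ha k (by omega)
    refine ⟨by omega, ?_⟩
    rw [hy k (by omega)]
    nlinarith

theorem lt_of_lt_succ_of_le {y : ℕ → ℤ} {N : ℕ} (h : ∀ k < N, y k < y (k + 1)) {i j : ℕ}
    (hij : i < j) (hj : j ≤ N) : y i < y j := by
  induction j, hij using Nat.le_induction with
  | base => exact h i (by omega)
  | succ j hij ih => exact (ih (by omega)).trans (h j (by omega))

/-- Consecutive members of a two-term recurrence with unit trailing coefficient keep their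
determinant. -/
theorem det_eq_one_of_recurrence {m : ℕ} {a x y : ℕ → ℤ}
    (hx : ∀ k ≤ m, x (k + 2) = a k * x (k + 1) - x k)
    (hy : ∀ k ≤ m, y (k + 2) = a k * y (k + 1) - y k) (h0 : x 0 * y 1 - x 1 * y 0 = 1) :
    ∀ k ≤ m + 1, x k * y (k + 1) - x (k + 1) * y k = 1 := by
  intro k
  induction k with
  | zero => exact fun _ => h0
  | succ k ih =>
    intro hk
    rw [hx k (by omega), hy k (by omega)]
    linear_combination ih (by omega)

theorem exists_sign_change {d : ℕ → ℤ} {N : ℕ} (h0 : 0 ≤ d 0) (hN : d (N + 1) ≤ 0) :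
    ∃ k ≤ N, 0 ≤ d k ∧ d (k + 1) ≤ 0 := by
  induction N with
  | zero => exact ⟨0, le_rfl, h0, hN⟩
  | succ N ih =>
    rcases le_total (d (N + 1)) 0 with h | h
    · obtain ⟨k, hk, hd⟩ := ih h
      exact ⟨k, by omega, hd⟩
    · exact ⟨N + 1, le_rfl, h, hN⟩

/-- The dual semigroup as an additive submonoid. -/
def dualSubmonoid (p q : ℤ) : AddSubmonoid (ℤ × ℤ) where
  carrier := dualSemigroup p q
  zero_mem' := by simp [dualSemigroup]
  add_mem' := by
    rintro u v ⟨hu, hu'⟩ ⟨hv, hv'⟩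
    refine ⟨?_, add_nonneg hu' hv'⟩
    simp only [Prod.fst_add, Prod.snd_add]
    linarith

/-- In the dual semigroup, `w ≠ 0` is not a sum of elements each of which exceeds `w` in one of
the two coordinates `p * u.1 - q * u.2` and `u.2`. -/
theorem notMem_closure_of_forall_lt {p q : ℤ} {w : ℤ × ℤ} {s : Set (ℤ × ℤ)} (hw : w ≠ 0)
    (hs : s ⊆ dualSemigroup p q)
    (hlt : ∀ v ∈ s, w.2 < v.2 ∨ p * w.1 - q * w.2 < p * v.1 - q * v.2) :
    w ∉ AddSubmonoid.closure s := by
  intro hmem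
  have key : ∀ v ∈ AddSubmonoid.closure s, v ∈ dualSemigroup p q ∧
      (v = 0 ∨ w.2 < v.2 ∨ p * w.1 - q * w.2 < p * v.1 - q * v.2) := by
    intro v hv
    induction hv using AddSubmonoid.closure_induction with
    | mem v hv => exact ⟨hs hv, .inr (hlt v hv)⟩
    | zero => exact ⟨(dualSubmonoid p q).zero_mem, .inl rfl⟩
    | add u v _ _ hu hv =>
      obtain ⟨hu, hu'⟩ := hu
      obtain ⟨hv, hv'⟩ := hv
      refine ⟨(dualSubmonoid p q).add_mem hu hv, ?_⟩
      obtain ⟨hu₁, hu₂⟩ := hu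
      obtain ⟨hv₁, hv₂⟩ := hv
      rcases hu' with rfl | hu' | hu'
      · simpa using hv'
      · refine .inr (.inl ?_)
        simp only [Prod.snd_add]
        linarith
      · refine .inr (.inr ?_)
        simp only [Prod.fst_add, Prod.snd_add]
        linarith
  rcases (key w hmem).2 with h | h | h
  · exact hw h
  · exact lt_irrefl _ h
  · exact lt_irrefl _ h

/-- With `0 < q < p` coprime, `a₂, …, a_{n−1}` the Hirzebruch–Jung expansion of
`p/(p−q)` and `μ₁ = (1,0)`, `μ₂ = (1,1)`, `μ_{i+1} = a_i·μ_i − μ_{i−1}`: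
every `μ_i` lies in `S = σ̌ ∩ ℤ²`, the additive monoid `S` is generated by
`{μ₁, …, μ_n}`, and this generating set is minimal. -/
theorem mu_minimal_generators (p q : ℤ) (hq : 0 < q) (hqp : q < p)
    (hcop : Int.gcd p q = 1)
    (n : ℕ) (hn : 3 ≤ n) (a : ℕ → ℤ)
    (ha : ∀ i, 2 ≤ i → i ≤ n - 1 → 2 ≤ a i)
    (hHJ : HJ ((List.range (n - 2)).map fun k => a (k + 2))
      = (p : ℚ) / ((p : ℚ) - (q : ℚ)))
    (μ : ℕ → ℤ × ℤ) (hμ1 : μ 1 = (1, 0)) (hμ2 : μ 2 = (1, 1))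
    (hrec : ∀ i, 2 ≤ i → i ≤ n - 1 → μ (i + 1) = a i • μ i - μ (i - 1)) :
    (∀ i, 1 ≤ i → i ≤ n → μ i ∈ dualSemigroup p q) ∧
    (AddSubmonoid.closure {v : ℤ × ℤ | ∃ i, 1 ≤ i ∧ i ≤ n ∧ v = μ i} : Set (ℤ × ℤ))
      = dualSemigroup p q ∧
    (∀ i, 1 ≤ i → i ≤ n →
      μ i ∉ AddSubmonoid.closure {v : ℤ × ℤ | ∃ j, 1 ≤ j ∧ j ≤ n ∧ j ≠ i ∧ v = μ j}) := by
  obtain ⟨m, rfl⟩ : ∃ m, n = m + 3 := ⟨n - 3, by omega⟩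
  have hp : 0 < p := hq.trans hqp
  set x : ℕ → ℤ := fun k => (μ (k + 1)).1 with hx_def
  set y : ℕ → ℤ := fun k => (μ (k + 1)).2 with hy_def
  have hμ (k : ℕ) : μ (k + 1) = (x k, y k) := rfl
  have hx0 : x 0 = 1 := by simp [hx_def, hμ1]
  have hx1 : x 1 = 1 := by simp [hx_def, hμ2]
  have hy0 : y 0 = 0 := by simp [hy_def, hμ1]
  have hy1 : y 1 = 1 := by simp [hy_def, hμ2]
  have ha' : ∀ k ≤ m, 2 ≤ a (k + 2) := fun k hk => ha _ (by omega) (by omega)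
  have hrec' : ∀ k ≤ m, μ (k + 2 + 1) = a (k + 2) • μ (k + 1 + 1) - μ (k + 1) :=
    fun k hk => hrec (k + 2) (by omega) (by omega)
  have hx : ∀ k ≤ m, x (k + 2) = a (k + 2) * x (k + 1) - x k := fun k hk => by
    simpa using congrArg Prod.fst (hrec' k hk)
  have hy : ∀ k ≤ m, y (k + 2) = a (k + 2) * y (k + 1) - y k := fun k hk => by
    simpa using congrArg Prod.snd (hrec' k hk)
  have hy_lt := lt_succ_of_recurrence ha' hy hy0.ge (by omega)
  have hdet := det_eq_one_of_recurrence hx hy (by simp [hx0, hy0, hy1])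
  obtain ⟨hf_last, hf_lt⟩ := HJ_remainders m (fun k => a (k + 2)) (fun k => p * x k - q * y k) ha'
    (fun k hk => by
      simp only [hx k hk, hy k hk]
      ring)
    (by
      have hpq : (p : ℚ) - q ≠ 0 := by
        rw [sub_ne_zero]
        exact_mod_cast hqp.ne'
      rw [show m + 1 = m + 3 - 2 by omega, hHJ]
      simp only [hx0, hx1, hy0, hy1]
      push_cast
      field_simp
      ring)
    (by simp only [hx1, hy1]; linarith)
  have hy_mono {i j : ℕ} (hij : i < j) (hj : j ≤ m + 2) : y i < y j :=
    lt_of_lt_succ_of_le (fun k hk => (hy_lt k (by omega)).2) hij hj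
  have hf_anti {i j : ℕ} (hij : i < j) (hj : j ≤ m + 2) :
      p * x j - q * y j < p * x i - q * y i :=
    neg_lt_neg_iff.1 <| lt_of_lt_succ_of_le (y := fun k => -(p * x k - q * y k))
      (fun k hk => neg_lt_neg (hf_lt k (by omega))) hij hj
  have hmem : ∀ i, 1 ≤ i → i ≤ m + 3 → μ i ∈ dualSemigroup p q := by
    intro i hi hin
    obtain ⟨k, rfl⟩ := Nat.exists_eq_add_of_le' hi
    refine ⟨?_, ?_⟩
    · rcases (show k ≤ m + 2 by omega).eq_or_lt with rfl | hk
      · exact hf_last.ge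
      · exact (hf_last.symm.trans_lt (hf_anti hk le_rfl)).le
    · rcases k.eq_zero_or_pos with rfl | hk
      · exact hy0.ge
      · exact (hy0.symm.trans_lt (hy_mono hk (by omega))).le
  refine ⟨hmem, subset_antisymm ?_ ?_, ?_⟩
  · refine (AddSubmonoid.closure_le (S := dualSubmonoid p q)).2 ?_
    rintro _ ⟨i, hi, hin, rfl⟩
    exact hmem i hi hin
  · rintro ⟨u₁, u₂⟩ ⟨hu₁, hu₂⟩
    simp only at hu₁ hu₂
    obtain ⟨k, hk, hd, hd'⟩ := exists_sign_change (d := fun k => x k * u₂ - y k * u₁) (N := m + 1)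
      (by simpa [hx0, hy0] using hu₂) (by
        have hy_nonneg : 0 ≤ y (m + 2) := (hmem (m + 3) (by omega) le_rfl).2
        refine nonpos_of_mul_nonpos_right (a := p) ?_ hp
        nlinarith [mul_nonneg hy_nonneg hu₁])
    have hcomb : (u₁, u₂) = (-(x (k + 1) * u₂ - y (k + 1) * u₁)).toNat • μ (k + 1) +
        (x k * u₂ - y k * u₁).toNat • μ (k + 1 + 1) := by
      rw [← natCast_zsmul, ← natCast_zsmul, Int.toNat_of_nonneg (by linarith),
        Int.toNat_of_nonneg hd, hμ, hμ]
      ext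
      · simp only [Prod.smul_mk, Prod.mk_add_mk, smul_eq_mul]
        linear_combination (-u₁) * hdet k hk
      · simp only [Prod.smul_mk, Prod.mk_add_mk, smul_eq_mul]
        linear_combination (-u₂) * hdet k hk
    have hgen (j : ℕ) (hj : j ≤ m + 2) :
        μ (j + 1) ∈ AddSubmonoid.closure {v : ℤ × ℤ | ∃ i, 1 ≤ i ∧ i ≤ m + 3 ∧ v = μ i} :=
      AddSubmonoid.subset_closure ⟨j + 1, by omega, by omega, rfl⟩
    rw [hcomb]
    exact add_mem (nsmul_mem (hgen k (by omega)) _) (nsmul_mem (hgen (k + 1) (by omega)) _)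
  · intro i hi hin
    obtain ⟨k, rfl⟩ := Nat.exists_eq_add_of_le' hi
    refine notMem_closure_of_forall_lt (p := p) (q := q) ?_ ?_ ?_
    · intro h0
      rcases k.eq_zero_or_pos with rfl | hk
      · simp [hμ1] at h0
      · have := hy_mono hk (by omega)
        have hyk : y k = 0 := congrArg Prod.snd h0
        omega
    · rintro _ ⟨j, hj, hjn, -, rfl⟩
      exact hmem j hj hjn
    · rintro _ ⟨j, hj, hjn, hne, rfl⟩
      obtain ⟨l, rfl⟩ := Nat.exists_eq_add_of_le' hj
      rcases lt_or_gt_of_ne hne with h | h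
      · exact .inr (hf_anti (by omega) (by omega))
      · exact .inl (hy_mono (by omega) (by omega))

end
end

section
/- Let a₂, a₃ ≥ 2 be integers and let p, q be the coprime integers with 0 < q < p determined by p/(p−q) = a₂ − 1/a₃. Let π : ℂ[z₁,z₂,z₃,z₄] → ℂ[t₁,t₂] be the ℂ-algebra homomorphism with π(z_i) = t₁^{μ_i¹}·t₂^{μ_i²}, where μ₁ = (1,0), μ₂ = (1,1), μ₃ = a₂·μ₂ − μ₁ and μ₄ = a₃·μ₃ − μ₂. Then ker π is the ideal generated by the three 2×2 minors of the 2×3 matrix with rows (z₁, z₂, z₃^{a₃−1}) and (z₂^{a₂−1}, z₃, z₄), namely z₁·z₃ − z₂^{a₂}, z₁·z₄ − z₂^{a₂−1}·z₃^{a₃−1} and z₂·z₄ − z₃^{a₃}. In particular the corresponding toric surface (of embedding dimension 4) is a determinantal surface. -/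
noncomputable section

open MvPolynomial

/-- If `x₀x₂ = x₁^(a+1)`, `x₀x₃ = x₁^a x₂^b` and `x₁x₃ = x₂^(b+1)`, then every monomial in the `xᵢ`
equals one of the same bidegree that is divisible by none of `x₀x₂`, `x₀x₃`, `x₁x₃`. -/
theorem exists_normal_monomial {R : Type*} [CommRing R] (a b : ℕ) (x₀ x₁ x₂ x₃ : R)
    (h₀₂ : x₀ * x₂ = x₁ ^ (a + 1)) (h₀₃ : x₀ * x₃ = x₁ ^ a * x₂ ^ b)
    (h₁₃ : x₁ * x₃ = x₂ ^ (b + 1)) (n i j k l : ℕ) (hn : i + l = n) :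
    ∃ i' j' k' l' : ℕ, (i' = 0 ∨ k' = 0) ∧ (i' = 0 ∨ l' = 0) ∧ (j' = 0 ∨ l' = 0) ∧
      x₀ ^ i * x₁ ^ j * x₂ ^ k * x₃ ^ l = x₀ ^ i' * x₁ ^ j' * x₂ ^ k' * x₃ ^ l' ∧
      (k + (b + 1) * l - i : ℤ) = k' + (b + 1) * l' - i' ∧
      (l - (a + 1) * i - j : ℤ) = l' - (a + 1) * i' - j' := by
  induction n using Nat.strong_induction_on generalizing i j k l with
  | _ n ih =>
    by_cases c₀₂ : i = 0 ∨ k = 0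
    · by_cases c₀₃ : i = 0 ∨ l = 0
      · by_cases c₁₃ : j = 0 ∨ l = 0
        · exact ⟨i, j, k, l, c₀₂, c₀₃, c₁₃, rfl, rfl, rfl⟩
        · push Not at c₁₃
          obtain ⟨j, rfl⟩ := Nat.exists_eq_add_one_of_ne_zero c₁₃.1
          obtain ⟨l, rfl⟩ := Nat.exists_eq_add_one_of_ne_zero c₁₃.2
          obtain ⟨i', j', k', l', h1, h2, h3, h, hD, hT⟩ :=
            ih (i + l) (by omega) i j (k + (b + 1)) l rfl
          refine ⟨i', j', k', l', h1, h2, h3, ?_, ?_, ?_⟩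
          · rw [← h, pow_add x₂ k (b + 1), ← h₁₃]; ring
          · rw [← hD]; push_cast; ring
          · rw [← hT]; push_cast; ring
      · push Not at c₀₃
        obtain ⟨i, rfl⟩ := Nat.exists_eq_add_one_of_ne_zero c₀₃.1
        obtain ⟨l, rfl⟩ := Nat.exists_eq_add_one_of_ne_zero c₀₃.2
        obtain ⟨i', j', k', l', h1, h2, h3, h, hD, hT⟩ :=
          ih (i + l) (by omega) i (j + a) (k + b) l rfl
        refine ⟨i', j', k', l', h1, h2, h3, ?_, ?_, ?_⟩
        · rw [← h]
          linear_combination x₀ ^ i * x₁ ^ j * x₂ ^ k * x₃ ^ l * h₀₃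
        · rw [← hD]; push_cast; ring
        · rw [← hT]; push_cast; ring
    · push Not at c₀₂
      obtain ⟨i, rfl⟩ := Nat.exists_eq_add_one_of_ne_zero c₀₂.1
      obtain ⟨k, rfl⟩ := Nat.exists_eq_add_one_of_ne_zero c₀₂.2
      obtain ⟨i', j', k', l', h1, h2, h3, h, hD, hT⟩ :=
        ih (i + l) (by omega) i (j + (a + 1)) k l rfl
      refine ⟨i', j', k', l', h1, h2, h3, ?_, ?_, ?_⟩
      · rw [← h, pow_add x₁ j (a + 1), ← h₀₂]; ring
      · rw [← hD]; push_cast; ring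
      · rw [← hT]; push_cast; ring

/-- A monomial divisible by none of `x₀x₂`, `x₀x₃`, `x₁x₃` is determined by its bidegree. -/
theorem normal_exponents_unique (a b i j k l i' j' k' l' : ℕ)
    (h1 : i = 0 ∨ k = 0) (h2 : i = 0 ∨ l = 0) (h3 : j = 0 ∨ l = 0)
    (h1' : i' = 0 ∨ k' = 0) (h2' : i' = 0 ∨ l' = 0) (h3' : j' = 0 ∨ l' = 0)
    (hD : (k + (b + 1) * l - i : ℤ) = k' + (b + 1) * l' - i')
    (hT : (l - (a + 1) * i - j : ℤ) = l' - (a + 1) * i' - j') :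
    i = i' ∧ j = j' ∧ k = k' ∧ l = l' := by
  have key : i = i' ∧ l = l' := by
    have p1 : (0 : ℤ) ≤ b * l := by positivity
    have p2 : (0 : ℤ) ≤ b * l' := by positivity
    have p3 : (0 : ℤ) ≤ a * i := by positivity
    have p4 : (0 : ℤ) ≤ a * i' := by positivity
    have hi : i = i' := by
      rcases h1 with rfl | rfl <;> rcases h2 with h2 | rfl <;>
        rcases h1' with rfl | rfl <;> rcases h2' with h2' | rfl <;> lia
    subst hi
    exact ⟨rfl, by lia⟩
  obtain ⟨rfl, rfl⟩ := key
  exact ⟨rfl, by lia, by lia, rfl⟩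

/-- Monomials of the same bidegree in elements satisfying the relations of the three minors
are equal. -/
theorem monomial_eq_of_bidegree_eq {R : Type*} [CommRing R] (a b : ℕ) (x₀ x₁ x₂ x₃ : R)
    (h₀₂ : x₀ * x₂ = x₁ ^ (a + 1)) (h₀₃ : x₀ * x₃ = x₁ ^ a * x₂ ^ b)
    (h₁₃ : x₁ * x₃ = x₂ ^ (b + 1)) (i j k l i' j' k' l' : ℕ)
    (hD : (k + (b + 1) * l - i : ℤ) = k' + (b + 1) * l' - i')
    (hT : (l - (a + 1) * i - j : ℤ) = l' - (a + 1) * i' - j') :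
    x₀ ^ i * x₁ ^ j * x₂ ^ k * x₃ ^ l = x₀ ^ i' * x₁ ^ j' * x₂ ^ k' * x₃ ^ l' := by
  obtain ⟨_, _, _, _, u1, u2, u3, hu, uD, uT⟩ :=
    exists_normal_monomial a b x₀ x₁ x₂ x₃ h₀₂ h₀₃ h₁₃ _ i j k l rfl
  obtain ⟨_, _, _, _, v1, v2, v3, hv, vD, vT⟩ :=
    exists_normal_monomial a b x₀ x₁ x₂ x₃ h₀₂ h₀₃ h₁₃ _ i' j' k' l' rfl
  obtain ⟨rfl, rfl, rfl, rfl⟩ := normal_exponents_unique a b _ _ _ _ _ _ _ _ u1 u2 u3 v1 v2 v3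
    (uD.symm.trans (hD.trans vD)) (uT.symm.trans (hT.trans vT))
  rw [hu, hv]

/-- Let `φ` be a linear map sending monomials to monomials via `e`. If an ideal `I` contains the
difference of any two monomials with the same image, then it contains the kernel of `φ`. -/
theorem mem_of_map_eq_zero_of_monomial {σ τ K : Type*} [CommRing K]
    (φ : MvPolynomial σ K →ₗ[K] MvPolynomial τ K) (e : (σ →₀ ℕ) → (τ →₀ ℕ))
    (hφ : ∀ m, φ (monomial m 1) = monomial (e m) 1) (I : Ideal (MvPolynomial σ K))
    (hI : ∀ m m', e m = e m' → (monomial m 1 - monomial m' 1 : MvPolynomial σ K) ∈ I)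
    {f : MvPolynomial σ K} (hf : φ f = 0) : f ∈ I := by
  let s : MvPolynomial τ K →ₗ[K] MvPolynomial σ K :=
    (basisMonomials τ K).constr K (fun v => monomial (Function.invFun e v) 1)
  have hs : ∀ v, s (monomial v 1) = monomial (Function.invFun e v) 1 := fun v => by
    simpa using (basisMonomials τ K).constr_basis K
      (fun v => (monomial (Function.invFun e v) 1 : MvPolynomial σ K)) v
  have hmem : ∀ g, g - s (φ g) ∈ I := fun g => by
    induction g using MvPolynomial.induction_on' with
    | monomial m c =>
      have hc : (monomial m c : MvPolynomial σ K) = c • monomial m 1 := by simp [smul_monomial]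
      rw [hc, map_smul, map_smul, ← smul_sub, hφ, hs]
      exact Submodule.smul_of_tower_mem I c
        (hI _ _ (Function.invFun_eq ⟨m, rfl⟩).symm)
    | add p q hp hq =>
      rw [map_add, map_add, add_sub_add_comm]
      exact I.add_mem hp hq
  simpa [hf] using hmem f

/-- For `a₂, a₃ ≥ 2` and `p, q` coprime with `0 < q < p` determined by
`p/(p−q) = a₂ − 1/a₃`, the kernel of the monomial map
`π : ℂ[z₁,z₂,z₃,z₄] → ℂ[t₁,t₂]`, `z_i ↦ t₁^{μ_i¹} t₂^{μ_i²}` (with `μ₁ = (1,0)`,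
`μ₂ = (1,1)`, `μ₃ = a₂·μ₂ − μ₁`, `μ₄ = a₃·μ₃ − μ₂`), is the ideal generated by the
three `2×2` minors of the matrix with rows `(z₁, z₂, z₃^{a₃−1})`, `(z₂^{a₂−1}, z₃, z₄)`:
so the associated toric surface of embedding dimension 4 is determinantal. -/
theorem kernel_embdim_four_determinantal (a₂ a₃ : ℕ) (h₂ : 2 ≤ a₂) (h₃ : 2 ≤ a₃)
    (p q : ℤ) (hq : 0 < q) (hqp : q < p) (hcop : Int.gcd p q = 1)
    (hfrac : (p : ℚ) / ((p : ℚ) - (q : ℚ)) = (a₂ : ℚ) - 1 / (a₃ : ℚ))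
    (μ : Fin 4 → ℤ × ℤ)
    (hμ1 : μ 0 = (1, 0)) (hμ2 : μ 1 = (1, 1))
    (hμ3 : μ 2 = (a₂ : ℤ) • μ 1 - μ 0) (hμ4 : μ 3 = (a₃ : ℤ) • μ 2 - μ 1) :
    RingHom.ker (MvPolynomial.aeval (fun i : Fin 4 =>
        (X 0 : MvPolynomial (Fin 2) ℂ) ^ (μ i).1.toNat * X 1 ^ (μ i).2.toNat) :
        MvPolynomial (Fin 4) ℂ →ₐ[ℂ] MvPolynomial (Fin 2) ℂ)
      = Ideal.span ({X 0 * X 2 - X 1 ^ a₂,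
          X 0 * X 3 - X 1 ^ (a₂ - 1) * X 2 ^ (a₃ - 1),
          X 1 * X 3 - X 2 ^ a₃} : Set (MvPolynomial (Fin 4) ℂ)) := by
  obtain ⟨a, rfl⟩ : ∃ a, a₂ = a + 1 + 1 := ⟨a₂ - 2, by omega⟩
  obtain ⟨b, rfl⟩ : ∃ b, a₃ = b + 1 + 1 := ⟨a₃ - 2, by omega⟩
  have hμ3' : μ 2 = (((a + 1 : ℕ) : ℤ), ((a + 2 : ℕ) : ℤ)) := by
    rw [hμ3, hμ1, hμ2]
    ext <;> simp <;> ring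
  have hμ4' : μ 3 = (((a * b + b + 2 * a + 1 : ℕ) : ℤ),
      ((a * b + 2 * b + 2 * a + 3 : ℕ) : ℤ)) := by
    rw [hμ4, hμ3', hμ2]
    ext <;> simp <;> ring
  simp only [Nat.add_sub_cancel]
  set I : Ideal (MvPolynomial (Fin 4) ℂ) := Ideal.span _ with hIdef
  set π : MvPolynomial (Fin 4) ℂ →ₐ[ℂ] MvPolynomial (Fin 2) ℂ := aeval _ with hπ
  have π0 : π (X 0) = X 0 := by simp [hπ, hμ1]
  have π1 : π (X 1) = X 0 * X 1 := by simp [hπ, hμ2]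
  have π2 : π (X 2) = X 0 ^ (a + 1) * X 1 ^ (a + 2) := by
    simp only [hπ, aeval_X, hμ3', Int.toNat_natCast]
  have π3 : π (X 3) = X 0 ^ (a * b + b + 2 * a + 1) * X 1 ^ (a * b + 2 * b + 2 * a + 3) := by
    simp only [hπ, aeval_X, hμ4', Int.toNat_natCast]
  apply le_antisymm
  · intro f hf
    let e : (Fin 4 →₀ ℕ) → (Fin 2 →₀ ℕ) := fun m =>
      Finsupp.single 0 (m 0 + m 1 + (a + 1) * m 2 + (a * b + b + 2 * a + 1) * m 3) +
      Finsupp.single 1 (m 1 + (a + 2) * m 2 + (a * b + 2 * b + 2 * a + 3) * m 3)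
    have hmon : ∀ m : Fin 4 →₀ ℕ, (monomial m 1 : MvPolynomial (Fin 4) ℂ) =
        X 0 ^ m 0 * X 1 ^ m 1 * X 2 ^ m 2 * X 3 ^ m 3 := fun m => by
      rw [monomial_eq, Finsupp.prod_fintype _ _ (by simp)]
      simp [Fin.prod_univ_four]
    refine mem_of_map_eq_zero_of_monomial π.toLinearMap e (fun m => ?_) I (fun m m' h => ?_) hf
    · have he : (monomial (e m) 1 : MvPolynomial (Fin 2) ℂ) =
          X 0 ^ (m 0 + m 1 + (a + 1) * m 2 + (a * b + b + 2 * a + 1) * m 3) *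
          X 1 ^ (m 1 + (a + 2) * m 2 + (a * b + 2 * b + 2 * a + 3) * m 3) := by
        rw [X_pow_eq_monomial, X_pow_eq_monomial, monomial_mul, one_mul]
      rw [he, hmon, AlgHom.toLinearMap_apply]
      simp only [map_mul, map_pow, π0, π1, π2, π3]
      ring
    · have e0 := DFunLike.congr_fun h 0
      have e1 := DFunLike.congr_fun h 1
      simp only [e, Finsupp.add_apply, Finsupp.single_apply] at e0 e1
      simp only [if_true, one_ne_zero, zero_ne_one, if_false, add_zero, zero_add] at e0 e1
      zify at e0 e1
      rw [← Ideal.Quotient.eq, hmon, hmon]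
      simp only [map_mul, map_pow]
      apply monomial_eq_of_bidegree_eq (a + 1) (b + 1)
      · rw [← map_mul, ← map_pow, Ideal.Quotient.eq]
        exact Ideal.subset_span (by simp)
      · rw [← map_mul, ← map_pow, ← map_pow, ← map_mul, Ideal.Quotient.eq]
        exact Ideal.subset_span (by simp)
      · rw [← map_mul, ← map_pow, Ideal.Quotient.eq]
        exact Ideal.subset_span (by simp)
      · push_cast
        linear_combination e1 - e0
      · push_cast
        linear_combination (a + 1 : ℤ) * e1 - (a + 2 : ℤ) * e0
  · rw [hIdef, Ideal.span_le]
    rintro f (rfl | rfl | rfl) <;>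
      simp only [SetLike.mem_coe, RingHom.mem_ker, map_sub, map_mul, map_pow, π0, π1, π2, π3] <;>
      ring

end
end

section
/- Let f, f' ∈ ℂ[x₁,…,x_d] vanish at the origin, suppose both are non-degenerate, both have an isolated critical point at the origin, and Γ₊(f) = Γ₊(f'). Then μ(f) = μ(f'). In particular, for a family f_t = f + Σ_{j=1}^{r} θ_j(t)·h_j of non-degenerate polynomials with an isolated critical point at 0 satisfying Γ₊(f_t) = Γ₊(f) for all t ∈ ℂ, the Milnor number μ(f_t) is independent of t. -/
noncomputable section

open MvPolynomial

/-- The Newton polygon `Γ₊(f) ⊂ ℝ^d` of a polynomial `f`: the convex hull of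
`⋃_{v ∈ supp f} (v + ℝ≥0^d)`. -/
def NewtonPolygon {d : ℕ} (f : MvPolynomial (Fin d) ℂ) : Set (Fin d → ℝ) :=
  convexHull ℝ {x | ∃ m ∈ f.support, ∃ y : Fin d → ℝ,
    (∀ i, 0 ≤ y i) ∧ x = (fun i => (m i : ℝ)) + y}

open Classical in
/-- The face part `f_γ = Σ_{v ∈ γ ∩ ℕ^d} a_v x^v` of `f` along a face `γ`. -/
def facePart {d : ℕ} (f : MvPolynomial (Fin d) ℂ) (γ : Set (Fin d → ℝ)) :
    MvPolynomial (Fin d) ℂ :=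
  ∑ m ∈ f.support, if (fun i => (m i : ℝ)) ∈ γ then monomial m (coeff m f) else 0

/-- `f` is non-degenerate (for its Newton polygon) if for every nonempty compact
exposed face `γ` of `Γ₊(f)` there is no point `x` of the torus `(ℂ∖{0})^d` with
`f_γ(x) = 0` and `∂f_γ/∂x_i(x) = 0` for all `i`. -/
def NonDegenerate {d : ℕ} (f : MvPolynomial (Fin d) ℂ) : Prop :=
  ∀ γ : Set (Fin d → ℝ), IsExposed ℝ (NewtonPolygon f) γ → IsCompact γ → γ.Nonempty →
    ¬ ∃ x : Fin d → ℂ, (∀ i, x i ≠ 0) ∧ eval x (facePart f γ) = 0 ∧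
      ∀ i, eval x (pderiv i (facePart f γ)) = 0

/-- `f` has an isolated critical point at the origin: the origin is a critical point
of `f` and it is isolated in the critical set. -/
def IsolatedCriticalPointAtZero {d : ℕ} (f : MvPolynomial (Fin d) ℂ) : Prop :=
  (∀ i, eval (0 : Fin d → ℂ) (pderiv i f) = 0) ∧
  ∃ U ∈ nhds (0 : Fin d → ℂ), ∀ x ∈ U, (∀ i, eval x (pderiv i f) = 0) → x = 0

/-- The Milnor number `μ(f) = dim_ℂ ℂ⟦x₁,…,x_d⟧/(∂f/∂x₁,…,∂f/∂x_d)`. -/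
def milnor {d : ℕ} (f : MvPolynomial (Fin d) ℂ) : ℕ :=
  Module.finrank ℂ (MvPowerSeries (Fin d) ℂ ⧸
    Ideal.span {g : MvPowerSeries (Fin d) ℂ | ∃ i, g = ↑(pderiv i f)})

section Regular

open RingTheory.Sequence IsLocalRing Pointwise

theorem le_coheight_of_isAssociatedPrime {R : Type*} [CommRing R] [IsNoetherianRing R]
    [IsLocalRing R] (n : ℕ) : ∀ (M : Type _) [AddCommGroup M] [Module R M] [Module.Finite R M]
    (rs : List R), rs.length = n → IsRegular M rs → (∀ r ∈ rs, r ∈ maximalIdeal R) →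
    ∀ P : PrimeSpectrum R, IsAssociatedPrime P.asIdeal M → (n : ℕ∞) ≤ Order.coheight P := by
  induction n with
  | zero => intros; simp
  | succ n ih =>
    intro M _ _ _ rs hlen hreg hmem P hP
    obtain ⟨a, rs, rfl⟩ : ∃ a rs', rs = a :: rs' := by
      cases rs with
      | nil => simp at hlen
      | cons a l => exact ⟨a, l, rfl⟩
    rw [isRegular_cons_iff] at hreg
    obtain ⟨hPp, z, hz⟩ := isAssociatedPrime_iff.mp hP
    have memP : ∀ p, p ∈ P.asIdeal ↔ p • z = 0 := by
      intro p; rw [hz]; simp [Submodule.mem_colon_singleton]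
    have hz0 : z ≠ 0 := by
      rintro rfl
      exact hPp.ne_top ((Ideal.eq_top_iff_one _).mpr ((memP 1).mpr (smul_zero _)))
    have haP : a ∉ P.asIdeal := fun h => hz0 (hreg.1 (by simpa using (memP a).mp h))
    let N : Submodule R M := Submodule.torsionBySet R M (P.asIdeal : Set R)
    have hN : ∃ y ∈ N, y ∉ a • (⊤ : Submodule R M) := by
      by_contra! hcon
      have hle : N ≤ Ideal.span {a} • N := by
        intro y hy
        obtain ⟨x, -, rfl⟩ := (Submodule.mem_smul_pointwise_iff_exists _ _ _).mp (hcon y hy)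
        refine Submodule.smul_mem_smul (Ideal.mem_span_singleton_self a) ?_
        rw [Submodule.mem_torsionBySet_iff] at hy ⊢
        intro p
        refine hreg.1 ?_
        have := hy p
        simp only [smul_zero]
        rw [smul_comm]; exact this
      have h0 : N = ⊥ := Submodule.eq_bot_of_le_smul_of_le_jacobson_bot _ _
        (IsNoetherian.noetherian N) hle (by
          rw [IsLocalRing.jacobson_eq_maximalIdeal _ bot_ne_top,
            Ideal.span_singleton_le_iff_mem]
          exact hmem a (by simp))
      have hzN : z ∈ N := by
        rw [Submodule.mem_torsionBySet_iff]
        rintro ⟨p, hp⟩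
        exact (memP p).mp hp
      rw [h0] at hzN
      exact hz0 (by simpa using hzN)
    obtain ⟨y, hyN, hy⟩ := hN
    have hy' : (Submodule.Quotient.mk y : QuotSMulTop a M) ≠ 0 := by
      rwa [Ne, Submodule.Quotient.mk_eq_zero]
    obtain ⟨Q, hQ, hle⟩ := exists_le_isAssociatedPrime_of_isNoetherianRing R _ hy'
    have hcol : ∀ p : R, p • y ∈ a • (⊤ : Submodule R M) → p ∈ Q := by
      intro p hp
      apply hle
      rw [Submodule.mem_colon_singleton, ← Submodule.Quotient.mk_smul, Submodule.mem_bot,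
        Submodule.Quotient.mk_eq_zero]
      exact hp
    have hlt : P < ⟨Q, hQ.isPrime⟩ := by
      rw [← PrimeSpectrum.asIdeal_lt_asIdeal]
      refine lt_of_le_of_ne ?_ ?_
      · intro p hp
        apply hcol
        rw [Submodule.mem_torsionBySet_iff] at hyN
        rw [hyN ⟨p, hp⟩]; exact zero_mem _
      · intro h
        apply haP
        rw [h]
        exact hcol a (Submodule.smul_mem_pointwise_smul _ _ _ trivial)
    have := ih (QuotSMulTop a M) rs (by simpa using hlen) hreg.2
      (fun r hr => hmem r (by simp [hr])) ⟨Q, hQ.isPrime⟩ hQ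
    refine le_trans ?_ (Order.coheight_add_one_le hlt)
    push_cast
    gcongr

universe u
open CategoryTheory Abelian in
theorem exists_isRegular_quotSMulTop {R : Type u} [CommRing R] [IsNoetherianRing R]
    [IsLocalRing R] {n : ℕ} {M : Type u} [AddCommGroup M] [Module R M] [Module.Finite R M]
    {rs : List R} (hlen : rs.length = n + 1) (hreg : IsRegular M rs)
    (hmem : ∀ r ∈ rs, r ∈ maximalIdeal R) {x : R} (hx : IsSMulRegular M x)
    (hxm : x ∈ maximalIdeal R) :
    ∃ rs' : List R, rs'.length = n ∧ (∀ r ∈ rs', r ∈ maximalIdeal R) ∧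
      IsRegular (QuotSMulTop x M) rs' := by
  have hM : Nontrivial M := hreg.nontrivial
  have hlt : ∀ (L : Type u) [AddCommGroup L] [Module R L] [Module.Finite R L] [Nontrivial L],
      maximalIdeal R • (⊤ : Submodule R L) < ⊤ := by
    intro L _ _ _ _
    refine lt_top_iff_ne_top.mpr fun h => ?_
    have := Submodule.eq_bot_of_le_smul_of_le_jacobson_bot (maximalIdeal R) (⊤ : Submodule R L)
      Module.Finite.fg_top h.ge (by
        rw [IsLocalRing.jacobson_eq_maximalIdeal _ bot_ne_top])
    exact (top_ne_bot this)
  have hnt : Nontrivial (QuotSMulTop x M) := by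
    refine Submodule.Quotient.nontrivial_iff.mpr ?_
    refine (Submodule.top_ne_pointwise_smul_of_mem_jacobson_annihilator ?_).symm
    refine IsLocalRing.maximalIdeal_le_jacobson _ hxm
  let N : ModuleCat.{u} R := ModuleCat.of R (R ⧸ maximalIdeal R)
  have hsupp : Module.support R N = PrimeSpectrum.zeroLocus (maximalIdeal R : Set R) := by
    change Module.support R (R ⧸ maximalIdeal R) = _
    rw [Module.support_eq_zeroLocus, Ideal.annihilator_quotient]
  have hext := ModuleCat.subsingleton_ext_of_exists_isRegular (maximalIdeal R) N hsupp.subset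
    (ModuleCat.of R M) (hlt M) rs hmem hreg
  refine ModuleCat.exists_isRegular_of_exists_subsingleton_ext (maximalIdeal R) n
    (ModuleCat.of R (QuotSMulTop x M)) (hlt _) N hsupp ?_
  intro i hi
  have zero1 := AddCommGrpCat.isZero_of_iff_subsingleton.mpr (hext i (by omega))
  have zero2 := AddCommGrpCat.isZero_of_iff_subsingleton.mpr (hext (i + 1) (by omega))
  exact AddCommGrpCat.subsingleton_of_isZero <| ShortComplex.Exact.isZero_of_both_zeros
    ((Ext.covariant_sequence_exact₃' N
      (IsSMulRegular.smulShortComplex_shortExact (M := ModuleCat.of R M) hx)) i (i + 1) rfl)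
    (zero1.eq_zero_of_src _) (zero2.eq_zero_of_tgt _)

theorem coheight_le_of_forall_eq_maximalIdeal {R : Type*} [CommRing R] [IsNoetherianRing R]
    [IsLocalRing R] (P : PrimeSpectrum R) (ys : List R) (hys : ∀ y ∈ ys, y ∈ maximalIdeal R)
    (h : ∀ Q : PrimeSpectrum R, P ≤ Q → (∀ y ∈ ys, y ∈ Q.asIdeal) →
      Q.asIdeal = maximalIdeal R) : Order.coheight P ≤ ys.length := by
  classical
  have h1 : ((Order.coheight P : ℕ∞) : WithBot ℕ∞) = ringKrullDim (R ⧸ P.asIdeal) := by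
    rw [ringKrullDim_quotient, Order.coheight_eq_krullDim_Ici]
    have : Set.Ici P = PrimeSpectrum.zeroLocus (P.asIdeal : Set R) := by
      ext Q; rfl
    rw [this]
  let S := R ⧸ P.asIdeal
  let π : R →+* S := Ideal.Quotient.mk _
  have hπ : Function.Surjective π := Ideal.Quotient.mk_surjective
  have : IsLocalRing S := IsLocalRing.of_surjective' π hπ
  rw [← IsLocalRing.maximalIdeal_height_eq_ringKrullDim] at h1
  have h1' : Order.coheight P = (maximalIdeal S).height := by exact_mod_cast h1
  have hcm : (maximalIdeal S).comap π = maximalIdeal R := by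
    have : ((maximalIdeal S).comap π).IsMaximal :=
      Ideal.comap_isMaximal_of_surjective π hπ
    exact IsLocalRing.eq_maximalIdeal this
  rw [h1']
  let s : Set S := ((ys.map π).toFinset : Set S)
  have hfin : s.Finite := Finset.finite_toSet _
  have hs : s.ncard ≤ ys.length := by
    simp only [s, Set.ncard_coe_finset]
    exact (List.toFinset_card_le _).trans (by simp)
  refine le_trans (Ideal.height_le_card_of_mem_minimalPrimes_span hfin ?_)
    (by exact_mod_cast hs)
  refine ⟨⟨inferInstance, ?_⟩, ?_⟩
  · rw [Ideal.span_le]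
    intro y hy
    simp only [s, List.coe_toFinset, List.mem_map, Set.mem_ofPred_eq] at hy
    obtain ⟨y, hy, rfl⟩ := hy
    have : y ∈ (maximalIdeal S).comap π := hcm ▸ hys y hy
    exact this
  · rintro Q ⟨hQ, hQ'⟩ -
    have := h ⟨Q.comap π, hQ.comap π⟩ (by
      rw [← PrimeSpectrum.asIdeal_le_asIdeal]
      intro p hp
      change π p ∈ Q
      rw [show π p = 0 from Ideal.Quotient.eq_zero_iff_mem.mpr hp]
      exact zero_mem _) (by
      intro y hy
      refine hQ' (Ideal.subset_span ?_)
      simp only [s, List.coe_toFinset, List.mem_map, Set.mem_ofPred_eq]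
      exact ⟨y, hy, rfl⟩)
    simp only at this
    rw [← Ideal.comap_le_comap_iff_of_surjective π hπ, this]
    exact hcm.le

theorem isWeaklyRegular_of_forall_eq_maximalIdeal {R : Type u} [CommRing R] [IsNoetherianRing R]
    [IsLocalRing R] (n : ℕ) : ∀ (M : Type u) [AddCommGroup M] [Module R M] [Module.Finite R M]
    (rs ys : List R), rs.length = n → IsRegular M rs → (∀ r ∈ rs, r ∈ maximalIdeal R) →
    ys.length = n → (∀ y ∈ ys, y ∈ maximalIdeal R) →
    (∀ Q ∈ Module.support R M, (∀ y ∈ ys, y ∈ Q.asIdeal) → Q.asIdeal = maximalIdeal R) →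
    IsWeaklyRegular M ys := by
  induction n with
  | zero =>
    intro M _ _ _ rs ys _ _ _ hys _ _
    rw [List.length_eq_zero_iff] at hys
    subst hys; exact IsWeaklyRegular.nil R M
  | succ n ih =>
    intro M _ _ _ rs ys hlen hreg hmem hylen hy hQ
    obtain ⟨y, ys, rfl⟩ : ∃ a rs', ys = a :: rs' := by
      cases ys with
      | nil => simp at hylen
      | cons a l => exact ⟨a, l, rfl⟩
    have hyreg : IsSMulRegular M y := by
      by_contra hcon
      have h1 : y ∈ ⋃ p ∈ associatedPrimes R M, (p : Set R) := by
        rw [biUnion_associatedPrimes_eq_compl_regular]; exact hcon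
      simp only [Set.mem_iUnion] at h1
      obtain ⟨P, hP, hyP⟩ := h1
      have h2 := le_coheight_of_isAssociatedPrime (n + 1) M rs hlen hreg hmem ⟨P, hP.isPrime⟩ hP
      have h3 := coheight_le_of_forall_eq_maximalIdeal ⟨P, hP.isPrime⟩ ys
        (fun z hz => hy z (by simp [hz])) (by
          intro Q hPQ hysQ
          refine hQ Q ?_ ?_
          · rw [Module.support_eq_zeroLocus]
            have hle := (IsAssociatedPrime.annihilator_le hP).trans hPQ
            rw [Submodule.annihilator_top] at hle
            exact hle
          · intro z hz
            rcases List.mem_cons.mp hz with rfl | hz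
            · exact hPQ hyP
            · exact hysQ z hz)
      have h4 := h2.trans h3
      simp only [List.length_cons, add_left_inj] at hylen
      rw [hylen] at h4
      have : n + 1 ≤ n := by exact_mod_cast h4
      omega
    rw [isWeaklyRegular_cons_iff]
    refine ⟨hyreg, ?_⟩
    obtain ⟨rs', hl', hm', hr'⟩ := exists_isRegular_quotSMulTop hlen hreg hmem hyreg
      (hy y (by simp))
    refine ih (QuotSMulTop y M) rs' ys hl' hr' hm' (by simpa using hylen)
      (fun z hz => hy z (by simp [hz])) ?_
    intro Q hQs hys
    rw [Module.support_quotSMulTop] at hQs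
    refine hQ Q hQs.1 ?_
    intro z hz
    rcases List.mem_cons.mp hz with rfl | hz
    · exact (PrimeSpectrum.mem_zeroLocus _ _).mp hQs.2 (by simp)
    · exact hys z hz

theorem IsWeaklyRegular.mem_of_mul_mem {A : Type*} [CommRing A] {ys : List A} {s : A}
    (h : IsWeaklyRegular A (ys ++ [s])) {a : A} (ha : s * a ∈ Ideal.ofList ys) :
    a ∈ Ideal.ofList ys := by
  have h1 := ((isWeaklyRegular_append_iff A ys [s]).mp h).2
  rw [isWeaklyRegular_cons_iff] at h1
  have h2 := (isSMulRegular_quotient_iff_mem_of_smul_mem _ _).mp h1.1 a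
  simpa using h2 (by simpa using ha)

theorem exists_notMem_mul_mem_of_isolated {A : Type u} [CommRing A] [IsNoetherianRing A]
    (n : Ideal A) [n.IsPrime] {rs ys : List A} {s : A} (hreg : IsWeaklyRegular A rs)
    (hrs : ∀ r ∈ rs, r ∈ n) (hys : ∀ y ∈ ys, y ∈ n) (hs : s ∈ n)
    (hlen : ys.length + 1 = rs.length)
    (hQ : ∀ Q : Ideal A, Q.IsPrime → Q ≤ n → (∀ y ∈ ys, y ∈ Q) → s ∈ Q → Q = n)
    {a : A} (ha : s * a ∈ Ideal.ofList ys) : ∃ u ∉ n, u * a ∈ Ideal.ofList ys := by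
  let R := Localization.AtPrime n
  let φ := algebraMap A R
  have : IsNoetherianRing R := IsLocalization.isNoetherianRing n.primeCompl R inferInstance
  have hmem : ∀ x ∈ n, φ x ∈ maximalIdeal R := by
    intro x hx
    rw [← Localization.AtPrime.map_eq_maximalIdeal]
    exact Ideal.mem_map_of_mem _ hx
  have hR := hreg.isRegular_of_isLocalization_of_mem R n hrs
  have hw : IsWeaklyRegular R (ys.map φ ++ [φ s]) := by
    refine isWeaklyRegular_of_forall_eq_maximalIdeal rs.length R (rs.map φ) _ (by simp) hR
      ?_ (by simp [hlen]) ?_ ?_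
    · intro r hr
      obtain ⟨x, hx, rfl⟩ := List.mem_map.mp hr
      exact hmem x (hrs x hx)
    · intro y hy
      rcases List.mem_append.mp hy with hy | hy
      · obtain ⟨r, hr, rfl⟩ := List.mem_map.mp hy
        exact hmem r (hys r hr)
      · rw [List.mem_singleton] at hy; subst hy; exact hmem s hs
    · intro Q _ hyQ
      have hle : Q.asIdeal.comap φ ≤ n := by
        intro x hx
        by_contra hxn
        have hu : IsUnit (φ x) := IsLocalization.map_units R (⟨x, hxn⟩ : n.primeCompl)
        exact Q.2.ne_top (Ideal.eq_top_of_isUnit_mem _ hx hu)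
      have heq := hQ (Q.asIdeal.comap φ) (Q.2.comap φ) hle
        (fun y hy => hyQ _ (by
          simp only [List.mem_append, List.mem_map]; exact Or.inl ⟨y, hy, rfl⟩))
        (hyQ _ (by simp))
      refine le_antisymm (IsLocalRing.le_maximalIdeal Q.2.ne_top) ?_
      rw [← Localization.AtPrime.map_eq_maximalIdeal, Ideal.map_le_iff_le_comap]
      exact heq.ge
  have h1 := IsWeaklyRegular.mem_of_mul_mem hw (a := φ a) (by
    rw [← Ideal.map_ofList, ← map_mul]
    exact Ideal.mem_map_of_mem _ ha)
  rw [← Ideal.map_ofList] at h1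
  obtain ⟨u, hu, h⟩ := (IsLocalization.algebraMap_mem_map_algebraMap_iff n.primeCompl R _ _).mp h1
  exact ⟨u, hu, h⟩

open MvPolynomial in
theorem isWeaklyRegular_X_append_C {d : ℕ} {B : Type*} [CommRing B] (b : B)
    (hb : IsSMulRegular B b) :
    IsWeaklyRegular (MvPolynomial (Fin d) B)
      (List.ofFn (fun i : Fin d => (X i : MvPolynomial (Fin d) B)) ++ [C b]) := by
  have hspan : ∀ k : ℕ, k ≤ d → Ideal.ofList ((List.ofFn (fun i : Fin d =>
      (X i : MvPolynomial (Fin d) B))).take k) =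
      Ideal.span (X '' {i : Fin d | (i : ℕ) < k}) := by
    intro k hk
    unfold Ideal.ofList
    congr 1
    ext p
    simp only [Set.mem_ofPred_eq, List.mem_take_iff_getElem, List.length_ofFn, List.getElem_ofFn,
      Set.mem_image]
    constructor
    · rintro ⟨i, hi, rfl⟩
      exact ⟨⟨i, by omega⟩, by show i < k; omega, rfl⟩
    · rintro ⟨i, hi, rfl⟩
      exact ⟨i, by have := i.2; omega, rfl⟩
  rw [isWeaklyRegular_append_iff]
  constructor
  · constructor
    intro i hi
    simp only [List.length_ofFn] at hi
    rw [isSMulRegular_quotient_iff_mem_of_smul_mem]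
    intro p hp
    rw [hspan i hi.le, smul_eq_mul, Ideal.mul_top, mem_ideal_span_X_image] at hp ⊢
    intro m hm
    simp only [List.getElem_ofFn, smul_eq_mul] at hp
    obtain ⟨j, hj, hj'⟩ := hp (Finsupp.single ⟨i, hi⟩ 1 + m) (by
      rw [mem_support_iff] at hm ⊢
      rwa [coeff_X_mul])
    refine ⟨j, hj, ?_⟩
    have hne : (⟨i, hi⟩ : Fin d) ≠ j := by
      rintro rfl
      simp at hj
    simpa [Finsupp.single_apply, hne] using hj'
  · rw [isWeaklyRegular_cons_iff]
    refine ⟨?_, IsWeaklyRegular.nil _ _⟩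
    rw [isSMulRegular_quotient_iff_mem_of_smul_mem]
    intro p hp
    have h := hspan d le_rfl
    rw [List.take_of_length_le (by simp)] at h
    rw [h, smul_eq_mul, Ideal.mul_top, mem_ideal_span_X_image] at hp ⊢
    intro m hm
    apply hp
    rw [mem_support_iff] at hm ⊢
    rw [smul_eq_mul, coeff_C_mul]
    intro h0
    exact hm (hb (by simpa using h0))

end Regular

theorem exists_pos_mul_lt_of_finset {ι : Type*} (s : Finset ι) (a b : ι → ℚ)
    (hb : ∀ i ∈ s, 0 < b i) : ∃ ε > 0, ∀ i ∈ s, ε * a i < b i := by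
  classical
  induction s using Finset.induction_on with
  | empty => exact ⟨1, one_pos, by simp⟩
  | insert j s _ ih =>
    obtain ⟨ε, hε, h⟩ := ih (fun i hi => hb i (Finset.mem_insert_of_mem hi))
    have hbj := hb j (Finset.mem_insert_self j s)
    have hpos : 0 < b j / (|a j| + 1) := by positivity
    refine ⟨min ε (b j / (|a j| + 1)), lt_min hε hpos, ?_⟩
    intro i hi
    rcases Finset.mem_insert.mp hi with rfl | hi'
    · calc min ε (b i / (|a i| + 1)) * a i ≤ min ε (b i / (|a i| + 1)) * |a i| := by
            gcongr; exact le_abs_self _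
        _ ≤ b i / (|a i| + 1) * |a i| := by gcongr; exact min_le_right _ _
        _ < b i / (|a i| + 1) * (|a i| + 1) := by gcongr; linarith
        _ = b i := by field_simp
    · rcases le_total 0 (a i) with h0 | h0
      · calc _ ≤ ε * a i := by gcongr; exact min_le_left _ _
          _ < _ := h i hi'
      · have := hb i hi
        have h2 : 0 < min ε (b j / (|a j| + 1)) := lt_min hε hpos
        nlinarith

/-- Gordan's alternative for a finite family of vectors in a rational vector space. -/
theorem exists_forall_pos_or_exists_sum_eq_zero {E : Type*} [AddCommGroup E] [Module ℚ E]
    {ι : Type*} (s : Finset ι) : ∀ v : ι → E,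
    (∃ φ : E →ₗ[ℚ] ℚ, ∀ i ∈ s, 0 < φ (v i)) ∨
      ∃ c : ι → ℚ, (∀ i ∈ s, 0 ≤ c i) ∧ (∃ i ∈ s, 0 < c i) ∧ ∑ i ∈ s, c i • v i = 0 := by
  classical
  induction s using Finset.induction_on with
  | empty => exact fun v => Or.inl ⟨0, by simp⟩
  | insert j s hj ih =>
    intro v
    have hne : ∀ i ∈ s, i ≠ j := fun i hi h => hj (h ▸ hi)
    have lift : ∀ (c : ι → ℚ) (b : ℚ), (∀ i ∈ s, 0 ≤ c i) → 0 ≤ b → (0 < b ∨ ∃ i ∈ s, 0 < c i) →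
        b • v j + ∑ i ∈ s, c i • v i = 0 →
        ∃ c : ι → ℚ, (∀ i ∈ insert j s, 0 ≤ c i) ∧ (∃ i ∈ insert j s, 0 < c i) ∧
          ∑ i ∈ insert j s, c i • v i = 0 := by
      intro c b hc hb hp hsum
      refine ⟨Function.update c j b, ?_, ?_, ?_⟩
      · intro i hi
        rcases Finset.mem_insert.mp hi with rfl | hi
        · simpa using hb
        · simpa [hne i hi] using hc i hi
      · rcases hp with hp | ⟨i, hi, hp⟩
        · exact ⟨j, Finset.mem_insert_self _ _, by simpa using hp⟩
        · exact ⟨i, Finset.mem_insert_of_mem hi, by simpa [hne i hi] using hp⟩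
      · rw [Finset.sum_insert hj, ← hsum]
        congr 1
        · simp
        · exact Finset.sum_congr rfl fun i hi => by simp [hne i hi]
    rcases ih v with ⟨φ, hφ⟩ | ⟨c, h1, h2, h3⟩
    · rcases lt_trichotomy (φ (v j)) 0 with hlt | heq | hgt
      · have hq : φ (v j) ≠ 0 := hlt.ne
        rcases ih (fun i => v i - (φ (v i) / φ (v j)) • v j) with ⟨ψ, hψ⟩ | ⟨c, h1, h2, h3⟩
        · left
          let ψ' : E →ₗ[ℚ] ℚ := ψ - (ψ (v j) / φ (v j)) • φ
          have e1 : ∀ i, ψ' (v i) = ψ (v i - (φ (v i) / φ (v j)) • v j) := by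
            intro i; simp [ψ']; ring
          obtain ⟨ε, hε, h⟩ := exists_pos_mul_lt_of_finset s (fun i => φ (v i))
            (fun i => ψ' (v i)) (fun i hi => by rw [e1]; exact hψ i hi)
          refine ⟨ψ' - ε • φ, ?_⟩
          intro i hi
          rcases Finset.mem_insert.mp hi with rfl | hi
          · have : ψ' (v i) = 0 := by simp [ψ', hq]
            simp [this]; nlinarith
          · have := h i hi
            simp at this ⊢; linarith
        · right
          refine lift c (∑ i ∈ s, c i * (φ (v i) / -φ (v j))) h1 ?_ (Or.inr h2) ?_
          · refine Finset.sum_nonneg fun i hi => mul_nonneg (h1 i hi)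
              (div_nonneg (hφ i hi).le (by linarith))
          · rw [← h3, Finset.sum_smul, ← Finset.sum_add_distrib]
            refine Finset.sum_congr rfl fun i _ => ?_
            rw [smul_sub, smul_smul, div_neg, mul_neg, neg_smul]
            abel
      · by_cases hv : v j = 0
        · right
          exact lift 0 1 (by simp) zero_le_one (Or.inl one_pos) (by simp [hv])
        · left
          obtain ⟨χ, hχ⟩ : ∃ χ : E →ₗ[ℚ] ℚ, χ (v j) ≠ 0 := by
            by_contra! h
            exact hv ((Module.forall_dual_apply_eq_zero_iff ℚ (v j)).mp h)
          obtain ⟨ε, hε, h⟩ := exists_pos_mul_lt_of_finset s (fun i => -(χ (v j) * χ (v i)))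
            (fun i => φ (v i)) hφ
          refine ⟨φ + (ε * χ (v j)) • χ, ?_⟩
          intro i hi
          rcases Finset.mem_insert.mp hi with rfl | hi
          · have : 0 < χ (v i) * χ (v i) := mul_self_pos.mpr hχ
            simp [heq, mul_assoc]; positivity
          · have := h i hi
            simp at this ⊢; linarith
      · left
        refine ⟨φ, fun i hi => ?_⟩
        rcases Finset.mem_insert.mp hi with rfl | hi
        · exact hgt
        · exact hφ i hi
    · right
      exact lift c 0 h1 le_rfl (Or.inr h2) (by simpa using h3)

theorem exists_rat_functional_pos {ι G J : Type*} [Fintype ι] [DecidableEq ι] [AddCommGroup G]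
    [LinearOrder G]
    [IsOrderedAddMonoid G] (ν : (ι → ℤ) →ₗ[ℤ] G) (s : Finset J) (e : J → ι → ℤ)
    (he : ∀ j ∈ s, 0 < ν (e j)) :
    ∃ w : ι → ℚ, (∀ u, ν u = 0 → ∑ i, w i * u i = 0) ∧ ∀ j ∈ s, 0 < ∑ i, w i * e j i := by
  let H := LinearMap.range ν
  let b := Module.Free.chooseBasis ℤ H
  let co : (ι → ℤ) →+ (Module.Free.ChooseBasisIndex ℤ H → ℚ) :=
    { toFun := fun u k => ((b.repr ⟨ν u, ⟨u, rfl⟩⟩ k : ℤ) : ℚ)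
      map_zero' := by
        ext k
        have : (⟨ν 0, ⟨0, rfl⟩⟩ : H) = 0 := by ext; simp
        simp only [this]; simp
      map_add' := by
        intro u u'
        ext k
        have : (⟨ν (u + u'), ⟨u + u', rfl⟩⟩ : H) = ⟨ν u, ⟨u, rfl⟩⟩ + ⟨ν u', ⟨u', rfl⟩⟩ := by
          ext; simp
        simp only [this]; simp }
  have hco : ∀ u, co u = 0 → ν u = 0 := by
    intro u hu
    have h1 : b.repr ⟨ν u, ⟨u, rfl⟩⟩ = 0 := by
      ext k
      have := congrFun hu k
      simpa [co] using this
    have h2 : (⟨ν u, ⟨u, rfl⟩⟩ : H) = 0 := by simpa using h1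
    exact congrArg Subtype.val h2
  have hco' : ∀ u, ν u = 0 → co u = 0 := by
    intro u hu
    ext k
    have : (⟨ν u, ⟨u, rfl⟩⟩ : H) = 0 := by ext; simpa using hu
    simp [co, this]
  obtain ⟨φ, hφ⟩ : ∃ φ : (Module.Free.ChooseBasisIndex ℤ H → ℚ) →ₗ[ℚ] ℚ,
      ∀ j ∈ s, 0 < φ (co (e j)) := by
    rcases exists_forall_pos_or_exists_sum_eq_zero s (fun j => co (e j)) with h | ⟨c, h1, h2, h3⟩
    · exact h
    · exfalso
      obtain ⟨N, hN⟩ := IsLocalization.exist_integer_multiples (nonZeroDivisors ℤ) s c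
      have hN0 : (N : ℤ) ≠ 0 := nonZeroDivisors.ne_zero N.2
      choose! z hz using hN
      have hz' : ∀ j ∈ s, (z j : ℚ) = (N : ℤ) * c j := by
        intro j hj
        have := hz j hj
        simpa [Algebra.smul_def] using this
      have hsum : co (∑ j ∈ s, ((N : ℤ) * z j) • e j) = 0 := by
        rw [map_sum]
        have : ((N : ℤ) : ℚ) • ((N : ℤ) : ℚ) • ∑ j ∈ s, c j • co (e j) = 0 := by
          rw [h3]; simp
        rw [← this, Finset.smul_sum, Finset.smul_sum]
        refine Finset.sum_congr rfl fun j hj => ?_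
        rw [map_zsmul]
        ext k
        simp [hz' j hj]
        ring
      have h0 := hco _ hsum
      rw [map_sum] at h0
      have hpos : ∀ j ∈ s, 0 ≤ ν (((N : ℤ) * z j) • e j) := by
        intro j hj
        rw [map_zsmul]
        refine zsmul_nonneg (he j hj).le ?_
        have : (0 : ℚ) ≤ ((N : ℤ) * z j : ℤ) := by
          push_cast
          rw [hz' j hj, ← mul_assoc]
          exact mul_nonneg (mul_self_nonneg _) (h1 j hj)
        exact_mod_cast this
      obtain ⟨j, hj, hcj⟩ := h2
      have h4 := (Finset.sum_eq_zero_iff_of_nonneg hpos).mp h0 j hj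
      have h5 : 0 < ν (((N : ℤ) * z j) • e j) := by
        rw [map_zsmul]
        refine zsmul_pos (he j hj) ?_
        have : (0 : ℚ) < ((N : ℤ) * z j : ℤ) := by
          push_cast
          rw [hz' j hj, ← mul_assoc]
          refine mul_pos (mul_self_pos.mpr ?_) hcj
          exact_mod_cast hN0
        exact_mod_cast this
      exact h5.ne' h4
  have key : ∀ u, φ (co u) = ∑ i, φ (co (Pi.single i 1)) * u i := by
    intro u
    have hu : u = ∑ i, u i • (Pi.single i 1 : ι → ℤ) := by
      ext j
      simp [Finset.sum_apply, Pi.single_apply]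
    conv_lhs => rw [hu]
    rw [map_sum, map_sum]
    refine Finset.sum_congr rfl fun i _ => ?_
    rw [map_zsmul, map_zsmul, zsmul_eq_mul, mul_comm]
  refine ⟨fun i => φ (co (Pi.single i 1)), ?_, ?_⟩
  · intro u hu
    rw [← key, hco' u hu, map_zero]
  · intro j hj
    rw [← key]
    exact hφ j hj

theorem exists_linear_extension_of_ker {ι G : Type*} [Fintype ι] [AddCommGroup G]
    [LinearOrder G] [IsOrderedAddMonoid G] (ν : (ι → ℤ) →ₗ[ℤ] G) {A : Type*} [AddCommGroup A]
    (ρ : LinearMap.ker ν →ₗ[ℤ] A) :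
    ∃ α : (ι → ℤ) →ₗ[ℤ] A, ∀ u : LinearMap.ker ν, α u = ρ u := by
  let H := LinearMap.range ν
  obtain ⟨σ, hσ⟩ := LinearMap.exists_rightInverse_of_surjective ν.rangeRestrict
    (LinearMap.range_rangeRestrict ν)
  let p : (ι → ℤ) →ₗ[ℤ] LinearMap.ker ν :=
    LinearMap.codRestrict _ (LinearMap.id - σ ∘ₗ ν.rangeRestrict) (by
      intro u
      have h1 := LinearMap.congr_fun hσ (ν.rangeRestrict u)
      have h2 := congrArg Subtype.val h1
      simp only [LinearMap.mem_ker, LinearMap.sub_apply, map_sub, LinearMap.id_apply,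
        LinearMap.comp_apply] at h2 ⊢
      exact sub_eq_zero.mpr h2.symm)
  refine ⟨ρ ∘ₗ p, fun u => ?_⟩
  have : p u = u := by
    ext1
    have h : ν.rangeRestrict (u : ι → ℤ) = 0 := by ext; exact u.2
    simp [p, h]
  simp [this]

theorem exists_weight_of_valuationSubring {K : Type*} [Field K] (V : ValuationSubring K)
    {ι : Type*} [Fintype ι] (x : ι → K) (hx : ∀ i, x i ≠ 0) (T : Finset (ι → ℕ)) :
    ∃ (w : ι → ℚ) (a : ι → IsLocalRing.ResidueField V), (∀ i, a i ≠ 0) ∧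
      ∀ t ∈ T, ∀ t' ∈ T,
        (V.valuation (∏ i, x i ^ t i) < V.valuation (∏ i, x i ^ t' i) →
          ∑ i, w i * t' i < ∑ i, w i * t i) ∧
        (V.valuation (∏ i, x i ^ t i) = V.valuation (∏ i, x i ^ t' i) →
          ∑ i, w i * t' i = ∑ i, w i * t i ∧
          ∀ r : V, (r : K) * ∏ i, x i ^ t' i = ∏ i, x i ^ t i →
            IsLocalRing.residue V r * ∏ i, a i ^ t' i = ∏ i, a i ^ t i) := by
  classical
  let xu : ι → Kˣ := fun i => Units.mk0 (x i) (hx i)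
  let m : (ι → ℤ) →ₗ[ℤ] Additive Kˣ :=
    (AddMonoidHom.mk' (fun e => Additive.ofMul (∏ i, xu i ^ e i)) (by
      intro e e'
      simp [zpow_add, Finset.prod_mul_distrib])).toIntLinearMap
  have hm : ∀ e, m e = Additive.ofMul (∏ i, xu i ^ e i) := fun e => rfl
  let val : Additive Kˣ →ₗ[ℤ] Additive V.ValueGroupˣ :=
    (MonoidHom.toAdditive (Units.map V.valuation.toMonoidWithZeroHom.toMonoidHom)).toIntLinearMap
  let ν := val ∘ₗ m
  have hν : ∀ e, ν e = 0 ↔ V.valuation ((∏ i, xu i ^ e i : Kˣ) : K) = 1 := by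
    intro e
    change Units.map V.valuation.toMonoidWithZeroHom.toMonoidHom (∏ i, xu i ^ e i) = 1 ↔ _
    rw [← Units.val_inj]; rfl
  have hν' : ∀ e, 0 < ν e ↔ 1 < V.valuation ((∏ i, xu i ^ e i : Kˣ) : K) := by
    intro e
    change 1 < Units.map V.valuation.toMonoidWithZeroHom.toMonoidHom (∏ i, xu i ^ e i) ↔ _
    rw [← Units.val_lt_val]; rfl
  let ρ : LinearMap.ker ν →ₗ[ℤ] Additive (IsLocalRing.ResidueField V)ˣ :=
    (AddMonoidHom.mk' (fun u : LinearMap.ker ν => Additive.ofMul (V.unitGroupToResidueFieldUnits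
      ⟨∏ i, xu i ^ (u : ι → ℤ) i, (V.mem_unitGroup_iff _).mpr ((hν u).mp u.2)⟩)) (by
        intro u u'
        rw [← ofMul_mul, ← map_mul]
        congr 2
        ext1
        simp [zpow_add, Finset.prod_mul_distrib])).toIntLinearMap
  have hρ : ∀ u : LinearMap.ker ν, ((ρ u).toMul : IsLocalRing.ResidueField V) =
      IsLocalRing.residue V (V.unitGroupMulEquiv ⟨∏ i, xu i ^ (u : ι → ℤ) i,
        (V.mem_unitGroup_iff _).mpr ((hν u).mp u.2)⟩ : V) := fun u => rfl
  obtain ⟨α, hα⟩ := exists_linear_extension_of_ker ν ρ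
  let a : ι → (IsLocalRing.ResidueField V)ˣ := fun i => (α (Pi.single i 1)).toMul
  have ha : ∀ e : ι → ℤ, (α e).toMul = ∏ i, a i ^ e i := by
    intro e
    have he : e = ∑ i, e i • (Pi.single i 1 : ι → ℤ) := by
      ext j
      simp [Finset.sum_apply, Pi.single_apply]
    conv_lhs => rw [he]
    rw [map_sum, toMul_sum]
    refine Finset.prod_congr rfl fun i _ => ?_
    rw [map_zsmul, toMul_zsmul]
  let df : (ι → ℕ) × (ι → ℕ) → ι → ℤ := fun p i => (p.2 i : ℤ) - p.1 i
  have hdf : ∀ t t' : ι → ℕ, ((∏ i, xu i ^ df (t, t') i : Kˣ) : K) * ∏ i, x i ^ t i =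
      ∏ i, x i ^ t' i := by
    intro t t'
    rw [Units.coe_prod, ← Finset.prod_mul_distrib]
    refine Finset.prod_congr rfl fun i _ => ?_
    simp only [Units.val_zpow_eq_zpow_val, xu, Units.val_mk0, df]
    rw [← zpow_natCast, ← zpow_natCast, ← zpow_add₀ (hx i)]
    congr 1; ring
  have hne : ∀ t : ι → ℕ, ∏ i, x i ^ t i ≠ 0 := fun t =>
    Finset.prod_ne_zero_iff.mpr fun i _ => pow_ne_zero _ (hx i)
  have hvne : ∀ t : ι → ℕ, 0 < V.valuation (∏ i, x i ^ t i) := fun t =>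
    zero_lt_iff.mpr ((V.valuation.ne_zero_iff).mpr (hne t))
  obtain ⟨w, hw0, hwpos⟩ := exists_rat_functional_pos (-ν)
    ((T ×ˢ T).filter fun p => V.valuation (∏ i, x i ^ p.2 i) < V.valuation (∏ i, x i ^ p.1 i)) df
    (by
      rintro ⟨t, t'⟩ hp
      rw [Finset.mem_filter] at hp
      have h1 : ν (df (t', t)) = (-ν) (df (t, t')) := by
        rw [LinearMap.neg_apply, ← map_neg]; congr 1; ext i; simp [df]
      rw [← h1, hν']
      have h2 := hp.2
      simp only at h2
      by_contra hcon
      rw [not_lt] at hcon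
      rw [← hdf t' t, map_mul] at h2
      exact absurd h2 (not_lt.mpr (mul_le_of_le_one_left' hcon)))
  have hwdf : ∀ t t', ∑ i, w i * (df (t, t') i : ℤ) = ∑ i, w i * t' i - ∑ i, w i * t i := by
    intro t t'
    rw [← Finset.sum_sub_distrib]
    refine Finset.sum_congr rfl fun i _ => ?_
    simp [df, mul_sub]
  refine ⟨w, fun i => (a i : IsLocalRing.ResidueField V), fun i => (a i).ne_zero, ?_⟩
  intro t ht t' ht'
  refine ⟨fun hlt => ?_, fun heq => ?_⟩
  · have := hwpos (t', t) (Finset.mem_filter.mpr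
      ⟨Finset.mem_product.mpr ⟨ht', ht⟩, hlt⟩)
    rw [hwdf] at this
    linarith
  · have hone : V.valuation ((∏ i, xu i ^ df (t', t) i : Kˣ) : K) = 1 := by
      rw [← hdf t' t, map_mul] at heq
      exact mul_right_cancel₀ (hvne t').ne' (by rw [heq, one_mul])
    have hker : ν (df (t', t)) = 0 := (hν _).mpr hone
    constructor
    · have := hw0 (df (t', t)) (by simp [hker])
      rw [hwdf] at this
      linarith
    · intro r hr
      have hr1 : (r : K) = ((∏ i, xu i ^ df (t', t) i : Kˣ) : K) :=
        mul_right_cancel₀ (hne t') (hr.trans (hdf t' t).symm)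
      have h1 := hρ ⟨df (t', t), hker⟩
      rw [← hα, ha] at h1
      have h2 : r = (V.unitGroupMulEquiv ⟨∏ i, xu i ^ df (t', t) i,
          (V.mem_unitGroup_iff _).mpr hone⟩ : V) := by
        ext1
        rw [hr1]; rfl
      rw [h2, ← h1, Units.coe_prod, ← Finset.prod_mul_distrib]
      refine Finset.prod_congr rfl fun i _ => ?_
      simp only [Units.val_zpow_eq_zpow_val, df]
      rw [← zpow_natCast, ← zpow_natCast, ← zpow_add₀ (a i).ne_zero]
      congr 1; ring

theorem le_of_mem_newtonPolygon {d : ℕ} {f : MvPolynomial (Fin d) ℂ} {W : Fin d → ℝ}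
    (hW : ∀ i, 0 ≤ W i) {c : ℝ} (h : ∀ m ∈ f.support, c ≤ ∑ i, W i * m i) {p : Fin d → ℝ}
    (hp : p ∈ NewtonPolygon f) : c ≤ ∑ i, W i * p i := by
  have hsub : NewtonPolygon f ⊆ {p | c ≤ ∑ i, W i * p i} := by
    refine convexHull_min ?_ ?_
    · rintro _ ⟨m, hm, y, hy, rfl⟩
      refine (h m hm).trans (Finset.sum_le_sum fun i _ => ?_)
      simp only [Pi.add_apply]
      have := mul_nonneg (hW i) (hy i)
      linarith
    · have := convex_halfSpace_ge (𝕜 := ℝ) (f := fun p : Fin d → ℝ => ∑ i, W i * p i)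
        ⟨fun x y => by simp [mul_add, Finset.sum_add_distrib],
          fun a x => by simp [Finset.mul_sum, mul_left_comm]⟩ c
      exact this
  exact hsub hp

theorem coe_mem_newtonPolygon {d : ℕ} {f : MvPolynomial (Fin d) ℂ} {m : Fin d →₀ ℕ}
    (hm : m ∈ f.support) : (fun i => (m i : ℝ)) ∈ NewtonPolygon f :=
  subset_convexHull ℝ _ ⟨m, hm, 0, fun _ => le_rfl, by simp⟩

/-- The supporting half-spaces with nonnegative rational normal of `f` also contain the exponents
of `h`. -/
def DominatesSupport {d : ℕ} (f h : MvPolynomial (Fin d) ℂ) : Prop :=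
  ∀ W : Fin d → ℚ, (∀ i, 0 ≤ W i) → ∀ c : ℚ, (∀ m ∈ f.support, c ≤ ∑ i, W i * m i) →
    ∀ m ∈ h.support, c ≤ ∑ i, W i * m i

theorem dominatesSupport_sub {d : ℕ} {f f' : MvPolynomial (Fin d) ℂ}
    (h : NewtonPolygon f = NewtonPolygon f') : DominatesSupport f (f' - f) := by
  intro W hW c hc m hm
  rcases Finset.mem_union.mp (support_sub _ _ _ hm) with hm | hm
  · have := le_of_mem_newtonPolygon (f := f) (W := fun i => (W i : ℝ)) (c := c)
      (fun i => by exact_mod_cast hW i) (fun m hm => by exact_mod_cast hc m hm)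
      (h ▸ coe_mem_newtonPolygon hm)
    exact_mod_cast this
  · exact hc m hm

/-- The part of `f` supported on the exponents of weight `c`. -/
def weightPart {d : ℕ} (f : MvPolynomial (Fin d) ℂ) (W : Fin d → ℚ) (c : ℚ) :
    MvPolynomial (Fin d) ℂ :=
  ∑ m ∈ f.support with ∑ i, W i * m i = c, monomial m (coeff m f)

theorem newtonPolygon_subset_of_weight {d : ℕ} {f : MvPolynomial (Fin d) ℂ} {W : Fin d → ℝ}
    (hW : ∀ i, 0 < W i) {c : ℝ} (hc : ∀ m ∈ f.support, c ≤ ∑ i, W i * m i) :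
    NewtonPolygon f ⊆ {p | c < ∑ i, W i * p i} ∪
      convexHull ℝ {x | ∃ m ∈ f.support, ∑ i, W i * (m i : ℝ) = c ∧ x = fun i => (m i : ℝ)} := by
  set T : Set (Fin d → ℝ) :=
    {x | ∃ m ∈ f.support, ∑ i, W i * (m i : ℝ) = c ∧ x = fun i => (m i : ℝ)}
  have hlin : ∀ (a b : ℝ) (p q : Fin d → ℝ), ∑ i, W i * (a • p + b • q) i =
      a * ∑ i, W i * p i + b * ∑ i, W i * q i := by
    intro a b p q
    rw [Finset.mul_sum, Finset.mul_sum, ← Finset.sum_add_distrib]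
    refine Finset.sum_congr rfl fun i _ => ?_
    simp; ring
  have hT : ∀ p ∈ convexHull ℝ T, ∑ i, W i * p i = c := by
    have : convexHull ℝ T ⊆ {p | ∑ i, W i * p i = c} := by
      refine convexHull_min ?_ ?_
      · rintro _ ⟨m, _, h, rfl⟩; exact h
      · intro p hp q hq a b _ _ hab
        change _ = _ at hp hq
        change _ = _
        rw [hlin, hp, hq, ← add_mul, hab, one_mul]
    exact this
  refine convexHull_min ?_ ?_
  · rintro _ ⟨m, hm, y, hy, rfl⟩
    have h1 := hc m hm
    have h2 : ∑ i, W i * ((fun i => (m i : ℝ)) + y) i = ∑ i, W i * m i + ∑ i, W i * y i := by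
      simp [mul_add, Finset.sum_add_distrib]
    have h3 : ∀ i ∈ Finset.univ, 0 ≤ W i * y i := fun i _ => mul_nonneg (hW i).le (hy i)
    rcases (add_nonneg (sub_nonneg.mpr h1) (Finset.sum_nonneg h3)).lt_or_eq with h | h
    · left
      rw [Set.mem_ofPred_eq, h2]; linarith
    · right
      have h4 := Finset.sum_nonneg h3
      have h5 : ∑ i, W i * y i = 0 := by linarith
      have h6 : y = 0 := by
        ext i
        have := (Finset.sum_eq_zero_iff_of_nonneg h3).mp h5 i (Finset.mem_univ i)
        simpa [(hW i).ne'] using this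
      subst h6
      refine subset_convexHull ℝ _ ⟨m, hm, by linarith, by simp⟩
  · intro p hp q hq a b ha hb hab
    have hge : ∀ p ∈ {p : Fin d → ℝ | c < ∑ i, W i * p i} ∪ convexHull ℝ T,
        c ≤ ∑ i, W i * p i := by
      rintro p (hp | hp)
      · exact le_of_lt hp
      · exact (hT p hp).ge
    by_cases hpq : p ∈ convexHull ℝ T ∧ q ∈ convexHull ℝ T
    · exact Or.inr (convex_convexHull ℝ T hpq.1 hpq.2 ha hb hab)
    · rcases ha.eq_or_lt with rfl | ha
      · have : b = 1 := by linarith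
        subst this; simpa using hq
      rcases hb.eq_or_lt with rfl | hb
      · have : a = 1 := by linarith
        subst this; simpa using hp
      left
      rw [Set.mem_ofPred_eq, hlin]
      have h1 := hge p hp
      have h2 := hge q hq
      have h3 : c < ∑ i, W i * p i ∨ c < ∑ i, W i * q i := by
        rcases hp with hp | hp
        · exact Or.inl hp
        · rcases hq with hq | hq
          · exact Or.inr hq
          · exact absurd ⟨hp, hq⟩ hpq
      have h4 : c = a * c + b * c := by rw [← add_mul, hab, one_mul]
      rcases h3 with h3 | h3
      · have := mul_lt_mul_of_pos_left h3 ha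
        have := mul_le_mul_of_nonneg_left h2 hb.le
        linarith
      · have := mul_le_mul_of_nonneg_left h1 ha.le
        have := mul_lt_mul_of_pos_left h3 hb
        linarith

theorem NonDegenerate.not_singular_weightPart {d : ℕ} {f : MvPolynomial (Fin d) ℂ}
    (hnd : NonDegenerate f) {W : Fin d → ℚ} (hW : ∀ i, 0 < W i) {c : ℚ}
    (hc : ∀ m ∈ f.support, c ≤ ∑ i, W i * m i) (hex : ∃ m ∈ f.support, ∑ i, W i * m i = c) :
    ¬ ∃ x : Fin d → ℂ, (∀ i, x i ≠ 0) ∧ eval x (weightPart f W c) = 0 ∧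
      ∀ i, eval x (pderiv i (weightPart f W c)) = 0 := by
  classical
  let Wr : Fin d → ℝ := fun i => W i
  have hWr : ∀ i, 0 < Wr i := fun i => Rat.cast_pos.mpr (hW i)
  have hcr : ∀ m ∈ f.support, (c : ℝ) ≤ ∑ i, Wr i * m i := fun m hm => by
    simp only [Wr]
    exact_mod_cast hc m hm
  have hcast : ∀ m : Fin d →₀ ℕ, ∑ i, Wr i * (m i : ℝ) = c ↔ ∑ i, W i * m i = c := by
    intro m
    simp only [Wr]
    exact_mod_cast Iff.rfl
  let T : Set (Fin d → ℝ) :=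
    {x | ∃ m ∈ f.support, ∑ i, Wr i * (m i : ℝ) = c ∧ x = fun i => (m i : ℝ)}
  let γ : Set (Fin d → ℝ) := {p ∈ NewtonPolygon f | ∑ i, Wr i * p i = c}
  have hγ : γ = convexHull ℝ T := by
    apply Set.Subset.antisymm
    · rintro p ⟨hp, hpc⟩
      rcases newtonPolygon_subset_of_weight hWr hcr hp with h | h
      · exact absurd hpc (ne_of_gt h)
      · exact h
    · refine convexHull_min ?_ ?_
      · rintro _ ⟨m, hm, h, rfl⟩
        exact ⟨coe_mem_newtonPolygon hm, h⟩
      · rintro p ⟨hp, hpc⟩ q ⟨hq, hqc⟩ a b ha hb hab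
        refine ⟨convex_convexHull ℝ _ hp hq ha hb hab, ?_⟩
        have : ∑ i, Wr i * (a • p + b • q) i =
            a * ∑ i, Wr i * p i + b * ∑ i, Wr i * q i := by
          rw [Finset.mul_sum, Finset.mul_sum, ← Finset.sum_add_distrib]
          refine Finset.sum_congr rfl fun i _ => ?_
          simp; ring
        rw [this, hpc, hqc, ← add_mul, hab, one_mul]
  have hfin : T.Finite := by
    refine (f.support.finite_toSet.image (fun m => fun i => (m i : ℝ))).subset ?_
    rintro _ ⟨m, hm, _, rfl⟩
    exact ⟨m, hm, rfl⟩
  have hcompact : IsCompact γ := by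
    rw [hγ]; exact hfin.isCompact_convexHull (𝕜 := ℝ)
  obtain ⟨m0, hm0, hm0c⟩ := hex
  have hm0γ : (fun i => (m0 i : ℝ)) ∈ γ := ⟨coe_mem_newtonPolygon hm0, (hcast m0).mpr hm0c⟩
  have hexp : IsExposed ℝ (NewtonPolygon f) γ := by
    intro _
    refine ⟨-∑ i, Wr i • ContinuousLinearMap.proj (R := ℝ) (φ := fun _ : Fin d => ℝ) i, ?_⟩
    ext p
    have hl : ∀ q : Fin d → ℝ, (-∑ i, Wr i • ContinuousLinearMap.proj (R := ℝ)
        (φ := fun _ : Fin d => ℝ) i : (Fin d → ℝ) →L[ℝ] ℝ) q = -∑ i, Wr i * q i := by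
      intro q; simp
    simp only [Set.mem_ofPred_eq, hl, neg_le_neg_iff]
    constructor
    · rintro ⟨hp, hpc⟩
      refine ⟨hp, fun q hq => ?_⟩
      rw [hpc]
      exact le_of_mem_newtonPolygon (fun i => (hWr i).le) hcr hq
    · rintro ⟨hp, h⟩
      refine ⟨hp, le_antisymm ?_ (le_of_mem_newtonPolygon (fun i => (hWr i).le) hcr hp)⟩
      have := h _ hm0γ.1
      rwa [hm0γ.2] at this
  have hface : facePart f γ = weightPart f W c := by
    unfold facePart weightPart
    rw [Finset.sum_filter]
    refine Finset.sum_congr rfl fun m hm => ?_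
    have hiff : (fun i => (m i : ℝ)) ∈ γ ↔ ∑ i, W i * m i = c := by
      rw [← hcast]
      exact ⟨fun h => h.2, fun h => ⟨coe_mem_newtonPolygon hm, h⟩⟩
    by_cases h : ∑ i, W i * m i = c
    · rw [if_pos h, if_pos (hiff.mpr h)]
    · rw [if_neg h, if_neg (hiff.not.mpr h)]
  rw [← hface]
  exact hnd γ hexp hcompact ⟨_, hm0γ⟩

theorem aeval_X_mul_pderiv_weightPart {d : ℕ} (f : MvPolynomial (Fin d) ℂ) (W : Fin d → ℚ)
    (c : ℚ) {κ : Type*} [Field κ] [Algebra ℂ κ] (y : Fin d → κ) (i : Fin d) :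
    y i * aeval y (pderiv i (weightPart f W c)) =
      ∑ m ∈ f.support with ∑ i, W i * m i = c,
        (m i : κ) * (algebraMap ℂ κ (coeff m f) * ∏ k, y k ^ m k) := by
  have h1 : X i * pderiv i (weightPart f W c) = ∑ m ∈ f.support with ∑ i, W i * m i = c,
      m i • monomial m (coeff m f) := by
    rw [weightPart, map_sum, Finset.mul_sum]
    refine Finset.sum_congr rfl fun m _ => ?_
    rw [X_mul_pderiv_monomial]
  have h2 := congrArg (aeval y) h1
  rw [map_mul, aeval_X, map_sum] at h2
  rw [h2]
  refine Finset.sum_congr rfl fun m _ => ?_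
  rw [map_nsmul, aeval_monomial, nsmul_eq_mul, Finsupp.prod_fintype _ _ (by simp)]

/-- Non-degeneracy excludes singular points of weight parts over arbitrary field extensions. -/
theorem NonDegenerate.false_of_singular {d : ℕ} {f : MvPolynomial (Fin d) ℂ}
    (hnd : NonDegenerate f) (hf0 : eval (0 : Fin d → ℂ) f = 0)
    {κ : Type*} [Field κ] [Algebra ℂ κ] {W : Fin d → ℚ} (hW : ∀ i, 0 < W i) {c : ℚ}
    (hc : ∀ m ∈ f.support, c ≤ ∑ i, W i * m i) (hex : ∃ m ∈ f.support, ∑ i, W i * m i = c)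
    {y : Fin d → κ} (hy : ∀ i, y i ≠ 0)
    (hcrit : ∀ i, ∑ m ∈ f.support with ∑ i, W i * m i = c,
      (m i : κ) * (algebraMap ℂ κ (coeff m f) * ∏ k, y k ^ m k) = 0) : False := by
  have hd : ∀ i, aeval y (pderiv i (weightPart f W c)) = 0 := by
    intro i
    have := aeval_X_mul_pderiv_weightPart f W c y i
    rw [hcrit i] at this
    exact (mul_eq_zero.mp this).resolve_left (hy i)
  let I : Ideal (MvPolynomial (Fin d) ℂ) := RingHom.ker (aeval y : MvPolynomial (Fin d) ℂ →ₐ[ℂ] κ)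
  have hI : I.IsPrime := RingHom.ker_isPrime _
  have hX : ∏ i, (X i : MvPolynomial (Fin d) ℂ) ∉ vanishingIdeal ℂ (zeroLocus ℂ I) := by
    rw [vanishingIdeal_zeroLocus_eq_radical, hI.radical, RingHom.mem_ker, map_prod]
    simpa [Finset.prod_eq_zero_iff] using hy
  rw [mem_vanishingIdeal_iff] at hX
  push Not at hX
  obtain ⟨z, hz, hz0⟩ := hX
  have hz0' : ∀ i, z i ≠ 0 := by
    simpa [Finset.prod_eq_zero_iff] using hz0
  have hzd : ∀ i, eval z (pderiv i (weightPart f W c)) = 0 := by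
    intro i
    have := (mem_zeroLocus_iff.mp hz) _ (show pderiv i (weightPart f W c) ∈ I from hd i)
    simpa [aeval_eq_eval] using this
  refine hnd.not_singular_weightPart hW hc hex ⟨z, hz0', ?_, hzd⟩
  have hcpos : 0 < c := by
    obtain ⟨m, hm, rfl⟩ := hex
    refine lt_of_le_of_ne (Finset.sum_nonneg fun i _ => by have := (hW i).le; positivity) ?_
    intro h
    have h1 := (Finset.sum_eq_zero_iff_of_nonneg
      (fun i _ => by have := (hW i).le; positivity)).mp h.symm
    have h2 : m = 0 := by
      ext i
      have := h1 i (Finset.mem_univ i)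
      simpa [(hW i).ne'] using this
    subst h2
    rw [mem_support_iff] at hm
    apply hm
    rwa [eval_zero, constantCoeff_eq] at hf0
  have hE : (c : ℂ) * eval z (weightPart f W c) = 0 := by
    have h1 : ∀ i, (W i : ℂ) * ∑ m ∈ f.support with ∑ i, W i * m i = c,
      (m i : ℂ) * (algebraMap ℂ ℂ (coeff m f) * ∏ k, z k ^ m k) = 0 := by
      intro i
      rw [← aeval_X_mul_pderiv_weightPart f W c z i, aeval_eq_eval]
      simp [hzd i]
    have h2 := Finset.sum_eq_zero (s := Finset.univ) (fun i _ => h1 i)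
    rw [← h2]
    simp_rw [Finset.mul_sum]
    rw [Finset.sum_comm, weightPart, map_sum, Finset.mul_sum]
    refine Finset.sum_congr rfl fun m hm => ?_
    rw [eval_monomial, Finsupp.prod_fintype _ _ (by simp)]
    have hmc : (c : ℂ) = ∑ i, (W i : ℂ) * m i := by
      rw [← (Finset.mem_filter.mp hm).2]; push_cast; rfl
    rw [hmc, Finset.sum_mul]
    refine Finset.sum_congr rfl fun i _ => ?_
    simp [mul_assoc]
  exact (mul_eq_zero.mp hE).resolve_left (by exact_mod_cast hcpos.ne')

theorem mul_aeval_pderiv_eq_sum {d : ℕ} {K : Type*} [Field K] [Algebra ℂ K]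
    (f : MvPolynomial (Fin d) ℂ) {S : Finset (Fin d →₀ ℕ)} (hS : f.support ⊆ S)
    {I : Finset (Fin d)} {x x' : Fin d → K} (hxI : ∀ i ∈ I, x' i = x i)
    (hx : ∀ j ∉ I, x j = 0) (i : Fin d) :
    x i * aeval x (pderiv i f) = ∑ m ∈ S with ∀ j ∉ I, m j = 0,
      algebraMap ℂ K (m i * coeff m f) * ∏ k, x' k ^ m k := by
  have h1 : X i * pderiv i f = ∑ m ∈ S, m i • monomial m (coeff m f) := by
    conv_lhs => rw [← support_sum_monomial_coeff f]
    rw [map_sum, Finset.mul_sum]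
    refine (Finset.sum_congr rfl fun m _ => X_mul_pderiv_monomial).trans
      (Finset.sum_subset hS fun m _ hm => ?_)
    rw [notMem_support_iff.mp hm]; simp
  have h2 := congrArg (aeval x) h1
  rw [map_mul, aeval_X, map_sum] at h2
  rw [h2, Finset.sum_filter]
  refine Finset.sum_congr rfl fun m _ => ?_
  rw [map_nsmul, aeval_monomial, Finsupp.prod_fintype _ _ (by simp)]
  split_ifs with hm
  · rw [nsmul_eq_mul, map_mul, map_natCast, mul_assoc]
    congr 2
    refine Finset.prod_congr rfl fun k _ => ?_
    by_cases hk : k ∈ I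
    · rw [hxI k hk]
    · simp [hm k hk]
  · push Not at hm
    obtain ⟨j, hj, hmj⟩ := hm
    have : ∏ k, x k ^ m k = 0 :=
      Finset.prod_eq_zero (Finset.mem_univ j) (by simp [hx j hj, hmj])
    simp [this]

/-- The exponent `m` is linear in `x_j` and involves no other variable outside `I`. -/
def LinearOff {d : ℕ} (I : Finset (Fin d)) (j : Fin d) (m : Fin d →₀ ℕ) : Prop :=
  m j = 1 ∧ ∀ k ∉ I, k ≠ j → m k = 0

open Classical in
theorem aeval_pderiv_eq_sum {d : ℕ} {K : Type*} [Field K] [Algebra ℂ K]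
    (f : MvPolynomial (Fin d) ℂ) {S : Finset (Fin d →₀ ℕ)} (hS : f.support ⊆ S)
    {I : Finset (Fin d)} {x x' : Fin d → K} (hxI : ∀ i ∈ I, x' i = x i)
    (hx : ∀ j ∉ I, x j = 0) (hx' : ∀ j ∉ I, x' j = 1) {j : Fin d} (hj : j ∉ I) :
    aeval x (pderiv j f) = ∑ m ∈ S with LinearOff I j m,
      algebraMap ℂ K (coeff m f) * ∏ k, x' k ^ m k := by
  have h1 : pderiv j f = ∑ m ∈ S, monomial (m - Finsupp.single j 1) (coeff m f * m j) := by
    conv_lhs => rw [← support_sum_monomial_coeff f]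
    rw [map_sum]
    refine (Finset.sum_congr rfl fun m _ => pderiv_monomial).trans
      (Finset.sum_subset hS fun m _ hm => ?_)
    rw [notMem_support_iff.mp hm]; simp
  rw [h1, map_sum, Finset.sum_filter]
  refine Finset.sum_congr rfl fun m _ => ?_
  rw [aeval_monomial, Finsupp.prod_fintype _ _ (by simp)]
  split_ifs with hm
  · rw [hm.1, Nat.cast_one, mul_one]
    congr 1
    refine Finset.prod_congr rfl fun k _ => ?_
    by_cases hk : k ∈ I
    · have : j ≠ k := by rintro rfl; exact hj hk
      rw [hxI k hk]; simp [this]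
    · rw [hx' k hk]
      by_cases hkj : k = j
      · subst hkj; simp [hm.1]
      · simp [hm.2 k hk hkj]
  · by_cases h0 : m j = 0
    · simp [h0]
    have : ∏ k, x k ^ (m k - Finsupp.single j 1 k) = 0 := by
      by_cases hm1 : m j = 1
      · have : ∃ k ∉ I, k ≠ j ∧ m k ≠ 0 := by
          by_contra! hcon
          exact hm ⟨hm1, hcon⟩
        obtain ⟨k, hk, hkj, hmk⟩ := this
        refine Finset.prod_eq_zero (Finset.mem_univ k) ?_
        simp [hx k hk, hkj.symm, hmk]
      · refine Finset.prod_eq_zero (Finset.mem_univ j) ?_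
        have : m j - 1 ≠ 0 := by omega
        simp [hx j hj, this]
    simp [this]

open IsLocalRing in
theorem sum_residue_eq_zero_of_weight {K : Type*} [Field K] {V : ValuationSubring K}
    [Algebra ℂ K] [Algebra ℂ V] [IsScalarTower ℂ V K] {ι : Type*} [Fintype ι] {x : ι → K}
    (hx : ∀ i, x i ≠ 0) {T : Finset (ι → ℕ)} {w : ι → ℚ} {a : ι → ResidueField V}
    (hwa : ∀ t ∈ T, ∀ t' ∈ T,
        (V.valuation (∏ i, x i ^ t i) < V.valuation (∏ i, x i ^ t' i) →
          ∑ i, w i * t' i < ∑ i, w i * t i) ∧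
        (V.valuation (∏ i, x i ^ t i) = V.valuation (∏ i, x i ^ t' i) →
          ∑ i, w i * t' i = ∑ i, w i * t i ∧
          ∀ r : V, (r : K) * ∏ i, x i ^ t' i = ∏ i, x i ^ t i →
            residue V r * ∏ i, a i ^ t' i = ∏ i, a i ^ t i))
    {S : Finset (ι →₀ ℕ)} (hST : ∀ m ∈ S, ⇑m ∈ T) {p q : (ι →₀ ℕ) → ℂ} {c : ℚ}
    (hp : ∀ m ∈ S, p m ≠ 0 → c ≤ ∑ i, w i * m i) (hq : ∀ m ∈ S, q m ≠ 0 → c ≤ ∑ i, w i * m i)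
    {s : K} (hs : V.valuation s < 1)
    (h : ∑ m ∈ S, algebraMap ℂ K (p m) * ∏ i, x i ^ m i +
      s * ∑ m ∈ S, algebraMap ℂ K (q m) * ∏ i, x i ^ m i = 0) :
    ∑ m ∈ S with ∑ i, w i * m i = c, algebraMap ℂ (ResidueField V) (p m) * ∏ i, a i ^ m i = 0 := by
  classical
  by_cases hex : ∃ m ∈ S, p m ≠ 0 ∧ ∑ i, w i * m i = c
  swap
  · refine Finset.sum_eq_zero fun m hm => ?_
    rw [Finset.mem_filter] at hm
    by_cases hpm : p m = 0
    · simp [hpm]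
    · exact absurd ⟨m, hm.1, hpm, hm.2⟩ hex
  obtain ⟨m0, hm0, hpm0, hm0c⟩ := hex
  have hne : ∀ t : ι → ℕ, ∏ i, x i ^ t i ≠ 0 := fun t =>
    Finset.prod_ne_zero_iff.mpr fun i _ => pow_ne_zero _ (hx i)
  have hvpos : 0 < V.valuation (∏ i, x i ^ m0 i) :=
    zero_lt_iff.mpr ((V.valuation.ne_zero_iff).mpr (hne m0))
  have hle : ∀ m ∈ S, c ≤ ∑ i, w i * m i →
      V.valuation (∏ i, x i ^ m i) ≤ V.valuation (∏ i, x i ^ m0 i) := by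
    intro m hm hc
    by_contra! hcon
    have := (hwa m0 (hST _ hm0) m (hST _ hm)).1 hcon
    linarith
  let S' := S.filter fun m => c ≤ ∑ i, w i * m i
  have hr : ∀ m, ∃ r : V, m ∈ S' → (r : K) * ∏ i, x i ^ m0 i = ∏ i, x i ^ m i := by
    intro m
    by_cases hm : m ∈ S'
    · refine ⟨⟨(∏ i, x i ^ m i) / ∏ i, x i ^ m0 i, ?_⟩, fun _ => div_mul_cancel₀ _ (hne m0)⟩
      rw [← V.valuation_le_one_iff, map_div₀]
      exact div_le_one_of_le₀ (hle m (Finset.mem_filter.mp hm).1 (Finset.mem_filter.mp hm).2)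
        zero_le
    · exact ⟨0, fun h => absurd h hm⟩
  choose r hr using hr
  have hsV : s ∈ V := by
    rw [← V.valuation_le_one_iff]; exact hs.le
  have hsum : ∀ g : (ι →₀ ℕ) → ℂ, (∀ m ∈ S, g m ≠ 0 → c ≤ ∑ i, w i * m i) →
      ∑ m ∈ S, algebraMap ℂ K (g m) * ∏ i, x i ^ m i =
        ((∑ m ∈ S', algebraMap ℂ V (g m) * r m : V) : K) * ∏ i, x i ^ m0 i := by
    intro g hg
    have : ((∑ m ∈ S', algebraMap ℂ V (g m) * r m : V) : K) =
        ∑ m ∈ S', algebraMap ℂ K (g m) * r m := by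
      change algebraMap V K _ = _
      rw [map_sum]
      refine Finset.sum_congr rfl fun m _ => ?_
      rw [map_mul, ← IsScalarTower.algebraMap_apply]; rfl
    rw [this, Finset.sum_mul]
    symm
    rw [Finset.sum_filter]
    refine Finset.sum_congr rfl fun m hm => ?_
    split_ifs with hc
    · rw [mul_assoc, hr m (Finset.mem_filter.mpr ⟨hm, hc⟩)]
    · have : g m = 0 := by
        by_contra h0; exact hc (hg m hm h0)
      simp [this]
  rw [hsum p hp, hsum q hq, ← mul_assoc, ← add_mul] at h
  have hV : (∑ m ∈ S', algebraMap ℂ V (p m) * r m) +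
      (⟨s, hsV⟩ : V) * ∑ m ∈ S', algebraMap ℂ V (q m) * r m = 0 := by
    ext1
    have := (mul_eq_zero.mp h).resolve_right (hne m0)
    simpa using this
  have hres := congrArg (residue V) hV
  have hs0 : residue V ⟨s, hsV⟩ = 0 := by
    rw [residue_eq_zero_iff]; exact (V.valuation_lt_one_iff _).mpr hs
  rw [map_add, map_mul, hs0, zero_mul, add_zero, map_zero, map_sum] at hres
  have hfin := congrArg (· * ∏ i, a i ^ m0 i) hres
  simp only [zero_mul, Finset.sum_mul] at hfin
  rw [← hfin, Finset.sum_filter, Finset.sum_filter]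
  refine Finset.sum_congr rfl fun m hm => ?_
  by_cases hc : c ≤ ∑ i, w i * m i
  · have hrm := hr m (Finset.mem_filter.mpr ⟨hm, hc⟩)
    rw [if_pos hc]
    by_cases hceq : ∑ i, w i * m i = c
    · rw [if_pos hceq, map_mul, mul_assoc]
      have hveq : V.valuation (∏ i, x i ^ m i) = V.valuation (∏ i, x i ^ m0 i) := by
        refine le_antisymm (hle m hm hc) ?_
        by_contra! hcon
        have := (hwa m (hST _ hm) m0 (hST _ hm0)).1 hcon
        linarith
      rw [((hwa m (hST _ hm) m0 (hST _ hm0)).2 hveq).2 (r m) hrm]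
      rfl
    · rw [if_neg hceq]
      have hvlt : V.valuation (∏ i, x i ^ m i) < V.valuation (∏ i, x i ^ m0 i) := by
        refine lt_of_le_of_ne (hle m hm hc) fun hveq => ?_
        have := ((hwa m (hST _ hm) m0 (hST _ hm0)).2 hveq).1
        exact hceq (by linarith)
      have hr0 : residue V (r m) = 0 := by
        rw [residue_eq_zero_iff]
        refine (V.valuation_lt_one_iff _).mpr ?_
        rw [← hrm, map_mul] at hvlt
        by_contra! hcon
        exact absurd hvlt (not_lt.mpr (le_mul_of_one_le_left' hcon))
      rw [map_mul, hr0]; simp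
  · rw [if_neg hc, if_neg]
    rintro rfl
    exact hc le_rfl

theorem LinearOff.sum_mul_eq {d : ℕ} {I : Finset (Fin d)} {j : Fin d} {m : Fin d →₀ ℕ}
    (hm : LinearOff I j m) (hj : j ∉ I) (W : Fin d → ℚ) :
    ∑ i, W i * m i = W j + ∑ i ∈ I, W i * m i := by
  rw [← Finset.sum_subset (Finset.subset_univ (insert j I)), Finset.sum_insert hj, hm.1]
  · simp
  · intro k _ hk
    rw [Finset.mem_insert, not_or] at hk
    simp [hm.2 k hk.2 hk.1]

theorem LinearOff.prod_pow_eq {d : ℕ} {κ : Type*} [CommMonoid κ] {I : Finset (Fin d)} {j : Fin d}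
    {m : Fin d →₀ ℕ} (hm : LinearOff I j m) (hj : j ∉ I) (y : Fin d → κ) :
    ∏ i, y i ^ m i = y j * ∏ i ∈ I, y i ^ m i := by
  rw [← Finset.prod_subset (Finset.subset_univ (insert j I)), Finset.prod_insert hj, hm.1]
  · simp
  · intro k _ hk
    rw [Finset.mem_insert, not_or] at hk
    simp [hm.2 k hk.2 hk.1]

open Classical in
/-- The variables outside `I` which occur linearly along the coordinate subspace of `I`. -/
def linearVars {d : ℕ} (f : MvPolynomial (Fin d) ℂ) (I : Finset (Fin d)) : Finset (Fin d) :=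
  {j | j ∉ I ∧ ∃ m ∈ f.support, LinearOff I j m}

theorem mem_linearVars {d : ℕ} {f : MvPolynomial (Fin d) ℂ} {I : Finset (Fin d)} {j : Fin d} :
    j ∈ linearVars f I ↔ j ∉ I ∧ ∃ m ∈ f.support, LinearOff I j m := by
  simp [linearVars]

theorem exists_sum_mul_eq_zero_of_card_le {κ ι : Type*} [Field κ] {I J : Finset ι}
    (hIJ : I.card ≤ J.card) (R : ι → ι → κ) {w : ι → κ} {i₀ : ι} (hi₀ : i₀ ∈ I) (hw : w i₀ ≠ 0)
    (hR : ∀ j ∈ J, ∑ i ∈ I, w i * R j i = 0) :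
    ∃ l : ι → κ, (∃ j ∈ J, l j ≠ 0) ∧ (∀ j ∉ J, l j = 0) ∧ ∀ i ∈ I, ∑ j ∈ J, l j * R j i = 0 := by
  classical
  let φ : (J → κ) →ₗ[κ] (I → κ) := 
    { toFun := fun l i => ∑ j, l j * R j i
      map_add' := fun l l' => by ext i; simp [add_mul, Finset.sum_add_distrib]
      map_smul' := fun c l => by ext i; simp [Finset.mul_sum, mul_assoc] }
  have hφ : ¬ Function.Injective φ := by
    intro hinj
    have h1 : Module.finrank κ (LinearMap.range φ) = J.card := by
      rw [LinearMap.finrank_range_of_inj hinj]; simp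
    have h2 : LinearMap.range φ = ⊤ := by
      apply Submodule.eq_top_of_finrank_eq
      refine le_antisymm (Submodule.finrank_le _) ?_
      rw [h1]; simpa using hIJ
    have h3 : ∀ v ∈ LinearMap.range φ, ∑ i : I, w i * v i = 0 := by
      rintro _ ⟨l, rfl⟩
      simp only [φ, LinearMap.coe_mk, AddHom.coe_mk, Finset.mul_sum]
      rw [Finset.sum_comm]
      refine Finset.sum_eq_zero fun j _ => ?_
      have := hR j j.2
      rw [← Finset.sum_coe_sort] at this
      calc _ = l j * ∑ i : I, w i * R j i := by
            rw [Finset.mul_sum]; exact Finset.sum_congr rfl fun i _ => by ring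
        _ = 0 := by rw [this, mul_zero]
    have h4 := h3 (Pi.single ⟨i₀, hi₀⟩ 1) (h2 ▸ Submodule.mem_top)
    rw [Finset.sum_eq_single ⟨i₀, hi₀⟩] at h4
    · simp [hw] at h4
    · intro b _ hb; simp [hb]
    · simp
  rw [← LinearMap.ker_eq_bot, Submodule.eq_bot_iff] at hφ
  push Not at hφ
  obtain ⟨l, hl, hl0⟩ := hφ
  obtain ⟨j, hj⟩ := Function.ne_iff.mp hl0
  refine ⟨fun j => if h : j ∈ J then l ⟨j, h⟩ else 0, ⟨j, j.2, by simpa using hj⟩,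
    fun j hj => by simp [hj], fun i hi => ?_⟩
  have := congrFun (LinearMap.mem_ker.mp hl) ⟨i, hi⟩
  simp only [φ, LinearMap.coe_mk, AddHom.coe_mk, Pi.zero_apply] at this
  rw [← Finset.sum_coe_sort, ← this]
  exact Finset.sum_congr rfl fun j _ => by simp

open Classical in
theorem NonDegenerate.false_of_linear_singular {d : ℕ} {f : MvPolynomial (Fin d) ℂ}
    (hnd : NonDegenerate f) (hf0 : eval (0 : Fin d → ℂ) f = 0) {κ : Type*} [Field κ] [Algebra ℂ κ]
    {I : Finset (Fin d)} (hI : I.Nonempty) (hIf : ∀ m ∈ f.support, ∃ j ∉ I, m j ≠ 0)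
    (hcard : I.card ≤ (linearVars f I).card) {w : Fin d → ℚ} (hwI : ∀ i ∈ I, 0 < w i)
    (hwJ : ∀ j ∉ I, w j = 0) {a : Fin d → κ} (ha : ∀ i, a i ≠ 0) (haJ : ∀ j ∉ I, a j = 1)
    {c : Fin d → ℚ} (hc : ∀ j ∈ linearVars f I, ∀ m ∈ f.support, LinearOff I j m →
      c j ≤ ∑ i, w i * m i)
    (hex : ∀ j ∈ linearVars f I, ∃ m ∈ f.support, LinearOff I j m ∧ ∑ i, w i * m i = c j)
    (hG : ∀ j ∈ linearVars f I,
      ∑ m ∈ f.support with LinearOff I j m ∧ ∑ i, w i * m i = c j,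
        algebraMap ℂ κ (coeff m f) * ∏ k, a k ^ m k = 0) : False := by
  have : CharZero κ := charZero_of_injective_algebraMap (algebraMap ℂ κ).injective
  obtain ⟨i₀, hi₀⟩ := hI
  let E : Fin d → Finset (Fin d →₀ ℕ) := fun j =>
    f.support.filter fun m => LinearOff I j m ∧ ∑ i, w i * m i = c j
  let t : (Fin d →₀ ℕ) → κ := fun m => algebraMap ℂ κ (coeff m f) * ∏ k, a k ^ m k
  obtain ⟨l, ⟨j₀, hj₀, hlj₀⟩, hl0, hl⟩ := exists_sum_mul_eq_zero_of_card_le hcard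
    (fun j i => ∑ m ∈ E j, (m i : κ) * t m) (w := fun i => (w i : κ)) hi₀
    (by simpa using (hwI i₀ hi₀).ne') (by
      intro j hj
      simp only [Finset.mul_sum]
      rw [Finset.sum_comm]
      have : ∀ m ∈ E j, ∑ i ∈ I, (w i : κ) * (m i * t m) = c j * t m := by
        intro m hm
        rw [← (Finset.mem_filter.mp hm).2.2]
        push_cast
        rw [Finset.sum_mul]
        simp only [← mul_assoc]
        refine Finset.sum_subset (Finset.subset_univ _) fun k _ hk => ?_
        simp [hwJ k hk]
      rw [Finset.sum_congr rfl this, ← Finset.mul_sum]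
      exact mul_eq_zero_of_right _ (hG j hj))
  have hc0 : ∀ j ∈ linearVars f I, 0 ≤ c j := by
    intro j hj
    obtain ⟨m, _, _, h⟩ := hex j hj
    rw [← h]
    refine Finset.sum_nonneg fun i _ => mul_nonneg ?_ (Nat.cast_nonneg _)
    by_cases hi : i ∈ I
    · exact (hwI i hi).le
    · exact (hwJ i hi).ge
  let B : ℚ := 2 * ∑ j ∈ linearVars f I, c j + 1
  have hB : ∀ j ∈ linearVars f I, 2 * c j < B := by
    intro j hj
    have := Finset.single_le_sum hc0 hj
    simp only [B]; linarith
  have hB0 : 0 < B := by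
    have := Finset.sum_nonneg hc0
    simp only [B]; linarith
  let W : Fin d → ℚ := fun i => if i ∈ I then w i else if l i ≠ 0 then B - c i else 2 * B
  have hlK : ∀ j, l j ≠ 0 → j ∈ linearVars f I := fun j hj => by
    by_contra h; exact hj (hl0 j h)
  have hWI : ∀ i ∈ I, W i = w i := fun i hi => by simp [W, hi]
  have hWJ : ∀ j ∉ I, B < 2 * W j := by
    intro j hj
    simp only [W, hj, if_false]
    split_ifs with h
    · have := hB j (hlK j h); linarith
    · linarith
  have hW : ∀ i, 0 < W i := by
    intro i
    by_cases hi : i ∈ I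
    · rw [hWI i hi]; exact hwI i hi
    · have := hWJ i hi; linarith
  have hWlin : ∀ j, l j ≠ 0 → ∀ m, LinearOff I j m →
      ∑ i, W i * m i = ∑ i, w i * m i + (B - c j) := by
    intro j hj m hm
    have hjI := (mem_linearVars.mp (hlK j hj)).1
    rw [hm.sum_mul_eq hjI, hm.sum_mul_eq hjI, hwJ j hjI,
      Finset.sum_congr rfl fun i hi => by rw [hWI i hi]]
    simp only [W, hjI, hj, if_false, ne_eq, not_false_eq_true, if_true]
    ring
  have hWm : ∀ m : Fin d →₀ ℕ, ∀ k, W k * m k ≤ ∑ i, W i * m i := fun m k =>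
    Finset.single_le_sum (f := fun i => W i * (m i : ℚ))
      (fun i _ => mul_nonneg (hW i).le (Nat.cast_nonneg _)) (Finset.mem_univ k)
  have hclass : ∀ m ∈ f.support, (∃ j, l j ≠ 0 ∧ LinearOff I j m) ∨ B < ∑ i, W i * m i := by
    intro m hm
    obtain ⟨j, hj, hmj⟩ := hIf m hm
    have hWj := hWJ j hj
    by_cases hlin : LinearOff I j m
    · by_cases hlj : l j ≠ 0
      · exact Or.inl ⟨j, hlj, hlin⟩
      · right
        refine lt_of_lt_of_le ?_ (hWm m j)
        simp only [W, hj, hlj, if_false, hlin.1]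
        push_cast; linarith
    · right
      by_cases hmj1 : m j = 1
      · have : ∃ k ∉ I, k ≠ j ∧ m k ≠ 0 := by
          by_contra! hcon
          exact hlin ⟨hmj1, hcon⟩
        obtain ⟨k, hk, hkj, hmk⟩ := this
        have hWk := hWJ k hk
        have h1 : W j * m j + W k * m k ≤ ∑ i, W i * m i := by
          rw [← Finset.sum_pair (f := fun i => W i * (m i : ℚ)) hkj.symm]
          exact Finset.sum_le_sum_of_subset_of_nonneg (Finset.subset_univ _)
            fun i _ _ => mul_nonneg (hW i).le (Nat.cast_nonneg _)
        have h2 : W k ≤ W k * m k := le_mul_of_one_le_right (hW k).le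
          (by exact_mod_cast Nat.one_le_iff_ne_zero.mpr hmk)
        rw [hmj1] at h1
        push_cast at h1
        linarith
      · have h2 : W j * 2 ≤ W j * m j := by
          refine mul_le_mul_of_nonneg_left ?_ (hW j).le
          have : 2 ≤ m j := by omega
          exact_mod_cast this
        have := hWm m j
        linarith
  have hset : (f.support.filter fun m => ∑ i, W i * m i = B) =
      (Finset.univ.filter fun j => l j ≠ 0).biUnion E := by
    ext m
    simp only [Finset.mem_filter, Finset.mem_biUnion, Finset.mem_univ, true_and, E]
    constructor
    · rintro ⟨hm, hmB⟩
      rcases hclass m hm with ⟨j, hj, hlin⟩ | h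
      · refine ⟨j, hj, hm, hlin, ?_⟩
        have := hWlin j hj m hlin
        linarith
      · exact absurd hmB h.ne'
    · rintro ⟨j, hj, hm, hlin, hmc⟩
      refine ⟨hm, ?_⟩
      rw [hWlin j hj m hlin, hmc]; ring
  have hdisj :
      ((Finset.univ.filter fun j => l j ≠ 0 : Finset (Fin d)) : Set (Fin d)).PairwiseDisjoint
      E := by
    intro j hj k hk hjk
    rw [Function.onFun, Finset.disjoint_left]
    intro m hmj hmk
    have hj' := (mem_linearVars.mp (hlK j (by simpa using hj))).1
    have h1 := (Finset.mem_filter.mp hmj).2.1.1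
    have h2 := (Finset.mem_filter.mp hmk).2.1.2 j hj' hjk
    omega
  let y : Fin d → κ := fun i => if i ∈ I then a i else if l i ≠ 0 then l i else 1
  have hy : ∀ j, l j ≠ 0 → ∀ m, LinearOff I j m → ∏ k, y k ^ m k = l j * ∏ k, a k ^ m k := by
    intro j hj m hm
    have hjI := (mem_linearVars.mp (hlK j hj)).1
    rw [hm.prod_pow_eq hjI, hm.prod_pow_eq hjI, haJ j hjI,
      Finset.prod_congr rfl fun i hi => by rw [show y i = a i by simp [y, hi]]]
    simp [y, hjI, hj]
  refine hnd.false_of_singular hf0 hW (c := B) (y := y) ?_ ?_ ?_ ?_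
  · intro m hm
    rcases hclass m hm with ⟨j, hj, hlin⟩ | h
    · rw [hWlin j hj m hlin]
      have := hc j (hlK j hj) m hm hlin
      linarith
    · exact h.le
  · obtain ⟨m, hm, hlin, hmc⟩ := hex j₀ hj₀
    refine ⟨m, hm, ?_⟩
    rw [hWlin j₀ hlj₀ m hlin, hmc]; ring
  · intro i
    simp only [y]
    split_ifs with h1 h2
    · exact ha i
    · exact h2
    · exact one_ne_zero
  · intro i
    rw [hset, Finset.sum_biUnion hdisj]
    have hE : ∀ j, l j ≠ 0 → ∑ m ∈ E j, (m i : κ) * (algebraMap ℂ κ (coeff m f) * ∏ k, y k ^ m k) =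
        l j * ∑ m ∈ E j, (m i : κ) * t m := by
      intro j hj
      rw [Finset.mul_sum]
      refine Finset.sum_congr rfl fun m hm => ?_
      rw [hy j hj m (Finset.mem_filter.mp hm).2.1]
      simp only [t]; ring
    by_cases hi : i ∈ I
    · rw [Finset.sum_congr rfl fun j hj => hE j (Finset.mem_filter.mp hj).2]
      refine Eq.trans ?_ (hl i hi)
      refine Finset.sum_subset (fun j hj => hlK j (Finset.mem_filter.mp hj).2) fun j _ hj => ?_
      have : l j = 0 := by simpa using hj
      rw [this, zero_mul]
    · refine Finset.sum_eq_zero fun j hj => ?_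
      have hlj := (Finset.mem_filter.mp hj).2
      rw [hE j hlj]
      by_cases hij : i = j
      · subst hij
        have : ∑ m ∈ E i, (m i : κ) * t m = ∑ m ∈ E i, t m := by
          refine Finset.sum_congr rfl fun m hm => ?_
          rw [(Finset.mem_filter.mp hm).2.1.1]; simp
        rw [this]
        exact mul_eq_zero_of_right _ (hG i (hlK i hlj))
      · refine mul_eq_zero_of_right _ (Finset.sum_eq_zero fun m hm => ?_)
        rw [(Finset.mem_filter.mp hm).2.1.2 i hi hij]; simp

open Classical IsLocalRing in
theorem NonDegenerate.eq_zero_of_critical {d : ℕ} {f h : MvPolynomial (Fin d) ℂ}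
    (hnd : NonDegenerate f) (hf0 : eval (0 : Fin d → ℂ) f = 0) (hdom : DominatesSupport f h)
    (hstar : ∀ I : Finset (Fin d), I.Nonempty → (∀ m ∈ f.support, ∃ j ∉ I, m j ≠ 0) →
      I.card ≤ (linearVars f I).card)
    {K : Type*} [Field K] {V : ValuationSubring K} [Algebra ℂ K] [Algebra ℂ V]
    [IsScalarTower ℂ V K] {x : Fin d → K} (hx : ∀ i, V.valuation (x i) < 1) {s : K}
    (hs : V.valuation s < 1) (hcrit : ∀ i, aeval x (pderiv i f) + s * aeval x (pderiv i h) = 0) :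
    ∀ i, x i = 0 := by
  by_contra! hne
  let I : Finset (Fin d) := Finset.univ.filter fun i => x i ≠ 0
  have hI : I.Nonempty := by
    obtain ⟨i, hi⟩ := hne
    exact ⟨i, by simpa [I] using hi⟩
  let x' : Fin d → K := fun i => if i ∈ I then x i else 1
  have hx'I : ∀ i ∈ I, x' i = x i := fun i hi => by simp [x', hi]
  have hx'J : ∀ j ∉ I, x' j = 1 := fun j hj => by simp [x', hj]
  have hxJ : ∀ j ∉ I, x j = 0 := fun j hj => by simpa [I] using hj
  have hx'0 : ∀ i, x' i ≠ 0 := by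
    intro i
    by_cases hi : i ∈ I
    · rw [hx'I i hi]; simpa [I] using hi
    · rw [hx'J i hi]; exact one_ne_zero
  let S : Finset (Fin d →₀ ℕ) := f.support ∪ h.support
  have hSf : f.support ⊆ S := Finset.subset_union_left
  have hSh : h.support ⊆ S := Finset.subset_union_right
  let T : Finset (Fin d → ℕ) := S.image (fun m : Fin d →₀ ℕ => (⇑m : Fin d → ℕ)) ∪
    insert 0 (Finset.univ.image fun i => Pi.single i 1)
  obtain ⟨w, a, ha, hwa⟩ := exists_weight_of_valuationSubring V x' hx'0 T
  have hST : ∀ m ∈ S, ⇑m ∈ T := fun m hm =>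
    Finset.mem_union_left _ (Finset.mem_image_of_mem (fun m : Fin d →₀ ℕ => (⇑m : Fin d → ℕ)) hm)
  have h0T : (0 : Fin d → ℕ) ∈ T := Finset.mem_union_right _ (Finset.mem_insert_self _ _)
  have hsT : ∀ i, (Pi.single i 1 : Fin d → ℕ) ∈ T := fun i => Finset.mem_union_right _
    (Finset.mem_insert_of_mem (Finset.mem_image_of_mem _ (Finset.mem_univ i)))
  have hprod : ∀ {M : Type _} [CommMonoid M] (z : Fin d → M) (i : Fin d),
      ∏ k, z k ^ (Pi.single i 1 : Fin d → ℕ) k = z i := by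
    intro M _ z i
    rw [Finset.prod_eq_single i]
    · simp
    · intro b _ hb; simp [hb]
    · simp
  have hsum : ∀ i : Fin d, ∑ k, w k * ((Pi.single i 1 : Fin d → ℕ) k : ℕ) = w i := by
    intro i
    rw [Finset.sum_eq_single i]
    · simp
    · intro b _ hb; simp [hb]
    · simp
  have hwI : ∀ i ∈ I, 0 < w i := by
    intro i hi
    have := (hwa _ (hsT i) 0 h0T).1 (by
      rw [hprod x' i, hx'I i hi]; simpa using hx i)
    rw [hsum] at this
    simpa using this
  have hwaJ : ∀ j ∉ I, w j = 0 ∧ a j = 1 := by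
    intro j hj
    have := (hwa _ (hsT j) 0 h0T).2 (by rw [hprod x' j, hx'J j hj]; simp)
    rw [hsum, hprod x' j, hprod a j, hx'J j hj] at this
    refine ⟨by simpa using this.1.symm, ?_⟩
    have h2 := this.2 1 (by simp)
    simpa using h2.symm
  have hwJ := fun j hj => (hwaJ j hj).1
  have haJ := fun j hj => (hwaJ j hj).2
  have hw0 : ∀ i, 0 ≤ w i := by
    intro i
    by_cases hi : i ∈ I
    · exact (hwI i hi).le
    · exact (hwJ i hi).ge
  have hsum0 : ∀ (W : Fin d → ℚ), (∀ i, 0 ≤ W i) → ∀ m : Fin d →₀ ℕ, ∀ k,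
      W k * m k ≤ ∑ i, W i * m i := fun W hW m k =>
    Finset.single_le_sum (f := fun i => W i * (m i : ℚ))
      (fun i _ => mul_nonneg (hW i) (Nat.cast_nonneg _)) (Finset.mem_univ k)
  by_cases hcase : ∀ m ∈ f.support, ∃ j ∉ I, m j ≠ 0
  · have hcex : ∀ j, ∃ c, j ∈ linearVars f I →
        (∀ m ∈ f.support, LinearOff I j m → c ≤ ∑ i, w i * m i) ∧
        ∃ m ∈ f.support, LinearOff I j m ∧ ∑ i, w i * m i = c := by
      intro j
      by_cases hj : j ∈ linearVars f I
      · obtain ⟨m, hm, hlin⟩ := (mem_linearVars.mp hj).2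
        obtain ⟨m0, hm0, hmin⟩ := Finset.exists_min_image
          (f.support.filter fun m => LinearOff I j m) (fun m => ∑ i, w i * (m i : ℚ))
          ⟨m, Finset.mem_filter.mpr ⟨hm, hlin⟩⟩
        exact ⟨_, fun _ => ⟨fun m hm hlin => hmin m (Finset.mem_filter.mpr ⟨hm, hlin⟩),
          m0, (Finset.mem_filter.mp hm0).1, (Finset.mem_filter.mp hm0).2, rfl⟩⟩
      · exact ⟨0, fun h => absurd h hj⟩
    choose c hc using hcex
    refine hnd.false_of_linear_singular hf0 hI hcase (hstar I hI hcase) hwI hwJ ha haJ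
      (fun j hj => (hc j hj).1) (fun j hj => (hc j hj).2) fun j hj => ?_
    obtain ⟨hjI, -⟩ := mem_linearVars.mp hj
    obtain ⟨hcmin, m0, hm0, hlin0, hm0c⟩ := hc j hj
    have hcj : 0 ≤ c j := by
      rw [← hm0c]
      exact Finset.sum_nonneg fun i _ => mul_nonneg (hw0 i) (Nat.cast_nonneg _)
    have hhmin : ∀ m ∈ h.support, LinearOff I j m → c j ≤ ∑ i, w i * m i := by
      intro m hm hlin
      let W : Fin d → ℚ := fun i => if i ∈ I then w i else if i = j then c j else 2 * c j
      have hW0 : ∀ i, 0 ≤ W i := by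
        intro i
        simp only [W]
        split_ifs
        · exact hw0 i
        · exact hcj
        · linarith
      have hWlin : ∀ m, LinearOff I j m → ∑ i, W i * m i = c j + ∑ i, w i * m i := by
        intro m hm
        rw [hm.sum_mul_eq hjI, hm.sum_mul_eq hjI, hwJ j hjI, zero_add,
          Finset.sum_congr rfl fun i hi => by rw [show W i = w i by simp [W, hi]]]
        simp [W, hjI]
      have := hdom W hW0 (2 * c j) (by
        intro m hm
        by_cases hlin : LinearOff I j m
        · rw [hWlin m hlin]
          have := hcmin m hm hlin
          linarith
        · by_cases hk : ∃ k ∉ I, k ≠ j ∧ m k ≠ 0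
          · obtain ⟨k, hkI, hkj, hmk⟩ := hk
            refine le_trans ?_ (hsum0 W hW0 m k)
            simp only [W, hkI, hkj, if_false]
            exact le_mul_of_one_le_right (by linarith)
              (by exact_mod_cast Nat.one_le_iff_ne_zero.mpr hmk)
          · push Not at hk
            obtain ⟨k, hkI, hmk⟩ := hcase m hm
            have hkj : k = j := by
              by_contra hkj; exact hmk (hk k hkI hkj)
            subst hkj
            have h1 : m k ≠ 1 := fun h1 => hlin ⟨h1, hk⟩
            refine le_trans ?_ (hsum0 W hW0 m k)
            simp only [W, hkI, if_false, if_true]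
            rw [mul_comm]
            refine mul_le_mul_of_nonneg_left ?_ hcj
            have : 2 ≤ m k := by omega
            exact_mod_cast this) m hm
      rw [hWlin m hlin] at this
      linarith
    have key := sum_residue_eq_zero_of_weight hx'0 hwa
      (S := S.filter fun m => LinearOff I j m) (p := fun m => coeff m f) (q := fun m => coeff m h)
      (c := c j) (fun m hm => hST m (Finset.mem_filter.mp hm).1)
      (fun m hm hp => hcmin m (mem_support_iff.mpr hp) (Finset.mem_filter.mp hm).2)
      (fun m hm hp => hhmin m (mem_support_iff.mpr hp) (Finset.mem_filter.mp hm).2) hs (by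
        have h1 := aeval_pderiv_eq_sum f hSf hx'I hxJ hx'J hjI
        have h2 := aeval_pderiv_eq_sum h hSh hx'I hxJ hx'J hjI
        have h3 := hcrit j
        rwa [h1, h2] at h3)
    rw [Finset.filter_filter] at key
    rw [← key]
    refine Finset.sum_subset (Finset.filter_subset_filter _ hSf) fun m hm hm' => ?_
    have : coeff m f = 0 := by
      by_contra h0
      exact hm' (Finset.mem_filter.mpr ⟨mem_support_iff.mpr h0, (Finset.mem_filter.mp hm).2⟩)
    simp [this]
  · push Not at hcase
    obtain ⟨m1, hm1, hm1J⟩ := hcase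
    let P : (Fin d →₀ ℕ) → Prop := fun m => ∀ j ∉ I, m j = 0
    obtain ⟨m0, hm0, hmin⟩ := Finset.exists_min_image
      (f.support.filter P) (fun m => ∑ i, w i * (m i : ℚ))
      ⟨m1, Finset.mem_filter.mpr ⟨hm1, hm1J⟩⟩
    rw [Finset.mem_filter] at hm0
    obtain ⟨c, hc⟩ : ∃ c, c = ∑ i, w i * (m0 i : ℚ) := ⟨_, rfl⟩
    rw [← hc] at hmin
    have hc0 : 0 ≤ c := by
      rw [hc]
      exact Finset.sum_nonneg fun i _ => mul_nonneg (hw0 i) (Nat.cast_nonneg _)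
    let W : Fin d → ℚ := fun i => if i ∈ I then w i else c + 1
    have hW : ∀ i, 0 < W i := by
      intro i
      simp only [W]
      split_ifs with hi
      · exact hwI i hi
      · linarith
    have hWP : ∀ m, P m → ∑ i, W i * m i = ∑ i, w i * m i := by
      intro m hm
      refine Finset.sum_congr rfl fun i _ => ?_
      by_cases hi : i ∈ I
      · simp [W, hi]
      · simp [hm i hi]
    have hWnP : ∀ m, ¬ P m → c < ∑ i, W i * m i := by
      intro m hm
      simp only [P] at hm
      push Not at hm
      obtain ⟨j, hj, hmj⟩ := hm
      refine lt_of_lt_of_le ?_ (hsum0 W (fun i => (hW i).le) m j)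
      simp only [W, hj, if_false]
      refine lt_of_lt_of_le (lt_add_one c) (le_mul_of_one_le_right (by linarith)
              (by exact_mod_cast Nat.one_le_iff_ne_zero.mpr hmj))
    have hWf : ∀ m ∈ f.support, c ≤ ∑ i, W i * m i := by
      intro m hm
      by_cases hP : P m
      · rw [hWP m hP]; exact hmin m (Finset.mem_filter.mpr ⟨hm, hP⟩)
      · exact (hWnP m hP).le
    have hWh := hdom W (fun i => (hW i).le) c hWf
    refine hnd.false_of_singular hf0 hW hWf ⟨m0, hm0.1, by rw [hWP m0 hm0.2, hc]⟩ ha fun i => ?_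
    have hmc : ∀ (g : MvPolynomial (Fin d) ℂ), ∀ m, (m i : ℂ) * coeff m g ≠ 0 → m ∈ g.support :=
      fun g m hm => mem_support_iff.mpr (right_ne_zero_of_mul hm)
    have key := sum_residue_eq_zero_of_weight hx'0 hwa
      (S := S.filter P) (p := fun m => m i * coeff m f) (q := fun m => m i * coeff m h)
      (c := c) (fun m hm => hST m (Finset.mem_filter.mp hm).1)
      (fun m hm hp => by
        rw [← hWP m (Finset.mem_filter.mp hm).2]; exact hWf m (hmc f m hp))
      (fun m hm hp => by
        rw [← hWP m (Finset.mem_filter.mp hm).2]; exact hWh m (hmc h m hp)) hs (by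
        have h1 := mul_aeval_pderiv_eq_sum f hSf hx'I hxJ i
        have h2 := mul_aeval_pderiv_eq_sum h hSh hx'I hxJ i
        have h3 : x i * (aeval x (pderiv i f) + s * aeval x (pderiv i h)) = 0 := by
          rw [hcrit i, mul_zero]
        rw [mul_add, mul_left_comm, h1, h2] at h3
        convert h3 using 3)
    rw [Finset.filter_filter] at key
    rw [← key]
    refine Finset.sum_congr_of_eq_on_inter ?_ ?_ ?_
    · intro m hm hm'
      rw [Finset.mem_filter] at hm hm'
      exfalso
      refine hm' ⟨hSf hm.1, ?_⟩
      have hP : P m := by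
        by_contra hP
        exact (hWnP m hP).ne' hm.2
      exact ⟨hP, by rw [← hWP m hP]; exact hm.2⟩
    · intro m hm hm'
      rw [Finset.mem_filter] at hm
      have : coeff m f = 0 := by
        by_contra h0
        exact hm' (Finset.mem_filter.mpr ⟨mem_support_iff.mpr h0, by
          rw [hWP m hm.2.1]; exact hm.2.2⟩)
      simp [this]
    · intro m _ _
      rw [map_mul, map_natCast, mul_assoc]

/-- The generators of the relative Jacobian ideal of the pencil `f + s h`, with parameter `s`. -/
def pencilJacobian {d : ℕ} (f h : MvPolynomial (Fin d) ℂ) (i : Fin d) :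
    MvPolynomial (Fin d) (Polynomial ℂ) :=
  map Polynomial.C (pderiv i f) + C Polynomial.X * map Polynomial.C (pderiv i h)

/-- Evaluation at the origin of the total space of the pencil. -/
def pencilEval (d : ℕ) : MvPolynomial (Fin d) (Polynomial ℂ) →+* ℂ :=
  (Polynomial.evalRingHom 0).comp (eval 0)

theorem NonDegenerate.map_X_eq_zero_of_pencilJacobian {d : ℕ} {f h : MvPolynomial (Fin d) ℂ}
    (hnd : NonDegenerate f) (hf0 : eval (0 : Fin d → ℂ) f = 0) (hdom : DominatesSupport f h)
    (hstar : ∀ I : Finset (Fin d), I.Nonempty → (∀ m ∈ f.support, ∃ j ∉ I, m j ≠ 0) →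
      I.card ≤ (linearVars f I).card) {K : Type*} [Field K] [Algebra ℂ K]
    (ψ : MvPolynomial (Fin d) (Polynomial ℂ) →ₐ[ℂ] K)
    (hψ : ∀ p, ψ p = 0 → p ∈ RingHom.ker (pencilEval d))
    (hF : ∀ i, ψ (pencilJacobian f h i) = 0) (i : Fin d) : ψ (X i) = 0 := by
  let A₀ : Subring K := (ψ : MvPolynomial (Fin d) (Polynomial ℂ) →+* K).range
  let ρ : MvPolynomial (Fin d) (Polynomial ℂ) →+* A₀ := RingHom.rangeRestrict _
  have hρ : Function.Surjective ρ := RingHom.rangeRestrict_surjective _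
  let n₀ : Ideal A₀ := (RingHom.ker (pencilEval d)).map ρ
  have hn₀ : n₀ ≠ ⊤ := by
    intro htop
    obtain ⟨a, ha, ha1⟩ := (Ideal.mem_map_iff_of_surjective ρ hρ).mp
      ((Ideal.eq_top_iff_one _).mp htop)
    have h1 : ψ a = 1 := congrArg Subtype.val ha1
    have h2 : ψ (1 - a) = 0 := by rw [map_sub, h1, map_one, sub_self]
    have h3 := add_mem (hψ _ h2) ha
    rw [sub_add_cancel, RingHom.mem_ker, map_one] at h3
    exact one_ne_zero h3
  obtain ⟨V, hAV, hV⟩ := Ideal.image_subset_nonunits_valuationSubring n₀ hn₀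
  have hval : ∀ p ∈ RingHom.ker (pencilEval d), V.valuation (ψ p) < 1 := by
    intro p hp
    rw [← ValuationSubring.mem_nonunits_iff]
    exact hV ⟨ρ p, Ideal.mem_map_of_mem ρ hp, rfl⟩
  let φ : ℂ →+* V := (algebraMap ℂ K).codRestrict V.toSubring fun z =>
    hAV ⟨algebraMap ℂ _ z, ψ.commutes z⟩
  let _ : Algebra ℂ V := φ.toAlgebra
  have : IsScalarTower ℂ V K := IsScalarTower.of_algebraMap_eq fun _ => rfl
  have haev : ∀ g : MvPolynomial (Fin d) ℂ,
      aeval (fun i => ψ (X i)) g = ψ (map Polynomial.C g) := by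
    intro g
    induction g using MvPolynomial.induction_on with
    | C a =>
      rw [algHom_C, map_C]
      exact (ψ.commutes a).symm
    | add p q hp hq => simp only [map_add, hp, hq]
    | mul_X p i hp => simp only [map_mul, hp, aeval_X, map_X]
  refine hnd.eq_zero_of_critical hf0 hdom hstar (V := V)
    (x := fun i => ψ (X i)) (s := ψ (C Polynomial.X)) ?_ ?_ ?_ i
  · intro i
    exact hval _ (by simp [pencilEval, RingHom.mem_ker])
  · exact hval _ (by simp [pencilEval, RingHom.mem_ker])
  · intro i
    rw [haev, haev, ← map_mul, ← map_add]
    exact hF i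

theorem NonDegenerate.X_mem_of_pencilJacobian_mem {d : ℕ} {f h : MvPolynomial (Fin d) ℂ}
    (hnd : NonDegenerate f) (hf0 : eval (0 : Fin d → ℂ) f = 0) (hdom : DominatesSupport f h)
    (hstar : ∀ I : Finset (Fin d), I.Nonempty → (∀ m ∈ f.support, ∃ j ∉ I, m j ≠ 0) →
      I.card ≤ (linearVars f I).card)
    {Q : Ideal (MvPolynomial (Fin d) (Polynomial ℂ))} (hQ : Q.IsPrime)
    (hQn : Q ≤ RingHom.ker (pencilEval d)) (hF : ∀ i, pencilJacobian f h i ∈ Q) (i : Fin d) :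
    X i ∈ Q := by
  let D := MvPolynomial (Fin d) (Polynomial ℂ) ⧸ Q
  let K := FractionRing D
  let ψ : MvPolynomial (Fin d) (Polynomial ℂ) →ₐ[ℂ] K :=
    (IsScalarTower.toAlgHom ℂ D K).comp (Ideal.Quotient.mkₐ ℂ Q)
  have hψ : ∀ p, ψ p = 0 ↔ p ∈ Q := by
    intro p
    rw [← Ideal.Quotient.eq_zero_iff_mem, ← (IsFractionRing.injective D K).eq_iff, map_zero]
    rfl
  exact (hψ _).mp (hnd.map_X_eq_zero_of_pencilJacobian hf0 hdom hstar ψ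
    (fun p hp => hQn ((hψ p).mp hp)) (fun i => (hψ _).mpr (hF i)) i)

theorem exists_notMem_forall_pow_mul_mem {R : Type*} [CommRing R] [IsNoetherianRing R]
    {n I J : Ideal R} [n.IsPrime]
    (h : ∀ Q : Ideal R, Q.IsPrime → Q ≤ n → J ≤ Q → I ≤ Q) :
    ∃ u ∉ n, ∃ N : ℕ, ∀ k, N ≤ k → ∀ b ∈ I ^ k, u * b ∈ J := by
  classical
  have hfin : (J.minimalPrimes).Finite := Ideal.finite_minimalPrimes_of_isNoetherianRing R J
  let s := hfin.toFinset.filter fun Q => ¬ Q ≤ n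
  obtain ⟨u, hu, hun⟩ : ∃ u ∈ s.inf id, u ∉ n := by
    by_contra! hcon
    obtain ⟨Q, hQ, hQn⟩ := (Ideal.IsPrime.inf_le' (s := s) (f := id) ‹n.IsPrime›).mp hcon
    exact (Finset.mem_filter.mp hQ).2 hQn
  have hrad : Ideal.span {u} * I ≤ J.radical := by
    rw [← Ideal.sInf_minimalPrimes]
    refine le_sInf fun Q hQ => ?_
    by_cases hQn : Q ≤ n
    · exact Ideal.mul_le_right.trans (h Q hQ.1.1 hQn hQ.1.2)
    · refine Ideal.mul_le_left.trans ?_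
      rw [Ideal.span_singleton_le_iff_mem]
      exact (Finset.inf_le (f := id) (Finset.mem_filter.mpr ⟨hfin.mem_toFinset.mpr hQ, hQn⟩)) hu
  obtain ⟨N, hN⟩ := Ideal.exists_pow_le_of_le_radical_of_fg hrad
    (IsNoetherian.noetherian (Ideal.span {u} * I))
  refine ⟨u ^ N, fun hmem => hun (‹n.IsPrime›.mem_of_pow_mem N hmem), N, fun k hk b hb => ?_⟩
  refine hN ?_
  rw [mul_pow, Ideal.span_singleton_pow]
  exact Ideal.mul_mem_mul (Ideal.mem_span_singleton_self _) (Ideal.pow_le_pow_right hk hb)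

/-- The Jacobian ideal of a polynomial. -/
def jacobianIdeal {d : ℕ} (f : MvPolynomial (Fin d) ℂ) : Ideal (MvPolynomial (Fin d) ℂ) :=
  Ideal.span (Set.range fun i => pderiv i f)

theorem pencilEval_X {d : ℕ} (i : Fin d) : pencilEval d (X i) = 0 := by simp [pencilEval]

theorem pencilEval_C {d : ℕ} (p : Polynomial ℂ) : pencilEval d (C p) = p.eval 0 := by
  simp [pencilEval]

theorem sub_C_pencilEval_mem {d : ℕ} {Q : Ideal (MvPolynomial (Fin d) (Polynomial ℂ))}
    (hX : ∀ i, X i ∈ Q) (hs : C Polynomial.X ∈ Q) (p : MvPolynomial (Fin d) (Polynomial ℂ)) :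
    p - C (Polynomial.C (pencilEval d p)) ∈ Q := by
  induction p using MvPolynomial.induction_on with
  | C a =>
    rw [pencilEval_C, ← C_sub]
    have : Polynomial.X ∣ a - Polynomial.C (a.eval 0) := by
      rw [Polynomial.X_dvd_iff]; simp [Polynomial.coeff_zero_eq_eval_zero]
    exact Q.mem_of_dvd (map_dvd C this) hs
  | add p q hp hq =>
    have := add_mem hp hq
    rw [map_add, map_add, map_add]
    convert this using 1; ring
  | mul_X p i hp =>
    rw [map_mul, pencilEval_X, mul_zero, map_zero, map_zero, sub_zero]
    exact Q.mul_mem_left _ (hX i)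

theorem exists_notMem_mul_mem_of_pencil {d : ℕ} {f h : MvPolynomial (Fin d) ℂ}
    (hX : ∀ Q : Ideal (MvPolynomial (Fin d) (Polynomial ℂ)), Q.IsPrime →
      Q ≤ RingHom.ker (pencilEval d) → (∀ i, pencilJacobian f h i ∈ Q) → ∀ i, X i ∈ Q)
    {a : MvPolynomial (Fin d) (Polynomial ℂ)}
    (ha : C Polynomial.X * a ∈ Ideal.span (Set.range (pencilJacobian f h))) :
    ∃ u ∉ RingHom.ker (pencilEval d), u * a ∈ Ideal.span (Set.range (pencilJacobian f h)) := by
  have hlist : Ideal.ofList (List.ofFn (pencilJacobian f h)) =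
      Ideal.span (Set.range (pencilJacobian f h)) := by
    unfold Ideal.ofList
    congr 1
    ext p
    simp [List.mem_ofFn']
  have : (RingHom.ker (pencilEval d)).IsPrime := RingHom.ker_isPrime _
  rw [← hlist] at ha ⊢
  by_cases hF : ∀ i, pencilJacobian f h i ∈ RingHom.ker (pencilEval d)
  · refine exists_notMem_mul_mem_of_isolated (RingHom.ker (pencilEval d))
      (isWeaklyRegular_X_append_C (d := d) Polynomial.X
        (isRegular_iff_ne_zero.mpr Polynomial.X_ne_zero).isSMulRegular) ?_ ?_ ?_ ?_ ?_ ha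
    · intro r hr
      rcases List.mem_append.mp hr with hr | hr
      · obtain ⟨i, rfl⟩ := (List.mem_ofFn' _ _).mp hr
        exact pencilEval_X i
      · rw [List.mem_singleton.mp hr, RingHom.mem_ker, pencilEval_C, Polynomial.eval_X]
    · intro y hy
      obtain ⟨i, rfl⟩ := (List.mem_ofFn' _ _).mp hy
      exact hF i
    · rw [RingHom.mem_ker, pencilEval_C, Polynomial.eval_X]
    · simp
    · intro Q hQ hQn hFQ hsQ
      refine le_antisymm hQn fun p hp => ?_
      have := sub_C_pencilEval_mem
        (hX Q hQ hQn fun i => hFQ _ ((List.mem_ofFn' _ _).mpr ⟨i, rfl⟩)) hsQ p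
      rwa [RingHom.mem_ker.mp hp, map_zero, map_zero, sub_zero] at this
  · push Not at hF
    obtain ⟨i, hi⟩ := hF
    refine ⟨_, hi, Ideal.mul_mem_right _ _ (Ideal.subset_span ((List.mem_ofFn' _ _).mpr ⟨i, rfl⟩))⟩

theorem C_eval_pow_mul_mem {d : ℕ} {J : Ideal (MvPolynomial (Fin d) (Polynomial ℂ))} {N : ℕ}
    (hJ : idealOfVars (Fin d) (Polynomial ℂ) ^ N ≤ J)
    {v a : MvPolynomial (Fin d) (Polynomial ℂ)} (hv : v * a ∈ J) : C (eval 0 v) ^ N * a ∈ J := by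
  have h0 : v - C (eval 0 v) ∈ idealOfVars (Fin d) (Polynomial ℂ) := by
    rw [← pow_one (idealOfVars _ _), mem_pow_idealOfVars_iff']
    intro x hx
    have : x = 0 := by
      rw [← Finsupp.degree_eq_zero_iff]; omega
    subst this
    simp [constantCoeff_eq]
  obtain ⟨k, hk⟩ := sub_dvd_pow_sub_pow (v - C (eval 0 v)) (-C (eval 0 v)) N
  have h1 : (-C (eval 0 v)) ^ N * a = (v - C (eval 0 v)) ^ N * a - k * (v * a) := by
    have : v - C (eval 0 v) - -C (eval 0 v) = v := by ring
    rw [this] at hk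
    linear_combination (-a) * hk
  have h2 : (-C (eval 0 v)) ^ N * a ∈ J := by
    rw [h1]
    exact sub_mem (J.mul_mem_right _ (hJ (Ideal.pow_mem_pow h0 N))) (J.mul_mem_left _ hv)
  have h3 := J.mul_mem_left ((-1) ^ N) h2
  have h4 : (-1) ^ N * ((-C (eval 0 v)) ^ N * a) = C (eval 0 v) ^ N * a := by
    rw [← mul_assoc, ← mul_pow]; ring
  rwa [h4] at h3

theorem exists_mem_of_C_X_mul_mem {d : ℕ} {f h : MvPolynomial (Fin d) ℂ}
    (hX : ∀ Q : Ideal (MvPolynomial (Fin d) (Polynomial ℂ)), Q.IsPrime →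
      Q ≤ RingHom.ker (pencilEval d) → (∀ i, pencilJacobian f h i ∈ Q) → ∀ i, X i ∈ Q) :
    ∃ N₀, ∀ N, N₀ ≤ N → ∀ a, C Polynomial.X * a ∈ idealOfVars (Fin d) (Polynomial ℂ) ^ N ⊔
      Ideal.span (Set.range (pencilJacobian f h)) → a ∈ idealOfVars (Fin d) (Polynomial ℂ) ^ N ⊔
      Ideal.span (Set.range (pencilJacobian f h)) := by
  have hprime : (RingHom.ker (pencilEval d)).IsPrime := RingHom.ker_isPrime _
  obtain ⟨u, hu, N₀, hN₀⟩ := exists_notMem_forall_pow_mul_mem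
    (n := RingHom.ker (pencilEval d)) (I := idealOfVars (Fin d) (Polynomial ℂ))
    (J := Ideal.span (Set.range (pencilJacobian f h))) (by
      intro Q hQ hQn hFQ
      rw [Ideal.span_le]
      rintro _ ⟨i, rfl⟩
      exact hX Q hQ hQn (fun i => hFQ (Ideal.subset_span ⟨i, rfl⟩)) i)
  refine ⟨N₀, fun N hN a ha => ?_⟩
  set J := idealOfVars (Fin d) (Polynomial ℂ) ^ N ⊔ Ideal.span (Set.range (pencilJacobian f h))
  have h1 : C Polynomial.X * (u * a) ∈ Ideal.span (Set.range (pencilJacobian f h)) := by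
    obtain ⟨p, hp, q, hq, hpq⟩ := Submodule.mem_sup.mp ha
    rw [mul_left_comm, ← hpq, mul_add]
    exact add_mem (hN₀ N hN p hp) (Ideal.mul_mem_left _ _ hq)
  obtain ⟨u', hu', h2⟩ := exists_notMem_mul_mem_of_pencil hX h1
  rw [← mul_assoc] at h2
  have h3 := C_eval_pow_mul_mem (J := J) (N := N) le_sup_left
    ((le_sup_right : Ideal.span _ ≤ J) h2)
  have hv : u' * u ∉ RingHom.ker (pencilEval d) := fun hmem =>
    (hprime.mem_or_mem hmem).elim hu' hu
  have hcop : IsCoprime Polynomial.X (eval 0 (u' * u) ^ N) := by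
    refine IsCoprime.pow_right ?_
    rw [Polynomial.irreducible_X.coprime_iff_not_dvd, Polynomial.X_dvd_iff,
      Polynomial.coeff_zero_eq_eval_zero]
    exact hv
  obtain ⟨α, β, hαβ⟩ := hcop
  have h4 := congrArg (C : Polynomial ℂ →+* MvPolynomial (Fin d) (Polynomial ℂ)) hαβ
  simp only [map_add, map_mul, map_pow, map_one] at h4
  have h5 : a = C α * (C Polynomial.X * a) + C β * (C (eval 0 (u' * u)) ^ N * a) := by
    rw [map_mul, map_mul]
    linear_combination (-a) * h4
  rw [h5]
  exact add_mem (J.mul_mem_left _ ha) (J.mul_mem_left _ h3)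

theorem exists_annihilator_torsion {R M : Type*} [CommRing R] [IsDomain R] [AddCommGroup M]
    [Module R M] {T : Submodule R M} (hT : T.FG) (h : T ≤ Submodule.torsion R M) :
    ∃ g : R, g ≠ 0 ∧ ∀ m ∈ T, g • m = 0 := by
  induction T, hT using Submodule.fg_induction with
  | singleton x =>
    obtain ⟨a, ha⟩ := h (Submodule.mem_span_singleton_self x)
    refine ⟨a, nonZeroDivisors.ne_zero a.2, fun m hm => ?_⟩
    obtain ⟨c, rfl⟩ := Submodule.mem_span_singleton.mp hm
    rw [smul_comm, show (a : R) • x = 0 from ha, smul_zero]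
  | sup T₁ T₂ h₁ h₂ ih₁ ih₂ =>
    obtain ⟨g₁, hg₁, h₁'⟩ := ih₁ (le_sup_left.trans h)
    obtain ⟨g₂, hg₂, h₂'⟩ := ih₂ (le_sup_right.trans h)
    refine ⟨g₁ * g₂, mul_ne_zero hg₁ hg₂, fun m hm => ?_⟩
    obtain ⟨a, ha, b, hb, rfl⟩ := Submodule.mem_sup.mp hm
    rw [smul_add, mul_smul, mul_smul, smul_comm g₁ g₂ a, h₁' a ha, h₂' b hb, smul_zero, smul_zero,
      add_zero]

theorem exists_surjective_eval_of_finite {M : Type*} [AddCommGroup M] [Module (Polynomial ℂ) M]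
    [Module.Finite (Polynomial ℂ) M] (hX : ∀ m : M, (Polynomial.X : Polynomial ℂ) • m = 0 → m = 0) :
    ∃ (r : ℕ) (g : Polynomial ℂ), g.eval 0 ≠ 0 ∧ ∀ t : ℂ, g.eval t ≠ 0 →
      ∃ φ : M →+ (Fin r → ℂ), Function.Surjective φ ∧
        (∀ (p : Polynomial ℂ) m, φ (p • m) = p.eval t • φ m) ∧
        ∀ m, φ m = 0 → ∃ m', m = (Polynomial.X - Polynomial.C t) • m' := by
  classical
  obtain ⟨g₀, hg₀, hann₀⟩ := exists_annihilator_torsion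
    (IsNoetherian.noetherian (Submodule.torsion (Polynomial ℂ) M)) le_rfl
  obtain ⟨g, hg, hann⟩ : ∃ g : Polynomial ℂ, g.eval 0 ≠ 0 ∧
      ∀ m ∈ Submodule.torsion (Polynomial ℂ) M, g • m = 0 := by
    obtain ⟨g, hg, hdvd⟩ := Polynomial.exists_eq_pow_rootMultiplicity_mul_and_not_dvd g₀ hg₀ 0
    refine ⟨g, fun h0 => hdvd (Polynomial.dvd_iff_isRoot.mpr h0), fun m hm => ?_⟩
    have h1 := hann₀ m hm
    rw [hg, map_zero, sub_zero, mul_smul] at h1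
    have hpow : ∀ (n : ℕ) (x : M), (Polynomial.X ^ n : Polynomial ℂ) • x = 0 → x = 0 := by
      intro n
      induction n with
      | zero => intro x hx; simpa using hx
      | succ n ih => intro x hx; rw [pow_succ, mul_smul] at hx; exact hX x (ih _ hx)
    exact hpow _ _ h1
  let T := Submodule.torsion (Polynomial ℂ) M
  have : Module.IsTorsionFree (Polynomial ℂ) (M ⧸ T) := inferInstance
  have : Module.Free (Polynomial ℂ) (M ⧸ T) := Module.free_of_finite_type_torsion_free'
  let b := Module.finBasis (Polynomial ℂ) (M ⧸ T)
  refine ⟨Module.finrank (Polynomial ℂ) (M ⧸ T), g, hg, fun t ht => ?_⟩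
  let φ : M →+ (Fin (Module.finrank (Polynomial ℂ) (M ⧸ T)) → ℂ) :=
    { toFun := fun m i => (b.repr (T.mkQ m) i).eval t
      map_zero' := by ext; simp
      map_add' := by intros; ext; simp }
  refine ⟨φ, fun v => ?_, fun p m => ?_, fun m hm => ?_⟩
  · obtain ⟨m, hm⟩ := T.mkQ_surjective (∑ i, Polynomial.C (v i) • b i)
    refine ⟨m, ?_⟩
    ext i
    simp only [φ, AddMonoidHom.coe_mk, ZeroHom.coe_mk]
    rw [hm, b.repr_sum_self]
    simp
  · ext i
    simp [φ]
  · have h1 : ∀ i, ∃ q, b.repr (T.mkQ m) i = (Polynomial.X - Polynomial.C t) * q := fun i =>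
      Polynomial.dvd_iff_isRoot.mpr (congrFun hm i)
    choose q hq using h1
    obtain ⟨m₁, hm₁⟩ := T.mkQ_surjective (∑ i, q i • b i)
    have h2 : m - (Polynomial.X - Polynomial.C t) • m₁ ∈ T := by
      rw [← T.ker_mkQ, LinearMap.mem_ker, map_sub, map_smul, hm₁, sub_eq_zero]
      apply b.repr.injective
      ext1 i
      rw [hq, map_smul, Finsupp.smul_apply, b.repr_sum_self, smul_eq_mul]
    have hcop : IsCoprime (Polynomial.X - Polynomial.C t) g := by
      rw [(Polynomial.irreducible_X_sub_C t).coprime_iff_not_dvd, Polynomial.dvd_iff_isRoot]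
      exact ht
    obtain ⟨α, β, hαβ⟩ := hcop
    refine ⟨m₁ + α • (m - (Polynomial.X - Polynomial.C t) • m₁), ?_⟩
    have h3 := congrArg (· • (m - (Polynomial.X - Polynomial.C t) • m₁)) hαβ
    simp only [add_smul, mul_smul, one_smul] at h3
    rw [hann _ h2, smul_zero, add_zero, smul_comm] at h3
    rw [smul_add, h3]
    abel

theorem exists_map_C_map_eval_sub_eq {d : ℕ} (t : ℂ) (a : MvPolynomial (Fin d) (Polynomial ℂ)) :
    ∃ b, map Polynomial.C (map (Polynomial.evalRingHom t) a) - a =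
      C (Polynomial.X - Polynomial.C t) * b := by
  induction a using MvPolynomial.induction_on with
  | C p =>
    obtain ⟨q, hq⟩ : Polynomial.X - Polynomial.C t ∣ Polynomial.C (p.eval t) - p :=
      Polynomial.dvd_iff_isRoot.mpr (by simp)
    refine ⟨C q, ?_⟩
    rw [← map_mul, ← hq]
    simp
  | add p q hp hq =>
    obtain ⟨b, hb⟩ := hp
    obtain ⟨c, hc⟩ := hq
    refine ⟨b + c, ?_⟩
    rw [map_add, map_add, mul_add, ← hb, ← hc]
    ring
  | mul_X p i hp =>
    obtain ⟨b, hb⟩ := hp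
    refine ⟨b * X i, ?_⟩
    rw [map_mul, map_mul, map_X, map_X, ← mul_assoc, ← hb]
    ring

theorem map_evalRingHom_map_C {d : ℕ} (t : ℂ) (p : MvPolynomial (Fin d) ℂ) :
    map (Polynomial.evalRingHom t) (map Polynomial.C p) = p := by
  rw [map_map]
  convert MvPolynomial.map_id p using 2
  ext <;> simp

theorem exists_finrank_quotient_map_eval {d : ℕ} {J : Ideal (MvPolynomial (Fin d) (Polynomial ℂ))}
    (hfin : Module.Finite (Polynomial ℂ) (MvPolynomial (Fin d) (Polynomial ℂ) ⧸ J))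
    (hX : ∀ a, C Polynomial.X * a ∈ J → a ∈ J) :
    ∃ (r : ℕ) (g : Polynomial ℂ), g.eval 0 ≠ 0 ∧ ∀ t : ℂ, g.eval t ≠ 0 →
      Module.finrank ℂ
        (MvPolynomial (Fin d) ℂ ⧸ J.map (map (Polynomial.evalRingHom t))) = r := by
  have hsmul : ∀ (p : Polynomial ℂ) a,
      p • Ideal.Quotient.mk J a = Ideal.Quotient.mk J (C p * a) := by
    intro p a
    rw [← smul_eq_C_mul]; rfl
  obtain ⟨r, g, hg, h⟩ := exists_surjective_eval_of_finite
    (M := MvPolynomial (Fin d) (Polynomial ℂ) ⧸ J) (by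
      intro m
      obtain ⟨a, rfl⟩ := Ideal.Quotient.mk_surjective m
      intro ha
      rw [hsmul, Ideal.Quotient.eq_zero_iff_mem] at ha
      exact Ideal.Quotient.eq_zero_iff_mem.mpr (hX a ha))
  refine ⟨r, g, hg, fun t ht => ?_⟩
  obtain ⟨φ, hsurj, hlin, hker⟩ := h t ht
  have hmem : ∀ a, φ (Ideal.Quotient.mk J (map Polynomial.C (map (Polynomial.evalRingHom t) a)))
      = φ (Ideal.Quotient.mk J a) := by
    intro a
    obtain ⟨b, hb⟩ := exists_map_C_map_eval_sub_eq t a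
    rw [← sub_eq_zero, ← map_sub, ← map_sub, hb, ← hsmul, hlin]
    simp
  let χ : MvPolynomial (Fin d) ℂ →ₗ[ℂ] (Fin r → ℂ) :=
    { toFun := fun p => φ (Ideal.Quotient.mk J (map Polynomial.C p))
      map_add' := by intro p q; simp
      map_smul' := by
        intro c p
        rw [smul_eq_C_mul, map_mul, map_C, ← hsmul, hlin]
        simp }
  have hχ : Function.Surjective χ := fun v => by
    obtain ⟨m, hm⟩ := hsurj v
    obtain ⟨a, rfl⟩ := Ideal.Quotient.mk_surjective m
    exact ⟨map (Polynomial.evalRingHom t) a, (hmem a).trans hm⟩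
  have hevs : Function.Surjective (map (σ := Fin d) (Polynomial.evalRingHom t)) := fun p =>
    ⟨_, map_evalRingHom_map_C t p⟩
  have hχker : (J.map (map (Polynomial.evalRingHom t))).restrictScalars ℂ = LinearMap.ker χ := by
    ext p
    rw [Submodule.restrictScalars_mem, LinearMap.mem_ker]
    constructor
    · intro hp
      obtain ⟨a, ha, rfl⟩ := (Ideal.mem_map_iff_of_surjective _ hevs).mp hp
      refine (hmem a).trans ?_
      rw [Ideal.Quotient.eq_zero_iff_mem.mpr ha, map_zero]
    · intro hp
      obtain ⟨m, hm⟩ := hker _ hp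
      obtain ⟨a, rfl⟩ := Ideal.Quotient.mk_surjective m
      rw [hsmul, Ideal.Quotient.mk_eq_mk_iff_sub_mem] at hm
      have := Ideal.mem_map_of_mem (map (Polynomial.evalRingHom t)) hm
      rw [map_sub, map_evalRingHom_map_C, map_mul, map_C] at this
      simpa using this
  rw [← ((Submodule.Quotient.restrictScalarsEquiv ℂ
      (J.map (map (Polynomial.evalRingHom t)))).finrank_eq),
    hχker, (χ.quotKerEquivOfSurjective hχ).finrank_eq]
  simp

theorem finite_quotient_of_pow_idealOfVars_le {σ R : Type*} [Finite σ] [CommRing R]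
    {J : Ideal (MvPolynomial σ R)} {N : ℕ} (hJ : idealOfVars σ R ^ N ≤ J) :
    Module.Finite R (MvPolynomial σ R ⧸ J) := by
  classical
  have hfin := Finsupp.finite_of_degree_lt (σ := σ) N
  refine ⟨⟨hfin.toFinset.image fun m => Ideal.Quotient.mk J (monomial m 1), ?_⟩⟩
  rw [eq_top_iff]
  rintro x -
  obtain ⟨p, rfl⟩ := Ideal.Quotient.mk_surjective x
  rw [p.as_sum, map_sum]
  refine Submodule.sum_mem _ fun m hm => ?_
  by_cases hdeg : m.degree < N
  · have h1 : Ideal.Quotient.mk J (monomial m (coeff m p)) =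
        coeff m p • Ideal.Quotient.mk J (monomial m 1) := by
      have : monomial m (coeff m p) = coeff m p • (monomial m 1 : MvPolynomial σ R) := by
        rw [smul_monomial, smul_eq_mul, mul_one]
      rw [this]; rfl
    rw [h1]
    refine Submodule.smul_mem _ _ (Submodule.subset_span ?_)
    exact Finset.mem_coe.mpr (Finset.mem_image_of_mem _ (hfin.mem_toFinset.mpr hdeg))
  · have h1 : monomial m (coeff m p) ∈ J :=
      hJ ((monomial_mem_pow_idealOfVars_iff N m (mem_support_iff.mp hm)).mpr (not_lt.mp hdeg))
    rw [Ideal.Quotient.eq_zero_iff_mem.mpr h1]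
    exact Submodule.zero_mem _

/-- The dimension of the Jacobian algebra truncated at order `N`. -/
def truncatedMilnor {d : ℕ} (N : ℕ) (f : MvPolynomial (Fin d) ℂ) : ℕ :=
  Module.finrank ℂ (MvPolynomial (Fin d) ℂ ⧸ idealOfVars (Fin d) ℂ ^ N ⊔ jacobianIdeal f)

theorem map_sup_pencilJacobian {d : ℕ} (f h : MvPolynomial (Fin d) ℂ) (N : ℕ) (t : ℂ) :
    (idealOfVars (Fin d) (Polynomial ℂ) ^ N ⊔ Ideal.span (Set.range (pencilJacobian f h))).map
      (map (Polynomial.evalRingHom t)) =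
    idealOfVars (Fin d) ℂ ^ N ⊔ jacobianIdeal (f + C t * h) := by
  rw [Ideal.map_sup, Ideal.map_pow, Ideal.map_span, Ideal.map_span, ← Set.range_comp,
    ← Set.range_comp, jacobianIdeal]
  have h1 : ⇑(map (σ := Fin d) (Polynomial.evalRingHom t)) ∘ X = X := by
    ext1 i
    simp
  have h2 : ⇑(map (Polynomial.evalRingHom t)) ∘ pencilJacobian f h =
      fun i => pderiv i (f + C t * h) := by
    ext1 i
    simp only [Function.comp_apply, pencilJacobian, map_add, map_mul, map_evalRingHom_map_C, map_C]
    simp [C_mul']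
  rw [h1, h2]

theorem exists_truncatedMilnor_pencil_eq {d : ℕ} {f h : MvPolynomial (Fin d) ℂ}
    (hX : ∀ Q : Ideal (MvPolynomial (Fin d) (Polynomial ℂ)), Q.IsPrime →
      Q ≤ RingHom.ker (pencilEval d) → (∀ i, pencilJacobian f h i ∈ Q) → ∀ i, X i ∈ Q) :
    ∃ N₀, ∀ N, N₀ ≤ N → ∃ g : Polynomial ℂ, g ≠ 0 ∧ ∀ t, g.eval t ≠ 0 →
      truncatedMilnor N (f + C t * h) = truncatedMilnor N f := by
  obtain ⟨N₀, hN₀⟩ := exists_mem_of_C_X_mul_mem hX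
  refine ⟨N₀, fun N hN => ?_⟩
  obtain ⟨r, g, hg, h1⟩ := exists_finrank_quotient_map_eval
    (finite_quotient_of_pow_idealOfVars_le le_sup_left) (hN₀ N hN)
  refine ⟨g, fun h0 => hg (by simp [h0]), fun t ht => ?_⟩
  have h2 := h1 t ht
  have h3 := h1 0 hg
  rw [map_sup_pencilJacobian] at h2 h3
  rw [map_zero, zero_mul, add_zero] at h3
  exact h2.trans h3.symm

theorem exists_truncatedMilnor_eq {d : ℕ} {f f' : MvPolynomial (Fin d) ℂ}
    (hX : ∀ Q : Ideal (MvPolynomial (Fin d) (Polynomial ℂ)), Q.IsPrime →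
      Q ≤ RingHom.ker (pencilEval d) → (∀ i, pencilJacobian f (f' - f) i ∈ Q) → ∀ i, X i ∈ Q)
    (hX' : ∀ Q : Ideal (MvPolynomial (Fin d) (Polynomial ℂ)), Q.IsPrime →
      Q ≤ RingHom.ker (pencilEval d) → (∀ i, pencilJacobian f' (f - f') i ∈ Q) → ∀ i, X i ∈ Q) :
    ∃ N₀, ∀ N, N₀ ≤ N → truncatedMilnor N f = truncatedMilnor N f' := by
  obtain ⟨N₁, h₁⟩ := exists_truncatedMilnor_pencil_eq hX
  obtain ⟨N₂, h₂⟩ := exists_truncatedMilnor_pencil_eq hX'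
  refine ⟨max N₁ N₂, fun N hN => ?_⟩
  obtain ⟨g₁, hg₁, h₁⟩ := h₁ N ((le_max_left _ _).trans hN)
  obtain ⟨g₂, hg₂, h₂⟩ := h₂ N ((le_max_right _ _).trans hN)
  have hne : g₁ * g₂.comp (1 - Polynomial.X) ≠ 0 := by
    refine mul_ne_zero hg₁ fun h0 => hg₂ ?_
    have := congrArg (fun p => Polynomial.comp p (1 - Polynomial.X)) h0
    simpa [Polynomial.comp_assoc] using this
  obtain ⟨t, ht⟩ : ∃ t, (g₁ * g₂.comp (1 - Polynomial.X)).eval t ≠ 0 := by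
    by_contra! h0
    exact hne (Polynomial.funext fun t => by simpa using h0 t)
  rw [Polynomial.eval_mul, Polynomial.eval_comp] at ht
  have e₁ := h₁ t (left_ne_zero_of_mul ht)
  have e₂ := h₂ (1 - t) (by simpa using right_ne_zero_of_mul ht)
  have : f + C t * (f' - f) = f' + C (1 - t) * (f - f') := by
    rw [map_sub, map_one]; ring
  rw [← e₁, ← e₂, this]

theorem mem_map_pow_idealOfVars_of_coeff_eq_zero {σ R : Type*} [Finite σ] [CommRing R] {N : ℕ}
    {p : MvPowerSeries σ R} (hp : ∀ n : σ →₀ ℕ, n.degree < N → MvPowerSeries.coeff n p = 0) :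
    p ∈ (idealOfVars σ R ^ N).map coeToMvPowerSeries.ringHom := by
  classical
  choose! c hc hcN using fun n : σ →₀ ℕ => Finsupp.exists_le_degree_eq n N
  have hfin := Finsupp.finite_of_degree_eq (σ := σ) N
  let q : (σ →₀ ℕ) → MvPowerSeries σ R := fun m n =>
    if N ≤ (m + n).degree ∧ c (m + n) = m then MvPowerSeries.coeff (m + n) p else 0
  have hq : ∀ m n, MvPowerSeries.coeff n (q m) =
    if N ≤ (m + n).degree ∧ c (m + n) = m then MvPowerSeries.coeff (m + n) p else 0 :=
    fun _ _ => rfl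
  have hsum : p = ∑ m ∈ hfin.toFinset, MvPowerSeries.monomial m 1 * q m := by
    ext n
    rw [map_sum]
    have hterm : ∀ m ∈ hfin.toFinset,
        MvPowerSeries.coeff n (MvPowerSeries.monomial m 1 * q m) =
          if c n = m then (if N ≤ n.degree then MvPowerSeries.coeff n p else 0) else 0 := by
      intro m hm
      rw [MvPowerSeries.coeff_monomial_mul, one_mul, hq]
      by_cases hmn : m ≤ n
      · rw [if_pos hmn, add_tsub_cancel_of_le hmn]
        by_cases h1 : N ≤ n.degree <;> by_cases h2 : c n = m <;> simp [h1, h2]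
      · rw [if_neg hmn]
        by_cases h2 : c n = m
        · by_cases h1 : N ≤ n.degree
          · exact absurd (h2 ▸ hc n h1) hmn
          · simp [h1]
        · simp [h2]
    rw [Finset.sum_congr rfl hterm, Finset.sum_ite_eq]
    by_cases h1 : N ≤ n.degree
    · rw [if_pos (hfin.mem_toFinset.mpr (hcN n h1)), if_pos h1]
    · rw [if_neg h1, ite_self]
      exact hp n (not_le.mp h1)
  rw [hsum]
  refine Ideal.sum_mem _ fun m hm => Ideal.mul_mem_right _ _ ?_
  have hmem : (monomial m 1 : MvPolynomial σ R) ∈ idealOfVars σ R ^ N := by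
    rw [pow_idealOfVars_eq_span]
    exact Ideal.subset_span ⟨m, hfin.mem_toFinset.mp hm, rfl⟩
  have := Ideal.mem_map_of_mem coeToMvPowerSeries.ringHom hmem
  rwa [coeToMvPowerSeries.ringHom_apply, coe_monomial] at this

theorem milnor_eq_truncatedMilnor {d : ℕ} {f u : MvPolynomial (Fin d) ℂ} {N : ℕ}
    (hu : eval 0 u ≠ 0)
    (h : ∀ b ∈ idealOfVars (Fin d) ℂ ^ N, u * b ∈ jacobianIdeal f) :
    milnor f = truncatedMilnor N f := by
  have hK : Ideal.span {g : MvPowerSeries (Fin d) ℂ | ∃ i, g = ↑(pderiv i f)} =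
      (jacobianIdeal f).map coeToMvPowerSeries.ringHom := by
    rw [jacobianIdeal, Ideal.map_span, ← Set.range_comp]
    congr 1
    ext g
    exact exists_congr fun i => ⟨fun h => h.symm, fun h => h.symm⟩
  rw [milnor, hK, truncatedMilnor]
  set K := (jacobianIdeal f).map coeToMvPowerSeries.ringHom
  set I := idealOfVars (Fin d) ℂ ^ N ⊔ jacobianIdeal f
  let ψ : MvPowerSeries (Fin d) ℂ →ₗ[ℂ] MvPolynomial (Fin d) ℂ ⧸ I :=
    (Ideal.Quotient.mkₐ ℂ I).toLinearMap ∘ₗ MvPowerSeries.truncTotal N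
  have hψ : ∀ p, ψ p = Ideal.Quotient.mk I (MvPowerSeries.truncTotal N p) := fun _ => rfl
  have hcoe : ∀ p : MvPolynomial (Fin d) ℂ,
      ψ (p : MvPowerSeries (Fin d) ℂ) = Ideal.Quotient.mk I p := by
    intro p
    rw [hψ, Ideal.Quotient.mk_eq_mk_iff_sub_mem]
    refine Ideal.mem_sup_left ((mem_pow_idealOfVars_iff' _ _).mpr fun x hx => ?_)
    rw [coeff_sub, MvPowerSeries.coeff_truncTotal _ hx, coeff_coe, sub_self]
  have hmul : ∀ p q, ψ (p * q) = Ideal.Quotient.mk I (MvPowerSeries.truncTotal N p) * ψ q := by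
    intro p q
    rw [hψ, hψ, ← map_mul, Ideal.Quotient.mk_eq_mk_iff_sub_mem]
    exact Ideal.mem_sup_left
      (MvPowerSeries.truncTotal_mul_sub_mul_truncTotal_mem_pow_idealOfVars p q)
  have hpow : (idealOfVars (Fin d) ℂ ^ N).map coeToMvPowerSeries.ringHom ≤ K := by
    rw [Ideal.map_le_iff_le_comap]
    intro b hb
    have hunit : IsUnit (u : MvPowerSeries (Fin d) ℂ) := by
      rw [MvPowerSeries.isUnit_iff_constantCoeff, isUnit_iff_ne_zero]
      have : MvPowerSeries.constantCoeff (u : MvPowerSeries (Fin d) ℂ) = eval 0 u := by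
        rw [← MvPowerSeries.coeff_zero_eq_constantCoeff_apply, coeff_coe, ← constantCoeff_eq,
          constantCoeff_eq, eval_zero]
        rfl
      rwa [this]
    have h1 : (u : MvPowerSeries (Fin d) ℂ) * b ∈ K := by
      rw [← coe_mul]
      exact Ideal.mem_map_of_mem coeToMvPowerSeries.ringHom (h b hb)
    exact (K.unit_mul_mem_iff_mem hunit).mp h1
  have hker : K.restrictScalars ℂ = LinearMap.ker ψ := by
    ext p
    rw [Submodule.restrictScalars_mem, LinearMap.mem_ker]
    constructor
    · intro hp
      induction hp using Submodule.span_induction with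
      | mem x hx =>
        obtain ⟨a, ha, rfl⟩ := hx
        exact (hcoe a).trans (Ideal.Quotient.eq_zero_iff_mem.mpr (Ideal.mem_sup_right ha))
      | zero => exact map_zero ψ
      | add x y _ _ hx hy => rw [map_add, hx, hy, add_zero]
      | smul a x _ hx => rw [smul_eq_mul, hmul, hx, mul_zero]
    · intro hp
      rw [hψ, Ideal.Quotient.eq_zero_iff_mem] at hp
      obtain ⟨q, hq, j, hj, hqj⟩ := Submodule.mem_sup.mp hp
      have h1 : p - (MvPowerSeries.truncTotal N p : MvPowerSeries (Fin d) ℂ) ∈ K := by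
        refine hpow (mem_map_pow_idealOfVars_of_coeff_eq_zero fun n hn => ?_)
        rw [map_sub, coeff_coe, MvPowerSeries.coeff_truncTotal _ hn, sub_self]
      have h2 : (MvPowerSeries.truncTotal N p : MvPowerSeries (Fin d) ℂ) ∈ K := by
        rw [← hqj, coe_add]
        exact add_mem (hpow (Ideal.mem_map_of_mem coeToMvPowerSeries.ringHom hq))
          (Ideal.mem_map_of_mem coeToMvPowerSeries.ringHom hj)
      simpa using add_mem h1 h2
  have hsurj : Function.Surjective ψ := fun x => by
    obtain ⟨p, rfl⟩ := Ideal.Quotient.mk_surjective x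
    exact ⟨p, hcoe p⟩
  rw [← (Submodule.Quotient.restrictScalarsEquiv ℂ K).finrank_eq, hker,
    (ψ.quotKerEquivOfSurjective hsurj).finrank_eq]

theorem exists_isRoot_norm_pow_le {p : Polynomial ℂ} (hp : p.Monic) (hdeg : p.natDegree ≠ 0) :
    ∃ r, p.IsRoot r ∧ ‖r‖ ^ p.natDegree ≤ ‖p.coeff 0‖ := by
  classical
  have hsplit := IsAlgClosed.splits p
  have hcard : p.roots.card = p.natDegree := hsplit.natDegree_eq_card_roots.symm
  have hne : p.roots.toFinset.Nonempty := by
    rw [Multiset.toFinset_nonempty]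
    intro h0
    rw [h0, Multiset.card_zero] at hcard
    exact hdeg hcard.symm
  obtain ⟨r, hr, hmin⟩ := Finset.exists_min_image p.roots.toFinset norm hne
  refine ⟨r, Polynomial.isRoot_of_mem_roots (Multiset.mem_toFinset.mp hr), ?_⟩
  have hprod : p.coeff 0 = (p.roots.map fun a => -a).prod := by
    conv_lhs => rw [hsplit.eq_prod_roots_of_monic hp, Polynomial.coeff_zero_eq_eval_zero,
      Polynomial.eval_multiset_prod, Multiset.map_map]
    simp
  have key : ∀ s : Multiset ℂ, (∀ x ∈ s, ‖r‖ ≤ ‖x‖) →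
      ‖r‖ ^ s.card ≤ ‖(s.map fun a => -a).prod‖ := by
    intro s
    induction s using Multiset.induction_on with
    | empty => intro _; simp
    | cons a s ih =>
      intro h
      rw [Multiset.card_cons, pow_succ', Multiset.map_cons, Multiset.prod_cons, norm_mul, norm_neg]
      exact mul_le_mul (h a (Multiset.mem_cons_self a s))
        (ih fun x hx => h x (Multiset.mem_cons_of_mem hx)) (by positivity) (norm_nonneg _)
  rw [hprod, ← hcard]
  exact key _ fun x hx => hmin x (Multiset.mem_toFinset.mpr hx)

theorem norm_le_of_isRoot {p : Polynomial ℂ} (hp : p.Monic) {r : ℂ} (hr : p.IsRoot r) :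
    ‖r‖ ≤ (∑ i ∈ Finset.range p.natDegree, ‖p.coeff i‖) + 1 := by
  have h1 := (Polynomial.IsRoot.norm_lt_cauchyBound hp.ne_zero hr).le
  have h2 : p.cauchyBound ≤ (∑ i ∈ Finset.range p.natDegree, ‖p.coeff i‖₊) + 1 := by
    rw [Polynomial.cauchyBound, hp.leadingCoeff, nnnorm_one, div_one]
    gcongr
    exact Finset.sup_le fun i hi =>
      Finset.single_le_sum (f := fun i => ‖p.coeff i‖₊) (fun _ _ => zero_le) hi
  have h3 := NNReal.coe_le_coe.mpr (h1.trans h2)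
  simpa using h3

theorem exists_isMaximal_of_isRoot_minpoly {A B K : Type*} [CommRing A] [IsDomain A]
    [IsIntegrallyClosed A] [CommRing B] [IsDomain B] [Algebra A B] [Module.IsTorsionFree A B]
    [Algebra.IsIntegral A B] [Field K] {φ : A →+* K} (hφ : Function.Surjective φ) {b : B} {r : K}
    (hr : ((minpoly A b).map φ).IsRoot r) :
    ∃ Q : Ideal B, Q.IsMaximal ∧
      ∀ p : Polynomial A, p.eval₂ φ r = 0 → Polynomial.aeval b p ∈ Q := by
  let _ : Algebra (Polynomial A) B :=
    (Polynomial.aeval b : Polynomial A →ₐ[A] B).toRingHom.toAlgebra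
  have hmap : ∀ p : Polynomial A, algebraMap (Polynomial A) B p = Polynomial.aeval b p :=
    fun _ => rfl
  have : IsScalarTower A (Polynomial A) B := IsScalarTower.of_algebraMap_eq fun a => by
    rw [hmap, Polynomial.algebraMap_eq, Polynomial.aeval_C]
  have : Algebra.IsIntegral (Polynomial A) B := Algebra.IsIntegral.tower_top A
  have hsurj : Function.Surjective (Polynomial.eval₂RingHom φ r) := fun x => by
    obtain ⟨a, rfl⟩ := hφ x
    exact ⟨Polynomial.C a, by simp⟩
  have := RingHom.ker_isMaximal_of_surjective (Polynomial.eval₂RingHom φ r) hsurj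
  obtain ⟨Q, hQ, hcomap⟩ := Ideal.exists_ideal_over_maximal_of_isIntegral (S := B)
    (RingHom.ker (Polynomial.eval₂RingHom φ r)) (by
      intro p hp
      rw [RingHom.mem_ker, hmap] at hp
      obtain ⟨q, rfl⟩ := minpoly.isIntegrallyClosed_dvd (Algebra.IsIntegral.isIntegral b) hp
      rw [RingHom.mem_ker, map_mul, Polynomial.coe_eval₂RingHom, Polynomial.eval₂_eq_eval_map,
        hr.eq_zero, zero_mul])
  refine ⟨Q, hQ, fun p hp => ?_⟩
  have : p ∈ Ideal.comap (algebraMap (Polynomial A) B) Q := by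
    rw [hcomap]; exact hp
  exact this

theorem exists_monic_forall_isRoot_exists_zero {d s : ℕ} {B : Type*} [CommRing B] [IsDomain B]
    {ρ : MvPolynomial (Fin d) ℂ →+* B} (hρ : Function.Surjective ρ)
    {g : MvPolynomial (Fin s) ℂ →+* B} (hg : Function.Injective g) (h_integral : g.IsIntegral)
    (hC : ∀ c, g (C c) = ρ (C c)) {G : Fin s → MvPolynomial (Fin d) ℂ}
    (hG : ∀ i, ρ (G i) = g (X i)) (b : MvPolynomial (Fin d) ℂ) :
    ∃ χ : Polynomial (MvPolynomial (Fin s) ℂ), χ.Monic ∧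
      (∀ p, (∀ q ∈ RingHom.ker ρ, eval p q = 0) →
        (χ.map (eval fun i => eval p (G i))).IsRoot (eval p b)) ∧
      ∀ y r, (χ.map (eval y)).IsRoot r →
        ∃ p, (∀ q ∈ RingHom.ker ρ, eval p q = 0) ∧ (∀ i, eval p (G i) = y i) ∧ eval p b = r := by
  let _ : Algebra (MvPolynomial (Fin s) ℂ) B := g.toAlgebra
  have hmap : ∀ p, algebraMap (MvPolynomial (Fin s) ℂ) B p = g p := fun _ => rfl
  have : Algebra.IsIntegral (MvPolynomial (Fin s) ℂ) B := ⟨fun x => h_integral x⟩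
  have : FaithfulSMul (MvPolynomial (Fin s) ℂ) B :=
    (faithfulSMul_iff_algebraMap_injective _ _).mpr hg
  have hbint : IsIntegral (MvPolynomial (Fin s) ℂ) (ρ b) := Algebra.IsIntegral.isIntegral _
  refine ⟨minpoly _ (ρ b), minpoly.monic hbint, fun p hp => ?_, fun y r hr => ?_⟩
  · let π : B →+* ℂ := RingHom.liftOfSurjective ρ hρ ⟨eval p, hp⟩
    have hπρ : ∀ q, π (ρ q) = eval p q :=
      fun q => RingHom.liftOfRightInverse_comp_apply _ _ _ ⟨eval p, hp⟩ q
    have hπ : π.comp g = eval fun i => eval p (G i) := by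
      refine MvPolynomial.ringHom_ext (fun c => ?_) fun i => ?_
      · simp [hC, hπρ]
      · simp [← hG, hπρ]
    have h0 := congrArg π (minpoly.aeval (MvPolynomial (Fin s) ℂ) (ρ b))
    rw [Polynomial.aeval_def, Polynomial.hom_eval₂, map_zero, hπρ] at h0
    rw [Polynomial.IsRoot, Polynomial.eval_map, ← hπ]
    exact h0
  · obtain ⟨Q, hQ, hmem⟩ := exists_isMaximal_of_isRoot_minpoly
      (φ := eval y) (fun c => ⟨C c, eval_C c⟩) hr
    have hQ' : (Q.comap ρ).IsMaximal := Ideal.comap_isMaximal_of_surjective _ hρ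
    obtain ⟨p, hp⟩ := isMaximal_iff_eq_vanishingIdeal_singleton.mp hQ'
    have hzero : ∀ q, ρ q ∈ Q → eval p q = 0 := by
      intro q hq
      have : q ∈ vanishingIdeal ℂ {p} := hp ▸ hq
      rwa [mem_vanishingIdeal_singleton_iff, aeval_eq_eval] at this
    refine ⟨p, fun q hq => hzero q ?_, fun i => ?_, ?_⟩
    · rw [RingHom.mem_ker.mp hq]; exact Q.zero_mem
    · have h1 := hmem (Polynomial.C (X i - C (y i))) (by simp)
      rw [Polynomial.aeval_C, hmap, map_sub, ← hG, hC, ← map_sub] at h1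
      have := hzero _ h1
      rwa [map_sub, eval_C, sub_eq_zero] at this
    · have h1 := hmem (Polynomial.X - Polynomial.C (C r)) (by simp)
      rw [map_sub, Polynomial.aeval_C, hmap, Polynomial.aeval_X, hC, ← map_sub] at h1
      have := hzero _ h1
      rwa [map_sub, eval_C, sub_eq_zero] at this

theorem exists_eval_zero_eq_zero_forall_ne_zero {d : ℕ} {F : Set (Fin d → ℂ)} (hF : F.Finite) :
    ∃ b : MvPolynomial (Fin d) ℂ, eval 0 b = 0 ∧ ∀ p ∈ F, eval p b = 0 → p = 0 := by
  classical
  have hne : ∀ p : Fin d → ℂ, ∃ q : MvPolynomial (Fin d) ℂ,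
      eval 0 q = 0 ∧ (p ≠ 0 → eval p q = 1) := fun p => by
    by_cases hp : p = 0
    · exact ⟨0, by simp, fun h => absurd hp h⟩
    · obtain ⟨j, hj⟩ := Function.ne_iff.mp hp
      exact ⟨C (p j)⁻¹ * X j, by simp, fun _ => by simpa using inv_mul_cancel₀ hj⟩
  choose q hq0 hq1 using hne
  refine ⟨1 - ∏ p ∈ hF.toFinset.erase 0, (1 - q p), ?_, fun p hp hb => ?_⟩
  · rw [map_sub, map_prod, Finset.prod_eq_one fun p _ => by rw [map_sub, hq0, map_one, sub_zero],
      map_one, sub_self]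
  · by_contra hp0
    have : eval p (∏ p ∈ hF.toFinset.erase 0, (1 - q p)) = 0 := by
      rw [map_prod]
      refine Finset.prod_eq_zero (i := p) (by simp [hp0, hp]) ?_
      simp [hq1 p hp0]
    rw [map_sub, this] at hb
    simp at hb

theorem X_mem_of_isolated_zero {d : ℕ} {P : Ideal (MvPolynomial (Fin d) ℂ)} [P.IsPrime]
    (h0 : P ≤ RingHom.ker (eval 0)) {U : Set (Fin d → ℂ)} (hU : U ∈ nhds 0)
    (h : ∀ x ∈ U, (∀ q ∈ P, eval x q = 0) → x = 0) (i : Fin d) : X i ∈ P := by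
  obtain ⟨s, -, g, hg, h_integral⟩ :=
    exists_integral_inj_algHom_of_quotient P (Ideal.IsPrime.ne_top ‹_›)
  obtain _ | s := s
  · let _ : Algebra (MvPolynomial (Fin 0) ℂ) (MvPolynomial (Fin d) ℂ ⧸ P) := g.toRingHom.toAlgebra
    have : Algebra.IsIntegral (MvPolynomial (Fin 0) ℂ) (MvPolynomial (Fin d) ℂ ⧸ P) :=
      ⟨fun x => h_integral x⟩
    have hfield : IsField (MvPolynomial (Fin 0) ℂ) :=
      (isEmptyAlgEquiv ℂ (Fin 0)).toMulEquiv.isField (Field.toIsField ℂ)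
    have := Ideal.Quotient.maximal_of_isField P (isField_of_isIntegral_of_isField'
      (R := MvPolynomial (Fin 0) ℂ) hfield)
    rw [Ideal.IsMaximal.eq_of_le this (RingHom.ker_ne_top _) h0]
    simp
  exfalso
  choose G hG using fun i : Fin (s + 1) => Ideal.Quotient.mk_surjective (g (X i))
  have key := exists_monic_forall_isRoot_exists_zero (Ideal.Quotient.mk_surjective (I := P))
    (g := (g : MvPolynomial (Fin (s + 1)) ℂ →+* MvPolynomial (Fin d) ℂ ⧸ P)) hg h_integral
    (fun c => g.commutes c) hG
  rw [Ideal.mk_ker] at key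
  choose χ hmonic hroot hex using fun i => key (X i)
  let y₀ : Fin (s + 1) → ℂ := fun i => eval 0 (G i)
  let y : ℕ → Fin (s + 1) → ℂ := fun k i => y₀ i + 1 / ((k : ℂ) + 1)
  have hy : Filter.Tendsto y Filter.atTop (nhds y₀) := by
    rw [tendsto_pi_nhds]
    intro i
    have := (tendsto_const_nhds (x := y₀ i)).add (tendsto_one_div_add_atTop_nhds_zero_nat (𝕜 := ℂ))
    simpa [y] using this
  have hzero : ∀ q ∈ P, eval (0 : Fin d → ℂ) q = 0 := fun q hq => h0 hq
  let F : Set (Fin d → ℂ) := {p | (∀ q ∈ P, eval p q = 0) ∧ ∀ i, eval p (G i) = y₀ i}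
  have hF : F.Finite := by
    refine (Set.Finite.pi' fun i =>
      Polynomial.finite_setOfPred_isRoot ((hmonic i).map (eval y₀)).ne_zero).subset fun p hp i => ?_
    have := hroot i p hp.1
    rw [funext hp.2, eval_X] at this
    exact this
  obtain ⟨b, hb0, hbF⟩ := exists_eval_zero_eq_zero_forall_ne_zero hF
  obtain ⟨η, hη, hηroot, hηex⟩ := key b
  have hη0 : eval y₀ (η.coeff 0) = 0 := by
    have := hηroot 0 hzero
    rw [hb0, Polynomial.IsRoot, ← Polynomial.coeff_zero_eq_eval_zero, Polynomial.coeff_map] at this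
    exact this
  have hdeg : η.natDegree ≠ 0 := by
    intro hdeg
    rw [Polynomial.eq_one_of_monic_natDegree_zero hη hdeg] at hη0
    simp at hη0
  have hr : ∀ k, ∃ p : Fin d → ℂ, (∀ q ∈ P, eval p q = 0) ∧ (∀ i, eval p (G i) = y k i) ∧
      ‖eval p b‖ ^ η.natDegree ≤ ‖eval (y k) (η.coeff 0)‖ := by
    intro k
    obtain ⟨r, hr, hrn⟩ := exists_isRoot_norm_pow_le (hη.map (eval (y k)))
      (by rwa [hη.natDegree_map])
    obtain ⟨p, hp, hpG, hpb⟩ := hηex (y k) r hr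
    refine ⟨p, hp, hpG, ?_⟩
    rwa [hη.natDegree_map, Polynomial.coeff_map, ← hpb] at hrn
  choose p hpP hpG hpb using hr
  have hbdd : ∀ i, ∃ M, ∀ k, ‖p k i‖ ≤ M := by
    intro i
    have hcont : Continuous fun z => (∑ j ∈ Finset.range (χ i).natDegree,
        ‖eval z ((χ i).coeff j)‖) + 1 :=
      (continuous_finsetSum _ fun j _ => (continuous_eval _).norm).add continuous_const
    obtain ⟨M, hM⟩ := ((hcont.tendsto y₀).comp hy).bddAbove_range
    refine ⟨M, fun k => le_trans ?_ (hM ⟨k, rfl⟩)⟩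
    have h1 := hroot i (p k) (hpP k)
    rw [funext (hpG k), eval_X] at h1
    have h2 := norm_le_of_isRoot ((hmonic i).map _) h1
    rw [(hmonic i).natDegree_map] at h2
    simpa using h2
  choose M hM using hbdd
  obtain ⟨a, -, φ, hφ, ha⟩ := tendsto_subseq_of_bounded
    (Bornology.IsBounded.pi fun i => Metric.isBounded_closedBall (x := (0 : ℂ)) (r := M i))
    (x := p) (fun k i _ => by simpa using hM i k)
  have hyφ := hy.comp hφ.tendsto_atTop
  have haev : ∀ q, Filter.Tendsto (fun k => eval (p (φ k)) q) Filter.atTop (nhds (eval a q)) :=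
    fun q => ((continuous_eval q).tendsto a).comp ha
  have haF : a ∈ F := by
    refine ⟨fun q hq => ?_, fun i => ?_⟩
    · refine tendsto_nhds_unique (haev q) ?_
      simp [hpP _ q hq]
    · refine tendsto_nhds_unique (haev (G i)) ?_
      simp only [hpG]
      exact tendsto_pi_nhds.mp hyφ i
  have hab : eval a b = 0 := by
    have h1 := le_of_tendsto_of_tendsto' ((haev b).norm.pow η.natDegree)
      ((((continuous_eval (η.coeff 0)).norm).tendsto y₀).comp hyφ) fun k => hpb (φ k)
    rw [hη0, norm_zero] at h1
    exact norm_eq_zero.mp (pow_eq_zero_iff hdeg |>.mp (le_antisymm h1 (by positivity)))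
  have ha0 : a = 0 := hbF a haF hab
  rw [ha0] at ha
  obtain ⟨k, hk⟩ := (ha.eventually hU).exists
  have hk0 : p (φ k) = 0 := h _ hk (hpP _)
  have h1 := hpG (φ k) 0
  rw [hk0] at h1
  have h2 : (1 : ℂ) / ((φ k : ℂ) + 1) = 0 := by
    have : y₀ 0 = y₀ 0 + 1 / ((φ k : ℂ) + 1) := h1
    simpa using this
  have h3 : ((φ k : ℂ) + 1) ≠ 0 := Nat.cast_add_one_ne_zero _
  simp [h3] at h2

theorem IsolatedCriticalPointAtZero.X_mem_of_jacobianIdeal_le {d : ℕ}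
    {f : MvPolynomial (Fin d) ℂ} (hiso : IsolatedCriticalPointAtZero f)
    {Q : Ideal (MvPolynomial (Fin d) ℂ)} [Q.IsPrime] (h0 : Q ≤ RingHom.ker (eval 0))
    (hQ : jacobianIdeal f ≤ Q) (i : Fin d) : X i ∈ Q := by
  obtain ⟨-, U, hU, h⟩ := hiso
  exact X_mem_of_isolated_zero h0 hU
    (fun x hx hq => h x hx fun j => hq _ (hQ (Ideal.subset_span ⟨j, rfl⟩))) i

theorem IsolatedCriticalPointAtZero.exists_milnor_eq_truncatedMilnor {d : ℕ}
    {f : MvPolynomial (Fin d) ℂ} (hiso : IsolatedCriticalPointAtZero f) :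
    ∃ N₀, ∀ N, N₀ ≤ N → milnor f = truncatedMilnor N f := by
  have hprime : (RingHom.ker (eval (0 : Fin d → ℂ))).IsPrime := RingHom.ker_isPrime _
  obtain ⟨u, hu, N₀, h⟩ := exists_notMem_forall_pow_mul_mem
    (n := RingHom.ker (eval (0 : Fin d → ℂ))) (I := idealOfVars (Fin d) ℂ) (J := jacobianIdeal f)
    fun Q hQ hQ0 hJ => by
      rw [idealOfVars, Ideal.span_le, Set.range_subset_iff]
      exact hiso.X_mem_of_jacobianIdeal_le hQ0 hJ
  exact ⟨N₀, fun N hN => milnor_eq_truncatedMilnor hu (h N hN)⟩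

theorem exists_ringEquiv_eval_zero_eq {σ R : Type*} [CommRing R] (x : σ → R) :
    ∃ e : MvPolynomial σ R ≃+* MvPolynomial σ R, ∀ p, eval 0 (e p) = eval x p := by
  have hcomp : ∀ y z : σ → R, y + z = 0 → (aeval fun i => X i + C (y i)).comp
      (aeval fun i => X i + C (z i)) = AlgHom.id R (MvPolynomial σ R) := by
    intro y z hyz
    refine algHom_ext fun i => ?_
    rw [AlgHom.comp_apply, aeval_X, map_add, aeval_X, algHom_C, algebraMap_eq, add_assoc,
      ← C_add, ← Pi.add_apply, hyz, Pi.zero_apply, C_0, add_zero, AlgHom.id_apply]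
  refine ⟨(AlgEquiv.ofAlgHom _ _ (hcomp x (-x) (add_neg_cancel x))
    (hcomp (-x) x (neg_add_cancel x))).toRingEquiv, fun p => ?_⟩
  have h : ((aeval (0 : σ → R)).comp (aeval fun i => X i + C (x i)) :
      MvPolynomial σ R →ₐ[R] R) = aeval x := by
    refine algHom_ext fun i => ?_
    rw [AlgHom.comp_apply, aeval_X, map_add, aeval_X, algHom_C, aeval_X]
    simp
  simpa [coe_aeval_eq_eval] using DFunLike.congr_fun h p

theorem le_height_ker_eval_zero (d : ℕ) :
    (d : ℕ∞) ≤ (RingHom.ker (eval (0 : Fin d → ℂ))).height := by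
  have h : ringKrullDim (MvPolynomial (Fin d) ℂ) ≤
      ((RingHom.ker (eval (0 : Fin d → ℂ))).height : WithBot ℕ∞) := by
    refine (ringKrullDim_le_iff_isMaximal_height_le _).mpr fun M hM => ?_
    obtain ⟨x, rfl⟩ := isMaximal_iff_eq_vanishingIdeal_singleton.mp hM
    obtain ⟨e, he⟩ := exists_ringEquiv_eval_zero_eq x
    have hx : vanishingIdeal ℂ {x} = (RingHom.ker (eval (0 : Fin d → ℂ))).comap e := by
      ext p
      rw [mem_vanishingIdeal_singleton_iff, Ideal.mem_comap, RingHom.mem_ker, he,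
        ← coe_aeval_eq_eval]
      rfl
    rw [hx, RingEquiv.height_comap]
  rw [MvPolynomial.ringKrullDim_of_isNoetherianRing, ringKrullDim_eq_zero_of_field, zero_add,
    Nat.card_eq_fintype_card, Fintype.card_fin] at h
  exact_mod_cast h

theorem pderiv_mem_span_X_compl {d : ℕ} {f : MvPolynomial (Fin d) ℂ} {I : Finset (Fin d)}
    (hI : ∀ m ∈ f.support, ∃ j ∉ I, m j ≠ 0) {i : Fin d} (hi : i ∉ linearVars f I) :
    pderiv i f ∈ Ideal.span (X '' (Iᶜ : Finset (Fin d)) : Set (MvPolynomial (Fin d) ℂ)) := by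
  rw [← support_sum_monomial_coeff f, map_sum]
  refine Ideal.sum_mem _ fun m hm => ?_
  rw [pderiv_monomial]
  by_cases hmi : m i = 0
  · simp [hmi]
  rw [mem_ideal_span_X_image]
  intro m' hm'
  obtain rfl : m' = m - Finsupp.single i 1 := by
    simpa using support_monomial_subset hm'
  suffices ∃ j ∉ I, m j ≠ 0 ∧ (j = i → m i ≠ 1) by
    obtain ⟨j, hj, hmj, hji⟩ := this
    refine ⟨j, by simpa using hj, ?_⟩
    rw [Finsupp.tsub_apply]
    obtain rfl | hne := eq_or_ne j i
    · rw [Finsupp.single_eq_same]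
      have := hji rfl
      omega
    · rwa [Finsupp.single_eq_of_ne hne, tsub_zero]
  by_cases hiI : i ∈ I
  · obtain ⟨j, hj, hmj⟩ := hI m hm
    exact ⟨j, hj, hmj, fun h => absurd (h ▸ hiI) hj⟩
  · have hl : ¬ LinearOff I i m := fun h => hi (mem_linearVars.mpr ⟨hiI, m, hm, h⟩)
    by_cases h1 : m i = 1
    · have : ∃ k ∉ I, k ≠ i ∧ m k ≠ 0 := by
        by_contra! hcon
        exact hl ⟨h1, hcon⟩
      obtain ⟨k, hk, hki, hmk⟩ := this
      exact ⟨k, hk, hmk, fun h => absurd h hki⟩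
    · exact ⟨i, hiI, hmi, fun _ => h1⟩

theorem IsolatedCriticalPointAtZero.card_le_card_linearVars {d : ℕ}
    {f : MvPolynomial (Fin d) ℂ} (hiso : IsolatedCriticalPointAtZero f) {I : Finset (Fin d)}
    (hI : ∀ m ∈ f.support, ∃ j ∉ I, m j ≠ 0) : I.card ≤ (linearVars f I).card := by
  classical
  let s : Finset (MvPolynomial (Fin d) ℂ) :=
    Iᶜ.image X ∪ (linearVars f I).image fun i => pderiv i f
  have hprime : (RingHom.ker (eval (0 : Fin d → ℂ))).IsPrime := RingHom.ker_isPrime _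
  have hker : ∀ Q : Ideal (MvPolynomial (Fin d) ℂ), (∀ i, X i ∈ Q) →
      RingHom.ker (eval (0 : Fin d → ℂ)) ≤ Q := by
    intro Q hQ p hp
    have h1 : p ∈ Ideal.span (X '' Set.univ : Set (MvPolynomial (Fin d) ℂ)) := by
      rw [mem_ideal_span_X_image]
      intro m hm
      by_contra! h0
      obtain rfl : m = 0 := Finsupp.ext fun i => h0 i trivial
      refine mem_support_iff.mp hm ?_
      rw [← constantCoeff_eq, ← eval_zero]
      exact hp
    refine Ideal.span_le.mpr ?_ h1
    rintro _ ⟨i, -, rfl⟩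
    exact hQ i
  have hmin : RingHom.ker (eval (0 : Fin d → ℂ)) ∈
      (Ideal.span (s : Set (MvPolynomial (Fin d) ℂ))).minimalPrimes := by
    refine ⟨⟨hprime, Ideal.span_le.mpr ?_⟩, fun Q hQ hQ0 => ?_⟩
    · intro p hp
      rw [Finset.mem_coe, Finset.mem_union, Finset.mem_image, Finset.mem_image] at hp
      rw [SetLike.mem_coe, RingHom.mem_ker]
      obtain ⟨i, -, rfl⟩ | ⟨i, -, rfl⟩ := hp
      · simp
      · exact hiso.1 i
    · have := hQ.1
      have hX : ∀ i ∉ I, (X i : MvPolynomial (Fin d) ℂ) ∈ Q := fun i hi =>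
        hQ.2 (Ideal.subset_span (Finset.mem_union_left _ (Finset.mem_image_of_mem _ (by simpa))))
      refine hker Q (hiso.X_mem_of_jacobianIdeal_le hQ0 (Ideal.span_le.mpr ?_))
      rintro _ ⟨i, rfl⟩
      by_cases hi : i ∈ linearVars f I
      · exact hQ.2 (Ideal.subset_span (Finset.mem_union_right _ (Finset.mem_image_of_mem _ hi)))
      · refine (Ideal.span_le.mpr ?_) (pderiv_mem_span_X_compl hI hi)
        rintro _ ⟨j, hj, rfl⟩
        exact hX j (by simpa using hj)
  have h1 := (le_height_ker_eval_zero d).trans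
    (Ideal.height_le_card_of_mem_minimalPrimes_span_finset hmin)
  have h2 : s.card ≤ (d - I.card) + (linearVars f I).card := by
    refine (Finset.card_union_le _ _).trans (add_le_add ?_ Finset.card_image_le)
    simpa [Finset.card_compl] using (Finset.card_image_le (s := Iᶜ)
      (f := (X : Fin d → MvPolynomial (Fin d) ℂ)))
  have h3 : I.card ≤ d := by simpa using I.card_le_univ
  have h4 : d ≤ s.card := by exact_mod_cast h1
  omega

theorem milnor_eq_of_newtonPolygon_eq {d : ℕ} {f f' : MvPolynomial (Fin d) ℂ}
    (hf0 : eval (0 : Fin d → ℂ) f = 0) (hf'0 : eval (0 : Fin d → ℂ) f' = 0)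
    (hnd : NonDegenerate f) (hnd' : NonDegenerate f')
    (hiso : IsolatedCriticalPointAtZero f) (hiso' : IsolatedCriticalPointAtZero f')
    (hNP : NewtonPolygon f = NewtonPolygon f') : milnor f = milnor f' := by
  obtain ⟨N₁, h1⟩ := hiso.exists_milnor_eq_truncatedMilnor
  obtain ⟨N₂, h2⟩ := hiso'.exists_milnor_eq_truncatedMilnor
  obtain ⟨N₃, h3⟩ := exists_truncatedMilnor_eq
    (fun Q hQ hQn hF => hnd.X_mem_of_pencilJacobian_mem hf0 (dominatesSupport_sub hNP)
      (fun I _ hI => hiso.card_le_card_linearVars hI) hQ hQn hF)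
    (fun Q hQ hQn hF => hnd'.X_mem_of_pencilJacobian_mem hf'0 (dominatesSupport_sub hNP.symm)
      (fun I _ hI => hiso'.card_le_card_linearVars hI) hQ hQn hF)
  rw [h1 (max N₁ (max N₂ N₃)) (by omega), h2 (max N₁ (max N₂ N₃)) (by omega),
    h3 (max N₁ (max N₂ N₃)) (by omega)]

/-- If `f, f'` vanish at the origin, are non-degenerate, have an isolated critical
point at the origin and the same Newton polygon, then `μ(f) = μ(f')`.  In particular,
for a family `f_t = f + Σ_j θ_j(t)·h_j` of non-degenerate polynomials vanishing at
`0`, with an isolated critical point at `0` and constant Newton polygon, the Milnor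
number `μ(f_t)` is independent of `t`. -/
theorem milnor_eq_of_same_newton_polygon {d : ℕ} (f f' : MvPolynomial (Fin d) ℂ)
    (hf0 : eval (0 : Fin d → ℂ) f = 0) (hf'0 : eval (0 : Fin d → ℂ) f' = 0)
    (hnd : NonDegenerate f) (hnd' : NonDegenerate f')
    (hiso : IsolatedCriticalPointAtZero f) (hiso' : IsolatedCriticalPointAtZero f')
    (hNP : NewtonPolygon f = NewtonPolygon f') :
    milnor f = milnor f' ∧
    ∀ (r : ℕ) (θ : Fin r → ℂ → ℂ) (h : Fin r → MvPolynomial (Fin d) ℂ),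
      (∀ t : ℂ,
        eval (0 : Fin d → ℂ) (f + ∑ j, C (θ j t) * h j) = 0 ∧
        NonDegenerate (f + ∑ j, C (θ j t) * h j) ∧
        IsolatedCriticalPointAtZero (f + ∑ j, C (θ j t) * h j) ∧
        NewtonPolygon (f + ∑ j, C (θ j t) * h j) = NewtonPolygon f) →
      ∀ t t' : ℂ,
        milnor (f + ∑ j, C (θ j t) * h j) = milnor (f + ∑ j, C (θ j t') * h j) := by
  refine ⟨milnor_eq_of_newtonPolygon_eq hf0 hf'0 hnd hnd' hiso hiso' hNP, fun r θ h H t t' => ?_⟩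
  obtain ⟨h0, h1, h2, h3⟩ := H t
  obtain ⟨h0', h1', h2', h3'⟩ := H t'
  exact milnor_eq_of_newtonPolygon_eq h0 h0' h1 h1' h2 h2' (h3.trans h3'.symm)

end
end
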